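/- arXiv:math/9811139 — 2 statements merged into one kernel-verified Lean document; each statement's English description precedes it below -/
import Mathlib

section
/- Horizontal composition of 2-morphisms in the 2-category T of 2-tangles is well defined: if α : f ⇒ f' and β : g ⇒ g' are 2-morphisms of T with f, f' : A → B and g, g' : B → C, represented by generic 2-tangles chosen so that α ∩ I₁×I₂×{1}×I₄ = β ∩ I₁×I₂×{0}×I₄, the representative of α has a product structure in the z direction for z ∈ [1/4,1], and that of β has a product structure for z ∈ [0,3/4], then the equivalence class of the glued 2-tangle (α ∩ I₁×I₂×[0,1/2]×I₄) ∪ (β ∩ I₁×I₂×[1/2,1]×I₄) is independent of all choices of representatives. -/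
/-! ## Geometry of tangles and 2-tangles (after Baez–Langford, HDA IV) -/

noncomputable section
open Set

namespace HDA4

abbrev Pt2 := ℝ × ℝ
abbrev Pt3 := ℝ × ℝ × ℝ
abbrev Pt4 := ℝ × ℝ × ℝ × ℝ

/-- The unit interval `[0,1]`. -/
def II : Set ℝ := Icc 0 1
/-- The unit square `I₁ × I₂`. -/
def sq : Set Pt2 := II ×ˢ II
/-- The unit cube `I₁ × I₂ × I₃`. -/
def cube : Set Pt3 := II ×ˢ II ×ˢ II
/-- The unit 4-cube `I₁ × I₂ × I₃ × I₄`. -/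
def cube4 : Set Pt4 := II ×ˢ II ×ˢ II ×ˢ II

def x3 (p : Pt3) : ℝ := p.1
def y3 (p : Pt3) : ℝ := p.2.1
def z3 (p : Pt3) : ℝ := p.2.2
def x4 (p : Pt4) : ℝ := p.1
def y4 (p : Pt4) : ℝ := p.2.1
def z4 (p : Pt4) : ℝ := p.2.2.1
def t4 (p : Pt4) : ℝ := p.2.2.2

/-- A generic finite subset of the square: finite, contained in the interior,
with no two points sharing the same `y` coordinate. -/
structure IsGenericSubset (A : Set Pt2) : Prop where
  finite : A.Finite
  interior : A ⊆ Ioo (0:ℝ) 1 ×ˢ Ioo (0:ℝ) 1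
  injY : InjOn Prod.snd A

/-- An ambient isotopy of the square: a smooth family of diffeomorphisms of `I₁ × I₂`. -/
structure SquareIsotopy (H : Pt2 → ℝ → Pt2) : Prop where
  smooth : ContDiff ℝ (⊤ : ℕ∞) fun q : Pt2 × ℝ => H q.1 q.2
  mapsTo : ∀ s ∈ II, MapsTo (fun p => H p s) sq sq
  diffeo : ∀ s ∈ II, ∃ G : Pt2 → Pt2, ContDiff ℝ (⊤ : ℕ∞) G ∧ InvOn G (fun p => H p s) sq sq

/-- Level preserving: a fiber isotopy for the bundle `I₁ × I₂ → I₂`. -/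
def LevelPreserving2 (H : Pt2 → ℝ → Pt2) : Prop :=
  ∀ s ∈ II, ∀ p q : Pt2, p.2 = q.2 → (H p s).2 = (H q s).2

/-- Equivalence of generic finite subsets of the square. -/
def SubsetEquiv (A B : Set Pt2) : Prop :=
  ∃ H, SquareIsotopy H ∧ LevelPreserving2 H ∧
    (fun p => H p 0) '' A = A ∧ (fun p => H p 1) '' A = B

/-- A smooth regular local parametrization of `T` through `p`. -/
def LocalCurveAt (T : Set Pt3) (p : Pt3) (γ : ℝ → Pt3) (δ : ℝ) : Prop :=
  0 < δ ∧ γ 0 = p ∧ ContDiff ℝ (⊤ : ℕ∞) γ ∧ deriv γ 0 ≠ 0 ∧ ∀ t ∈ Ioo (-δ) δ, γ t ∈ T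

/-- A tangle: a compact 1-manifold with boundary smoothly embedded in
`int(I₁ × I₂) × I₃`, with boundary in `int(I₁ × I₂) × {0,1}` and a product
structure near the top and the bottom. -/
structure IsTangle (T : Set Pt3) : Prop where
  compact : IsCompact T
  subset : T ⊆ Ioo (0:ℝ) 1 ×ˢ Ioo (0:ℝ) 1 ×ˢ II
  manifold : ∀ p ∈ T, ∃ (U : Set Pt3) (γ : ℝ → Pt3) (J : Set ℝ),
    IsOpen U ∧ p ∈ U ∧ ContDiff ℝ (⊤ : ℕ∞) γ ∧ InjOn γ J ∧
    (∀ t ∈ J, deriv γ t ≠ 0) ∧ (J = Ioo (-1:ℝ) 1 ∨ J = Ico (0:ℝ) 1) ∧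
    (0:ℝ) ∈ J ∧ γ 0 = p ∧ T ∩ U = γ '' J
  boundary : ∀ p ∈ T,
    (¬ ∃ (U : Set Pt3) (γ : ℝ → Pt3), IsOpen U ∧ p ∈ U ∧ ContDiff ℝ (⊤ : ℕ∞) γ ∧
        InjOn γ (Ioo (-1:ℝ) 1) ∧ (∀ t ∈ Ioo (-1:ℝ) 1, deriv γ t ≠ 0) ∧
        γ 0 = p ∧ T ∩ U = γ '' Ioo (-1:ℝ) 1) → z3 p = 0 ∨ z3 p = 1
  product : ∃ ε > 0, ∀ x y : ℝ, ∀ z ∈ II, ∀ z' ∈ II,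
    ((z ≤ ε ∧ z' ≤ ε) ∨ (1 - ε ≤ z ∧ 1 - ε ≤ z')) →
    ((x, y, z) ∈ T ↔ (x, y, z') ∈ T)

/-- Projection of the cube onto the square `I₂ × I₃` (the plane of the diagram). -/
def pYZ (p : Pt3) : Pt2 := (p.2.1, p.2.2)

/-- A generic tangle: the projection to `I₂ × I₃` is an embedding except for
finitely many transverse double points (crossings), the critical points of the
height function `z` are nondegenerate local extrema, and all crossings and
critical points occur at distinct heights. -/
def IsGenericTangle (T : Set Pt3) : Prop :=
  IsTangle T ∧
  ∃ (Cr : Finset Pt2) (Ex : Finset Pt3),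
    (Ex : Set Pt3) ⊆ T ∧
    InjOn pYZ (T \ pYZ ⁻¹' (Cr : Set Pt2)) ∧
    (∀ c ∈ Cr, ∃ p q : Pt3, p ≠ q ∧ T ∩ pYZ ⁻¹' {c} = {p, q} ∧
      ∃ (γp γq : ℝ → Pt3) (δ : ℝ), LocalCurveAt T p γp δ ∧ LocalCurveAt T q γq δ ∧
        LinearIndependent ℝ ![pYZ (deriv γp 0), pYZ (deriv γq 0)]) ∧
    (∀ p ∈ T, (p ∈ Ex ↔ ∃ γ δ, LocalCurveAt T p γ δ ∧ deriv (fun t => z3 (γ t)) 0 = 0)) ∧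
    (∀ p ∈ Ex, ∀ γ δ, LocalCurveAt T p γ δ →
      deriv (fun t => z3 (γ t)) 0 = 0 ∧ deriv (deriv fun t => z3 (γ t)) 0 ≠ 0) ∧
    InjOn Prod.snd (Cr : Set Pt2) ∧ InjOn z3 (Ex : Set Pt3) ∧
    ∀ c ∈ Cr, ∀ p ∈ Ex, c.2 ≠ z3 p

/-- An ambient isotopy of the cube. -/
structure CubeIsotopy (H : Pt3 → ℝ → Pt3) : Prop where
  smooth : ContDiff ℝ (⊤ : ℕ∞) fun q : Pt3 × ℝ => H q.1 q.2
  mapsTo : ∀ s ∈ II, MapsTo (fun p => H p s) cube cube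
  diffeo : ∀ s ∈ II, ∃ G : Pt3 → Pt3, ContDiff ℝ (⊤ : ℕ∞) G ∧ InvOn G (fun p => H p s) cube cube

/-- An equivalence isotopy between generic tangles: level preserving for the
bundles `I₁×I₂×I₃ → I₂×I₃` and `I₁×I₂×I₃ → I₃`, with a product structure in a
neighborhood of `I₁ × I₂ × ∂I₃`. -/
structure TangleEquivIsotopy (H : Pt3 → ℝ → Pt3) : Prop where
  isotopy : CubeIsotopy H
  levelYZ : ∀ s ∈ II, ∀ p q : Pt3, pYZ p = pYZ q → pYZ (H p s) = pYZ (H q s)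
  levelZ : ∀ s ∈ II, ∀ p q : Pt3, z3 p = z3 q → z3 (H p s) = z3 (H q s)
  product : ∃ ε > 0, ∀ s ∈ II, ∀ x y : ℝ, ∀ z ∈ II,
    (z ≤ ε → H (x, y, z) s = (x3 (H (x, y, 0) s), y3 (H (x, y, 0) s), z)) ∧
    (1 - ε ≤ z → H (x, y, z) s = (x3 (H (x, y, 1) s), y3 (H (x, y, 1) s), z))

/-- Equivalence of generic tangles. -/
def TangleEquiv (T T' : Set Pt3) : Prop :=
  ∃ H, TangleEquivIsotopy H ∧ (∀ p, H p 0 = p) ∧ (fun p => H p 1) '' T = T'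

/-- The source set of a tangle. -/
def srcSet (T : Set Pt3) : Set Pt2 := {q : Pt2 | (q.1, q.2, (0:ℝ)) ∈ T}
/-- The target set of a tangle. -/
def tgtSet (T : Set Pt3) : Set Pt2 := {q : Pt2 | (q.1, q.2, (1:ℝ)) ∈ T}
/-- Gluing of tangles in the `z` direction:
`(T ∩ I₁×I₂×[0,1/2]) ∪ (T' ∩ I₁×I₂×[1/2,1])`. -/
def glueZ (T T' : Set Pt3) : Set Pt3 := {p ∈ T | z3 p ≤ 1/2} ∪ {p ∈ T' | 1/2 ≤ z3 p}
/-- A tangle has a product structure in the `z` direction on `[a,b]`. -/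
def ProductZOn (T : Set Pt3) (a b : ℝ) : Prop :=
  ∀ x y : ℝ, ∀ z ∈ Icc a b, ∀ z' ∈ Icc a b, ((x, y, z) ∈ T ↔ (x, y, z') ∈ T)
/-- The identity tangle `A × I₃` on a subset of the square. -/
def cylMor (A : Set Pt2) : Set Pt3 := {p : Pt3 | (x3 p, y3 p) ∈ A ∧ z3 p ∈ II}

/-- The slice of a subset of the 4-cube at `t = t₀`. -/
def tSlice (S : Set Pt4) (t : ℝ) : Set Pt3 := {p : Pt3 | (p.1, p.2.1, p.2.2, t) ∈ S}
/-- The source tangle of a 2-tangle. -/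
def srcTangle (S : Set Pt4) : Set Pt3 := tSlice S 0
/-- The target tangle of a 2-tangle. -/
def tgtTangle (S : Set Pt4) : Set Pt3 := tSlice S 1

/-- A 2-tangle: a compact 2-manifold with corners embedded in the 4-cube whose
boundary lies in `I₁×I₂×∂(I₃×I₄)`, meeting `I₁×I₂×I₃×∂I₄` in a pair of tangles
and `I₁×I₂×∂I₃×I₄` in finitely many straight lines, with a product structure
near the boundary. -/
structure IsTwoTangle (S : Set Pt4) : Prop where
  compact : IsCompact S
  subset : S ⊆ cube4
  manifold : ∀ p ∈ S, ∃ (U : Set Pt4) (φ : Pt2 → Pt4) (J : Set Pt2),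
    IsOpen U ∧ p ∈ U ∧ ContDiff ℝ (⊤ : ℕ∞) φ ∧ InjOn φ J ∧
    (J = Ioo (-1:ℝ) 1 ×ˢ Ioo (-1:ℝ) 1 ∨ J = Ioo (-1:ℝ) 1 ×ˢ Ico (0:ℝ) 1 ∨
      J = Ico (0:ℝ) 1 ×ˢ Ico (0:ℝ) 1) ∧
    ((0:ℝ), (0:ℝ)) ∈ J ∧ φ (0, 0) = p ∧ S ∩ U = φ '' J ∧
    ∀ q ∈ J, LinearIndependent ℝ ![fderiv ℝ φ q (1, 0), fderiv ℝ φ q (0, 1)]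
  endTangles : IsTangle (tSlice S 0) ∧ IsTangle (tSlice S 1)
  sides : ∃ L : Finset Pt3, (∀ q ∈ L, z3 q = 0 ∨ z3 q = 1) ∧
    {p ∈ S | z4 p = 0 ∨ z4 p = 1} =
      {p : Pt4 | (x4 p, y4 p, z4 p) ∈ (L : Set Pt3) ∧ t4 p ∈ II}
  productZ : ∃ ε > 0, ∀ x y t : ℝ, ∀ z ∈ II, ∀ z' ∈ II,
    ((z ≤ ε ∧ z' ≤ ε) ∨ (1 - ε ≤ z ∧ 1 - ε ≤ z')) →
    ((x, y, z, t) ∈ S ↔ (x, y, z', t) ∈ S)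
  productT : ∃ ε > 0, ∀ x y z : ℝ, ∀ t ∈ II, ∀ t' ∈ II,
    ((t ≤ ε ∧ t' ≤ ε) ∨ (1 - ε ≤ t ∧ 1 - ε ≤ t')) →
    ((x, y, z, t) ∈ S ↔ (x, y, z, t') ∈ S)

/-- A generic 2-tangle: its constant-`t` slices are generic tangles except for
finitely many values of `t` (at which exactly one of Carter–Rieger–Saito's
elementary string interactions occurs). -/
def IsGenericTwoTangle (S : Set Pt4) : Prop :=
  IsTwoTangle S ∧ ∃ F : Finset ℝ, (F : Set ℝ) ⊆ II ∧
    ∀ t ∈ II \ (F : Set ℝ), IsGenericTangle (tSlice S t)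

def p123 (p : Pt4) : Pt3 := (p.1, p.2.1, p.2.2.1)
def emb3 (p : Pt3) (t : ℝ) : Pt4 := (p.1, p.2.1, p.2.2, t)

/-- An ambient isotopy of the 4-cube. -/
structure CubeIsotopy4 (H : Pt4 → ℝ → Pt4) : Prop where
  smooth : ContDiff ℝ (⊤ : ℕ∞) fun q : Pt4 × ℝ => H q.1 q.2
  mapsTo : ∀ s ∈ II, MapsTo (fun p => H p s) cube4 cube4
  diffeo : ∀ s ∈ II, ∃ G : Pt4 → Pt4, ContDiff ℝ (⊤ : ℕ∞) G ∧ InvOn G (fun p => H p s) cube4 cube4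

/-- An equivalence isotopy between generic 2-tangles (Definition 4 of HDA IV):
restrictions at `t = 0,1` are equivalence isotopies of generic tangles,
restrictions at `z = 0,1` are level preserving, and the whole isotopy has a
product structure near `I₁ × I₂ × ∂(I₃ × I₄)`. -/
structure TwoTangleEquivIsotopy (H : Pt4 → ℝ → Pt4) : Prop where
  isotopy : CubeIsotopy4 H
  productT : ∃ ε > 0, ∀ s ∈ II, ∀ x y z : ℝ, ∀ t ∈ II,
    (t ≤ ε → H (x, y, z, t) s =
      (x4 (H (x, y, z, 0) s), y4 (H (x, y, z, 0) s), z4 (H (x, y, z, 0) s), t)) ∧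
    (1 - ε ≤ t → H (x, y, z, t) s =
      (x4 (H (x, y, z, 1) s), y4 (H (x, y, z, 1) s), z4 (H (x, y, z, 1) s), t))
  productZ : ∃ ε > 0, ∀ s ∈ II, ∀ x y t : ℝ, ∀ z ∈ II,
    (z ≤ ε → H (x, y, z, t) s =
      (x4 (H (x, y, 0, t) s), y4 (H (x, y, 0, t) s), z, t4 (H (x, y, 0, t) s))) ∧
    (1 - ε ≤ z → H (x, y, z, t) s =
      (x4 (H (x, y, 1, t) s), y4 (H (x, y, 1, t) s), z, t4 (H (x, y, 1, t) s)))
  endEquiv : ∀ t₀ : ℝ, t₀ = 0 ∨ t₀ = 1 →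
    TangleEquivIsotopy fun p s => p123 (H (emb3 p t₀) s)
  levelSides : ∀ z₀ : ℝ, z₀ = 0 ∨ z₀ = 1 → ∀ s ∈ II, ∀ p q : Pt4,
    z4 p = z₀ → z4 q = z₀ →
    ((y4 p, t4 p) = (y4 q, t4 q) → (y4 (H p s), t4 (H p s)) = (y4 (H q s), t4 (H q s))) ∧
    (t4 p = t4 q → t4 (H p s) = t4 (H q s))

/-- Equivalence of generic 2-tangles. -/
def TwoTangleEquiv (S S' : Set Pt4) : Prop :=
  ∃ H, TwoTangleEquivIsotopy H ∧ (∀ p, H p 0 = p) ∧ (fun p => H p 1) '' S = S'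

/-- Gluing of 2-tangles in the `t` direction (vertical composition). -/
def glueT (S S' : Set Pt4) : Set Pt4 := {p ∈ S | t4 p ≤ 1/2} ∪ {p ∈ S' | 1/2 ≤ t4 p}
/-- Gluing of 2-tangles in the `z` direction (horizontal composition). -/
def glueZ4 (S S' : Set Pt4) : Set Pt4 := {p ∈ S | z4 p ≤ 1/2} ∪ {p ∈ S' | 1/2 ≤ z4 p}
/-- A 2-tangle has a product structure in the `t` direction on `[a,b]`. -/
def ProductTOn (S : Set Pt4) (a b : ℝ) : Prop :=
  ∀ x y z : ℝ, ∀ t ∈ Icc a b, ∀ t' ∈ Icc a b, ((x, y, z, t) ∈ S ↔ (x, y, z, t') ∈ S)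
/-- A 2-tangle has a product structure in the `z` direction on `[a,b]`. -/
def ProductZOn4 (S : Set Pt4) (a b : ℝ) : Prop :=
  ∀ x y t : ℝ, ∀ z ∈ Icc a b, ∀ z' ∈ Icc a b, ((x, y, z, t) ∈ S ↔ (x, y, z', t) ∈ S)
/-- The identity 2-tangle `T × I₄` on a tangle `T`. -/
def cylCell (T : Set Pt3) : Set Pt4 := {p : Pt4 | (x4 p, y4 p, z4 p) ∈ T ∧ t4 p ∈ II}
/-- The identity 2-tangle `A × I₃ × I₄` on a subset `A` of the square. -/
def cylObj2 (A : Set Pt2) : Set Pt4 := {p : Pt4 | (x4 p, y4 p) ∈ A ∧ z4 p ∈ II ∧ t4 p ∈ II}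

/-- The 2-tangle traced out by an isotopy `H` applied to a tangle `U`:
`{(H(x,y,z,s),s) : (x,y,z) ∈ U}`. -/
def traceSurf (H : Pt3 → ℝ → Pt3) (U : Set Pt3) : Set Pt4 :=
  {q : Pt4 | ∃ p ∈ U, ∃ s ∈ II, q = emb3 (H p s) s}

/-- A 2-tangle which is traced out by an ambient isotopy of the cube applied to
a generic tangle; such a 2-tangle always represents a 2-isomorphism, with
inverse traced out by the reverse isotopy. -/
def IsIsotopyTrace (S : Set Pt4) : Prop :=
  ∃ H U, CubeIsotopy H ∧ (∀ p, H p 0 = p) ∧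
    (∃ ε > 0, ∀ p, (∀ s ∈ Icc (0:ℝ) ε, H p s = H p 0) ∧ ∀ s ∈ Icc (1-ε) 1, H p s = H p 1) ∧
    IsGenericTangle U ∧ S = traceSurf H U

/-- Reflection of the square in the `y` direction (duals of objects). -/
def reflY2 (A : Set Pt2) : Set Pt2 := {p : Pt2 | (p.1, 1 - p.2) ∈ A}
/-- Reflection of the cube in the `z` direction (duals of 1-morphisms). -/
def reflZ3 (T : Set Pt3) : Set Pt3 := {p : Pt3 | (p.1, p.2.1, 1 - p.2.2) ∈ T}
/-- Reflection of the 4-cube in the `t` direction (duals of 2-morphisms). -/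
def reflT4 (S : Set Pt4) : Set Pt4 := {p : Pt4 | (p.1, p.2.1, p.2.2.1, 1 - p.2.2.2) ∈ S}

end HDA4
namespace HDA4

/-- A smooth map that is injective and immersive on a compact set of a finite-dimensional
space has a globally defined smooth left inverse on that set. -/
theorem exists_contDiff_leftInvOn {E : Type*} [NormedAddCommGroup E] [NormedSpace ℝ E]
    [FiniteDimensional ℝ E] {h : E → E} (hh : ContDiff ℝ (⊤ : ℕ∞) h) {Q : Set E}
    (hQ : IsCompact Q) (hinj : InjOn h Q)
    (hD : ∀ p ∈ Q, Function.Injective (fderiv ℝ h p)) :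
    ∃ G : E → E, ContDiff ℝ (⊤ : ℕ∞) G ∧ LeftInvOn G h Q := by
  classical
  have hne : ((⊤ : ℕ∞) : WithTop ℕ∞) ≠ 0 := by simp
  have hequiv : ∀ p, Function.Injective (fderiv ℝ h p) →
      ∃ e : E ≃L[ℝ] E, HasStrictFDerivAt h (e : E →L[ℝ] E) p := by
    intro p hp
    refine ⟨(LinearEquiv.ofInjectiveEndo (fderiv ℝ h p : E →ₗ[ℝ] E) hp).toContinuousLinearEquiv, ?_⟩
    convert (hh.contDiffAt (x := p)).hasStrictFDerivAt hne using 1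
    ext v; rfl
  have hloc : ∀ p ∈ Q, ∃ u ∈ nhds p, InjOn h u := by
    intro p hp
    obtain ⟨e, he⟩ := hequiv p (hD p hp)
    exact ⟨_, he.eventually_left_inverse, fun a ha b hb hab => by
      rw [← ha.out, ← hb.out, hab]⟩
  obtain ⟨t, ht, htinj⟩ := hinj.exists_mem_nhdsSet hQ (fun x _ => hh.continuous.continuousAt) hloc
  obtain ⟨V, hVo, hQV, hVt⟩ := mem_nhdsSet_iff_exists.1 ht
  have hopenD : IsOpen {p | Function.Injective (fderiv ℝ h p)} := by
    have : {p | Function.Injective (fderiv ℝ h p)} = (fderiv ℝ h) ⁻¹' {u | IsUnit u} := by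
      ext p
      simp only [mem_ofPred_eq, mem_preimage]
      constructor
      · intro hp
        refine ⟨ContinuousLinearEquiv.toUnit
          (LinearEquiv.ofInjectiveEndo (fderiv ℝ h p : E →ₗ[ℝ] E) hp).toContinuousLinearEquiv, ?_⟩
        ext v; rfl
      · rintro ⟨u, hu⟩
        rw [← hu]
        intro a b hab
        have := congrArg (fun v => (↑u⁻¹ : E →L[ℝ] E) v) hab
        simpa [← mul_apply_eq_comp] using this
    rw [this]
    have : CompleteSpace E := FiniteDimensional.complete ℝ E
    exact Units.isOpen.preimage (hh.continuous_fderiv (by simp))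
  set U := V ∩ {p | Function.Injective (fderiv ℝ h p)} with hU
  have hUo : IsOpen U := hVo.inter hopenD
  have hQU : Q ⊆ U := fun p hp => ⟨hQV hp, hD p hp⟩
  have hUinj : InjOn h U := htinj.mono (inter_subset_left.trans hVt)
  have : CompleteSpace E := FiniteDimensional.complete ℝ E
  have hWo : IsOpen (h '' U) := by
    rw [isOpen_iff_mem_nhds]
    rintro _ ⟨p, hp, rfl⟩
    obtain ⟨e, he⟩ := hequiv p hp.2
    rw [← he.map_nhds_eq_of_equiv]
    exact Filter.image_mem_map (hUo.mem_nhds hp)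
  set g := Function.invFunOn h U with hg
  have hgl : ∀ p ∈ U, g (h p) = p := fun p hp => hUinj.leftInvOn_invFunOn hp
  have hgs : ContDiffOn ℝ (⊤ : ℕ∞) g (h '' U) := by
    rintro _ ⟨p, hp, rfl⟩
    obtain ⟨e, he⟩ := hequiv p hp.2
    have hc := (hh.contDiffAt (x := p)).to_localInverse he.hasFDerivAt hne
    refine (hc.congr_of_eventuallyEq ?_).contDiffWithinAt
    have h1 : ∀ᶠ x in nhds p, g (h x) = x := by
      filter_upwards [hUo.mem_nhds hp] with x hx using hgl x hx
    exact (((hh.contDiffAt (x := p)).hasStrictFDerivAt' he.hasFDerivAt hne).localInverse_unique h1)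
  obtain ⟨χ, hχ0, hχ1, -⟩ := exists_contMDiffMap_zero_one_nhds_of_isClosed
    (n := (⊤ : ℕ∞)) (modelWithCornersSelf ℝ E) hWo.isClosed_compl (hQ.image hh.continuous).isClosed
    (disjoint_compl_left_iff_subset.2 (image_mono hQU))
  have hχs : ContDiff ℝ (⊤ : ℕ∞) (χ : E → ℝ) := χ.contMDiff.contDiff
  refine ⟨fun q => χ q • g q, ?_, ?_⟩
  · rw [contDiff_iff_contDiffAt]
    intro q
    by_cases hq : q ∈ h '' U
    · exact hχs.contDiffAt.smul (hgs.contDiffAt (hWo.mem_nhds hq))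
    · have : (fun q => χ q • g q) =ᶠ[nhds q] fun _ => 0 := by
        have h2 : ∀ᶠ x in nhds q, χ x = 0 := by
          rw [eventually_nhdsSet_iff_forall] at hχ0
          exact hχ0 q hq
        filter_upwards [h2] with x hx
        simp [hx]
      exact contDiffAt_const.congr_of_eventuallyEq this
  · intro p hp
    have h1 : χ (h p) = 1 := by
      rw [eventually_nhdsSet_iff_forall] at hχ1
      exact (hχ1 (h p) ⟨p, hp, rfl⟩).self_of_nhds
    simp [h1, hgl p (hQU hp)]

/-- Criterion for the existence of a smooth inverse in the sense of `InvOn` on a set `K`. -/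
theorem exists_contDiff_invOn {E : Type*} [NormedAddCommGroup E] [NormedSpace ℝ E]
    [FiniteDimensional ℝ E] {h : E → E} (hh : ContDiff ℝ (⊤ : ℕ∞) h) {Q K : Set E}
    (hQ : IsCompact Q) (hinj : InjOn h Q)
    (hD : ∀ p ∈ Q, Function.Injective (fderiv ℝ h p)) (hKQ : K ⊆ Q) (hKh : K ⊆ h '' Q) :
    ∃ G : E → E, ContDiff ℝ (⊤ : ℕ∞) G ∧ InvOn G h K K := by
  obtain ⟨G, hG, hGl⟩ := exists_contDiff_leftInvOn hh hQ hinj hD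
  refine ⟨G, hG, fun p hp => hGl (hKQ hp), fun q hq => ?_⟩
  obtain ⟨p, hp, rfl⟩ := hKh hq
  rw [hGl hp]

section Zone
variable {E : Type*} [NormedAddCommGroup E] [NormedSpace ℝ E] {h G : E → E} {K : Set E}
  {l : E →L[ℝ] ℝ} {a b : ℝ}

/-- If `h` preserves the levels of `l` in `[a,b]`, then so does any inverse of `h`. -/
theorem level_inverse_eq (hK : Convex ℝ K) (hG : Continuous G) (hm : MapsTo h K K)
    (hinv : InvOn G h K K) (hz : ∀ p, l p ∈ Icc a b → l (h p) = l p)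
    {p₀ : E} (hp₀ : p₀ ∈ K) (hl₀ : l p₀ ∈ Ioo a b) {q : E} (hq : q ∈ K) (hlq : l q ∈ Icc a b) :
    l (G q) = l q := by
  have key : ∀ q ∈ K, l (G q) ∈ Icc a b → l (G q) = l q := fun q hq hl => by
    rw [← hz _ hl, hinv.2 hq]
  have hlevel : ∀ q ∈ K, l q ∈ Ioo a b → l (G q) = l q := by
    set V := K ∩ l ⁻¹' Ioo a b with hV
    have hVc : IsPreconnected V :=
      (hK.inter ((convex_Ioo a b).linear_preimage l.toLinearMap)).isPreconnected
    have hcont : Continuous fun q => l (G q) := l.continuous.comp hG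
    by_contra hcon
    push Not at hcon
    obtain ⟨q, hqK, hq1, hq2⟩ := hcon
    have hne := hVc {q | l (G q) ∈ Ioo a b} {q | l (G q) ≠ l q}
      (isOpen_Ioo.preimage hcont) (isOpen_ne_fun hcont l.continuous)
      (fun x hx => by
        by_cases hxx : l (G x) = l x
        · left
          have : l x ∈ Ioo a b := hx.2
          change l (G x) ∈ Ioo a b
          rwa [hxx]
        · exact Or.inr hxx)
      ⟨h p₀, ⟨hm hp₀, by
        change l (h p₀) ∈ Ioo a b
        rwa [hz _ (Ioo_subset_Icc_self hl₀)]⟩, by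
        change l (G (h p₀)) ∈ Ioo a b
        rwa [hinv.1 hp₀]⟩
      ⟨q, ⟨hqK, hq1⟩, hq2⟩
    obtain ⟨x, hx, hx1, hx2⟩ := hne
    exact hx2 (key x hx.1 (Ioo_subset_Icc_self hx1))
  set c : ℝ → E := fun u => (1 - u) • q + u • p₀ with hc
  have hcc : Continuous c := by fun_prop
  have h1 : EqOn (fun u => l (G (c u))) (fun u => l (c u)) (Ioc 0 1) := by
    intro u hu
    have hcu : c u ∈ K := hK hq hp₀ (by linarith [hu.2]) hu.1.le (by ring)
    refine hlevel _ hcu ?_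
    simp only [hc, map_add, map_smul, smul_eq_mul]
    constructor
    · nlinarith [mul_nonneg (sub_nonneg.2 hu.2) (sub_nonneg.2 hlq.1), mul_pos hu.1 (sub_pos.2 hl₀.1)]
    · nlinarith [mul_nonneg (sub_nonneg.2 hu.2) (sub_nonneg.2 hlq.2), mul_pos hu.1 (sub_pos.2 hl₀.2)]
  have h2 := h1.closure (l.continuous.comp (hG.comp hcc)) (l.continuous.comp hcc)
  have h3 : (0 : ℝ) ∈ closure (Ioc (0:ℝ) 1) := by
    rw [closure_Ioc (by norm_num)]; simp
  simpa [hc] using h2 h3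

/-- A point of `K` below the zone `[a,b]` of preserved levels stays below it. -/
theorem level_lt_of_lt (hK : Convex ℝ K) (hG : Continuous G) (hm : MapsTo h K K)
    (hinv : InvOn G h K K) (hz : ∀ p, l p ∈ Icc a b → l (h p) = l p)
    {p₀ : E} (hp₀ : p₀ ∈ K) (hl₀ : l p₀ ∈ Ioo a b) (hb : ∀ q ∈ K, l q ≤ b)
    {p : E} (hp : p ∈ K) (hlp : l p < a) : l (h p) < a := by
  by_contra! hcon
  have := level_inverse_eq hK hG hm hinv hz hp₀ hl₀ (hm hp) ⟨hcon, hb _ (hm hp)⟩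
  rw [hinv.1 hp] at this
  linarith

/-- The inverse maps points of `K` below the zone `[a,b]` of preserved levels below it. -/
theorem level_inverse_lt_of_lt (hK : Convex ℝ K) (hG : Continuous G) (hm : MapsTo h K K)
    (hinv : InvOn G h K K) (hz : ∀ p, l p ∈ Icc a b → l (h p) = l p)
    {p₀ : E} (hp₀ : p₀ ∈ K) (hl₀ : l p₀ ∈ Ioo a b) (hb : ∀ q ∈ K, l q ≤ b)
    {q : E} (hq : q ∈ K) (hlq : l q < a) : l (G q) < a := by
  set V := K ∩ l ⁻¹' Iio a with hV
  have hVc : IsPreconnected V :=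
    (hK.inter ((convex_Iio a).linear_preimage l.toLinearMap)).isPreconnected
  have hcont : Continuous fun q => l (G q) := l.continuous.comp hG
  by_contra! hcon
  have hnot : ∀ x ∈ V, l (G x) ∉ Icc a b := by
    intro x hx hxx
    have h1 : l x < a := hx.2
    rw [← hinv.2 hx.1, hz _ hxx] at h1
    exact absurd hxx.1 (not_le.2 h1)
  obtain ⟨x, hx, hx1, hx2⟩ := hVc {q | l (G q) < a} {q | b < l (G q)}
    (isOpen_Iio.preimage hcont) (isOpen_Ioi.preimage hcont)
    (fun x hx => by
      have := hnot x hx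
      rw [mem_Icc, not_and_or, not_le, not_le] at this
      exact this)
    ⟨h q, ⟨hm hq, level_lt_of_lt hK hG hm hinv hz hp₀ hl₀ hb hq hlq⟩, by
      change l (G (h q)) < a
      rwa [hinv.1 hq]⟩
    ⟨q, ⟨hq, hlq⟩, by
      have := hnot q ⟨hq, hlq⟩
      rw [mem_Icc, not_and_or, not_le, not_le] at this
      rcases this with h | h
      · linarith
      · exact h⟩
  have h1 : l (G x) < a := hx1
  have h2 : b < l (G x) := hx2
  linarith [hl₀.1, hl₀.2]

/-- An inverse on a convex body has invertible derivative along the inverse image. -/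
theorem fderiv_injective_of_rightInvOn [FiniteDimensional ℝ E] (hK : Convex ℝ K)
    (hKi : (interior K).Nonempty) (hh : Differentiable ℝ h) (hG : Differentiable ℝ G)
    (hinv : RightInvOn G h K) {q : E} (hq : q ∈ K) :
    Function.Injective (fderiv ℝ h (G q)) := by
  have h1 : HasFDerivWithinAt (h ∘ G) ((fderiv ℝ h (G q)).comp (fderiv ℝ G q)) K q :=
    ((hh (G q)).hasFDerivAt.comp q (hG q).hasFDerivAt).hasFDerivWithinAt
  have h2 : HasFDerivWithinAt (h ∘ G) (ContinuousLinearMap.id ℝ E) K q :=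
    (hasFDerivWithinAt_id q K).congr (fun x hx => hinv hx) (hinv hq)
  have h3 := (uniqueDiffOn_convex hK hKi q hq).eq h1 h2
  have hsurj : Function.Surjective (fderiv ℝ h (G q) : E →ₗ[ℝ] E) := fun v =>
    ⟨fderiv ℝ G q v, by
      have := DFunLike.congr_fun h3 v
      simpa using this⟩
  exact LinearMap.injective_iff_surjective.2 hsurj

end Zone

/-- The coordinate `z` as a continuous linear functional. -/
def zL : Pt4 →L[ℝ] ℝ :=
  (ContinuousLinearMap.fst ℝ ℝ ℝ).comp
    ((ContinuousLinearMap.snd ℝ ℝ (ℝ × ℝ)).comp (ContinuousLinearMap.snd ℝ ℝ (ℝ × ℝ × ℝ)))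

/-- The coordinate `t` as a continuous linear functional. -/
def tL : Pt4 →L[ℝ] ℝ :=
  (ContinuousLinearMap.snd ℝ ℝ ℝ).comp
    ((ContinuousLinearMap.snd ℝ ℝ (ℝ × ℝ)).comp (ContinuousLinearMap.snd ℝ ℝ (ℝ × ℝ × ℝ)))

theorem zL_apply (p : Pt4) : zL p = z4 p := rfl
theorem tL_apply (p : Pt4) : tL p = t4 p := rfl

theorem mem_cube4 {p : Pt4} : p ∈ cube4 ↔ x4 p ∈ II ∧ y4 p ∈ II ∧ z4 p ∈ II ∧ t4 p ∈ II :=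
  Iff.rfl

theorem pt4_ext {p q : Pt4} (h1 : x4 p = x4 q) (h2 : y4 p = y4 q) (h3 : z4 p = z4 q)
    (h4 : t4 p = t4 q) : p = q :=
  Prod.ext h1 (Prod.ext h2 (Prod.ext h3 h4))

theorem zero_mem_II : (0 : ℝ) ∈ II := ⟨le_rfl, zero_le_one⟩
theorem one_mem_II : (1 : ℝ) ∈ II := ⟨zero_le_one, le_rfl⟩

theorem convex_cube4 : Convex ℝ cube4 :=
  (convex_Icc _ _).prod ((convex_Icc _ _).prod ((convex_Icc _ _).prod (convex_Icc _ _)))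

theorem isCompact_cube4 : IsCompact cube4 :=
  isCompact_Icc.prod (isCompact_Icc.prod (isCompact_Icc.prod isCompact_Icc))

theorem interior_cube4_nonempty : (interior cube4).Nonempty := by
  refine ⟨(1/2, 1/2, 1/2, 1/2), ?_⟩
  simp only [cube4, II, interior_prod_eq, interior_Icc, mem_prod]
  norm_num

/-- A repackaging of `TwoTangleEquivIsotopy` in terms of the 4-dimensional map only. -/
structure Good (H : Pt4 → ℝ → Pt4) : Prop where
  smooth : ContDiff ℝ (⊤ : ℕ∞) fun q : Pt4 × ℝ => H q.1 q.2
  mapsTo : ∀ s ∈ II, MapsTo (fun p => H p s) cube4 cube4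
  diffeo : ∀ s ∈ II, ∃ G : Pt4 → Pt4, ContDiff ℝ (⊤ : ℕ∞) G ∧ InvOn G (fun p => H p s) cube4 cube4
  productT : ∃ ε > 0, ∀ s ∈ II, ∀ x y z : ℝ, ∀ t ∈ II,
    (t ≤ ε → H (x, y, z, t) s =
      (x4 (H (x, y, z, 0) s), y4 (H (x, y, z, 0) s), z4 (H (x, y, z, 0) s), t)) ∧
    (1 - ε ≤ t → H (x, y, z, t) s =
      (x4 (H (x, y, z, 1) s), y4 (H (x, y, z, 1) s), z4 (H (x, y, z, 1) s), t))
  productZ : ∃ ε > 0, ∀ s ∈ II, ∀ x y t : ℝ, ∀ z ∈ II,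
    (z ≤ ε → H (x, y, z, t) s =
      (x4 (H (x, y, 0, t) s), y4 (H (x, y, 0, t) s), z, t4 (H (x, y, 0, t) s))) ∧
    (1 - ε ≤ z → H (x, y, z, t) s =
      (x4 (H (x, y, 1, t) s), y4 (H (x, y, 1, t) s), z, t4 (H (x, y, 1, t) s)))
  levelEnds : ∀ t₀ : ℝ, t₀ = 0 ∨ t₀ = 1 → ∀ s ∈ II, ∀ y z x x' : ℝ,
    y4 (H (x, y, z, t₀) s) = y4 (H (x', y, z, t₀) s)
  levelEndsZ : ∀ t₀ : ℝ, t₀ = 0 ∨ t₀ = 1 → ∀ s ∈ II, ∀ z x x' y y' : ℝ,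
    z4 (H (x, y, z, t₀) s) = z4 (H (x', y', z, t₀) s)
  levelSides : ∀ z₀ : ℝ, z₀ = 0 ∨ z₀ = 1 → ∀ s ∈ II, ∀ y t x x' : ℝ,
    y4 (H (x, y, z₀, t) s) = y4 (H (x', y, z₀, t) s)
  levelSidesT : ∀ z₀ : ℝ, z₀ = 0 ∨ z₀ = 1 → ∀ s ∈ II, ∀ t x x' y y' : ℝ,
    t4 (H (x, y, z₀, t) s) = t4 (H (x', y', z₀, t) s)

theorem TwoTangleEquivIsotopy.good {H : Pt4 → ℝ → Pt4} (h : TwoTangleEquivIsotopy H) : Good H where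
  smooth := h.isotopy.smooth
  mapsTo := h.isotopy.mapsTo
  diffeo := h.isotopy.diffeo
  productT := h.productT
  productZ := h.productZ
  levelEnds t₀ ht s hs y z x x' := by
    have := (h.endEquiv t₀ ht).levelYZ s hs (x, y, z) (x', y, z) rfl
    exact (Prod.mk.inj this).1
  levelEndsZ t₀ ht s hs z x x' y y' := (h.endEquiv t₀ ht).levelZ s hs (x, y, z) (x', y', z) rfl
  levelSides z₀ hz s hs y t x x' :=
    (Prod.mk.inj ((h.levelSides z₀ hz s hs (x, y, z₀, t) (x', y, z₀, t) rfl rfl).1 rfl)).1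
  levelSidesT z₀ hz s hs t x x' y y' :=
    (h.levelSides z₀ hz s hs (x, y, z₀, t) (x', y', z₀, t) rfl rfl).2 rfl

theorem exists_zone_const {P : ℝ → Prop} (h : ∃ ε > 0, P ε) (hmono : ∀ ε ε', ε' ≤ ε → P ε → P ε') :
    ∃ ε > 0, ε ≤ 1/4 ∧ P ε := by
  obtain ⟨ε, hε, hP⟩ := h
  exact ⟨min ε (1/4), by positivity, min_le_right _ _, hmono _ _ (min_le_left _ _) hP⟩

section
variable {H : Pt4 → ℝ → Pt4}

theorem Good.exists_t_zone (h : Good H) : ∃ ε > 0, ε ≤ 1/4 ∧ ∀ s ∈ II, ∀ x y z : ℝ, ∀ t ∈ II,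
    (t ≤ ε → H (x, y, z, t) s =
      (x4 (H (x, y, z, 0) s), y4 (H (x, y, z, 0) s), z4 (H (x, y, z, 0) s), t)) ∧
    (1 - ε ≤ t → H (x, y, z, t) s =
      (x4 (H (x, y, z, 1) s), y4 (H (x, y, z, 1) s), z4 (H (x, y, z, 1) s), t)) :=
  exists_zone_const h.productT fun ε ε' hle hP s hs x y z t ht =>
    ⟨fun h1 => (hP s hs x y z t ht).1 (by linarith), fun h1 => (hP s hs x y z t ht).2 (by linarith)⟩

theorem Good.exists_z_zone (h : Good H) : ∃ ε > 0, ε ≤ 1/4 ∧ ∀ s ∈ II, ∀ x y t : ℝ, ∀ z ∈ II,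
    (z ≤ ε → H (x, y, z, t) s =
      (x4 (H (x, y, 0, t) s), y4 (H (x, y, 0, t) s), z, t4 (H (x, y, 0, t) s))) ∧
    (1 - ε ≤ z → H (x, y, z, t) s =
      (x4 (H (x, y, 1, t) s), y4 (H (x, y, 1, t) s), z, t4 (H (x, y, 1, t) s))) :=
  exists_zone_const h.productZ fun ε ε' hle hP s hs x y z t ht =>
    ⟨fun h1 => (hP s hs x y z t ht).1 (by linarith), fun h1 => (hP s hs x y z t ht).2 (by linarith)⟩

theorem Good.t4_top (h : Good H) {s : ℝ} (hs : s ∈ II) {p : Pt4} (hp : t4 p = 1) :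
    t4 (H p s) = 1 := by
  obtain ⟨ε, hε, -, hP⟩ := h.exists_t_zone
  have := (hP s hs (x4 p) (y4 p) (z4 p) 1 one_mem_II).2 (by linarith)
  have hp' : p = (x4 p, y4 p, z4 p, 1) := pt4_ext rfl rfl rfl hp
  rw [hp', this]; rfl

theorem Good.t4_bot (h : Good H) {s : ℝ} (hs : s ∈ II) {p : Pt4} (hp : t4 p = 0) :
    t4 (H p s) = 0 := by
  obtain ⟨ε, hε, -, hP⟩ := h.exists_t_zone
  have := (hP s hs (x4 p) (y4 p) (z4 p) 0 zero_mem_II).1 hε.le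
  have hp' : p = (x4 p, y4 p, z4 p, 0) := pt4_ext rfl rfl rfl hp
  rw [hp', this]; rfl

/-- The inverse of an equivalence isotopy does not leave the unit interval in the `t` direction,
and it preserves the ends. -/
theorem Good.t4_inverse (h : Good H) {s : ℝ} (hs : s ∈ II) {G : Pt4 → Pt4} (hG : Continuous G)
    (hinv : InvOn G (fun p => H p s) cube4 cube4) {q : Pt4} (hq : q ∈ cube4) :
    t4 (G q) ∈ II ∧ (t4 q = 0 → t4 (G q) = 0) ∧ (t4 q = 1 → t4 (G q) = 1) := by
  obtain ⟨ε, hε, hε4, hP⟩ := h.exists_t_zone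
  have hup : ∀ p, tL p ∈ Icc (1 - ε) 1 → tL (H p s) = tL p := fun p hp => by
    have := (hP s hs (x4 p) (y4 p) (z4 p) (t4 p) ⟨by linarith [hp.1, tL_apply p], hp.2⟩).2 hp.1
    rw [show p = (x4 p, y4 p, z4 p, t4 p) from rfl, this]; rfl
  have hdn : ∀ p, (-tL) p ∈ Icc (-ε) 0 → (-tL) (H p s) = (-tL) p := fun p hp => by
    have h1 : -ε ≤ - t4 p := hp.1
    have h2 : - t4 p ≤ 0 := hp.2
    have := (hP s hs (x4 p) (y4 p) (z4 p) (t4 p) ⟨by linarith, by linarith⟩).1 (by linarith)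
    rw [show p = (x4 p, y4 p, z4 p, t4 p) from rfl, this]; rfl
  have hII : ∀ q ∈ cube4, t4 q ∈ Icc (0:ℝ) 1 := fun q hq => hq.2.2.2
  have hI : (0:ℝ) ∈ II := zero_mem_II
  have m1 : ((0, 0, 0, 1 - ε/2) : Pt4) ∈ cube4 := ⟨hI, hI, hI, by constructor <;> simp <;> linarith⟩
  have m2 : ((0, 0, 0, ε/2) : Pt4) ∈ cube4 := ⟨hI, hI, hI, by constructor <;> simp <;> linarith⟩
  have i1 : tL ((0, 0, 0, 1 - ε/2) : Pt4) ∈ Ioo (1 - ε) 1 := by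
    rw [tL_apply]; simp only [t4]; constructor <;> linarith
  have i2 : (-tL) ((0, 0, 0, ε/2) : Pt4) ∈ Ioo (-ε) 0 := by
    rw [neg_apply, tL_apply]; simp only [t4]; constructor <;> linarith
  have e1 := fun h1 => level_inverse_eq convex_cube4 hG (h.mapsTo s hs) hinv hup m1 i1 hq h1
  have e2 := fun h1 => level_inverse_eq convex_cube4 hG (h.mapsTo s hs) hinv hdn m2 i2 hq h1
  have l1 := fun h1 => level_inverse_lt_of_lt convex_cube4 hG (h.mapsTo s hs) hinv hup m1 i1
    (fun q hq => (hII q hq).2) hq h1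
  have l2 := fun h1 => level_inverse_lt_of_lt convex_cube4 hG (h.mapsTo s hs) hinv hdn m2 i2
    (fun q hq => neg_nonpos.2 (hII q hq).1) hq h1
  simp only [neg_apply, tL_apply, mem_Icc] at e1 e2 l1 l2
  have hq1 := hII q hq
  refine ⟨⟨?_, ?_⟩, fun h0 => ?_, fun h0 => ?_⟩
  · rcases lt_or_ge (t4 q) ε with h1 | h1
    · have := e2 ⟨by linarith, by linarith [hq1.1]⟩
      linarith [hq1.1]
    · rcases eq_or_lt_of_le h1 with h1 | h1
      · have := e2 ⟨by linarith, by linarith [hq1.1]⟩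
        linarith [hq1.1]
      · linarith [l2 (by linarith)]
  · rcases lt_or_ge (t4 q) (1 - ε) with h1 | h1
    · linarith [l1 h1]
    · linarith [e1 ⟨h1, hq1.2⟩, hq1.2]
  · linarith [e2 ⟨by linarith, by linarith⟩]
  · linarith [e1 ⟨by linarith, by linarith⟩]

theorem Good.twoTangleEquivIsotopy (h : Good H) : TwoTangleEquivIsotopy H where
  isotopy := ⟨h.smooth, h.mapsTo, h.diffeo⟩
  productT := h.productT
  productZ := h.productZ
  levelSides z₀ hz s hs p q hp hq := by
    rcases p with ⟨x, y, z, t⟩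
    rcases q with ⟨x', y', z', t'⟩
    simp only [z4] at hp hq
    subst hp hq
    constructor
    · intro he
      simp only [y4, t4, Prod.mk.injEq] at he
      obtain ⟨rfl, rfl⟩ := he
      exact Prod.ext (h.levelSides _ hz s hs _ _ _ _) (h.levelSidesT _ hz s hs _ _ _ _ _)
    · intro he
      simp only [t4] at he
      subst he
      exact h.levelSidesT _ hz s hs _ _ _ _ _
  endEquiv t₀ ht := by
    have htII : t₀ ∈ II := by
      rcases ht with rfl | rfl
      exacts [zero_mem_II, one_mem_II]
    have hlev : ∀ s ∈ II, ∀ p, t4 p = t₀ → t4 (H p s) = t₀ := by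
      rintro s hs p hp
      rcases ht with rfl | rfl
      exacts [h.t4_bot hs hp, h.t4_top hs hp]
    have hemb : ∀ p : Pt4, t4 p = t₀ → emb3 (p123 p) t₀ = p := by
      rintro p rfl; rfl
    have hmem : ∀ p ∈ cube, emb3 p t₀ ∈ cube4 := fun p hp => ⟨hp.1, hp.2.1, hp.2.2, htII⟩
    have hmem' : ∀ p ∈ cube4, p123 p ∈ cube := fun p hp => ⟨hp.1, hp.2.1, hp.2.2.1⟩
    have hc1 : ContDiff ℝ (⊤ : ℕ∞) p123 := by unfold p123; fun_prop
    have hc2 : ContDiff ℝ (⊤ : ℕ∞) fun p => emb3 p t₀ := by unfold emb3; fun_prop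
    refine ⟨⟨?_, ?_, ?_⟩, ?_, ?_, ?_⟩
    · exact hc1.comp (h.smooth.comp ((hc2.comp contDiff_fst).prodMk contDiff_snd))
    · intro s hs p hp
      exact hmem' _ (h.mapsTo s hs (hmem p hp))
    · intro s hs
      obtain ⟨G, hG, hinv⟩ := h.diffeo s hs
      refine ⟨fun p => p123 (G (emb3 p t₀)), hc1.comp (hG.comp hc2), fun p hp => ?_, fun q hq => ?_⟩
      · have := hinv.1 (hmem p hp)
        simp only at this ⊢
        rw [hemb _ (hlev s hs _ rfl), this]; rfl
      · have := hinv.2 (hmem q hq)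
        simp only at this ⊢
        rw [hemb _ ?_, this]
        · rfl
        · have := h.t4_inverse hs hG.continuous hinv (hmem q hq)
          rcases ht with rfl | rfl
          exacts [this.2.1 rfl, this.2.2 rfl]
    · rintro s hs ⟨x, y, z⟩ ⟨x', y', z'⟩ he
      simp only [pYZ, Prod.mk.injEq] at he
      obtain ⟨rfl, rfl⟩ := he
      exact Prod.ext (h.levelEnds t₀ ht s hs _ _ _ _) (h.levelEndsZ t₀ ht s hs _ _ _ _ _)
    · rintro s hs ⟨x, y, z⟩ ⟨x', y', z'⟩ he
      simp only [z3] at he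
      subst he
      exact h.levelEndsZ t₀ ht s hs _ _ _ _ _
    · obtain ⟨ε, hε, hP⟩ := h.productZ
      refine ⟨ε, hε, fun s hs x y z hz => ⟨fun h1 => ?_, fun h1 => ?_⟩⟩
      · exact congrArg p123 ((hP s hs x y t₀ z hz).1 h1)
      · exact congrArg p123 ((hP s hs x y t₀ z hz).2 h1)

end

/-- Apply a function to the `z` coordinate. -/
def mapZ (σ : ℝ → ℝ) (p : Pt4) : Pt4 := (x4 p, y4 p, σ (z4 p), t4 p)

/-- Conjugation of an isotopy by a change of the `z` coordinate. -/
def conjZ (σ τ : ℝ → ℝ) (H : Pt4 → ℝ → Pt4) (p : Pt4) (s : ℝ) : Pt4 := mapZ τ (H (mapZ σ p) s)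

theorem contDiff_mapZ {σ : ℝ → ℝ} (h : ContDiff ℝ (⊤ : ℕ∞) σ) : ContDiff ℝ (⊤ : ℕ∞) (mapZ σ) := by
  unfold mapZ x4 y4 z4 t4; fun_prop

/-- A smooth reparametrization of the `z` direction, possibly reversing it. -/
structure IsReparam (σ τ : ℝ → ℝ) : Prop where
  smooth : ContDiff ℝ (⊤ : ℕ∞) σ
  smooth_inv : ContDiff ℝ (⊤ : ℕ∞) τ
  mapsTo : MapsTo σ II II
  mapsTo_inv : MapsTo τ II II
  left : ∀ z, τ (σ z) = z
  right : ∀ z, σ (τ z) = z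
  ends : (σ 0 = 0 ∧ σ 1 = 1) ∨ (σ 0 = 1 ∧ σ 1 = 0)

section
variable {σ τ : ℝ → ℝ} {H : Pt4 → ℝ → Pt4}

theorem mapZ_mapZ (h : ∀ z, τ (σ z) = z) (p : Pt4) : mapZ τ (mapZ σ p) = p :=
  pt4_ext rfl rfl (h _) rfl

theorem mapZ_mem_cube4 (h : MapsTo σ II II) {p : Pt4} (hp : p ∈ cube4) : mapZ σ p ∈ cube4 :=
  ⟨hp.1, hp.2.1, h hp.2.2.1, hp.2.2.2⟩

theorem IsReparam.end_mem (h : IsReparam σ τ) {z₀ : ℝ} (hz : z₀ = 0 ∨ z₀ = 1) :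
    σ z₀ = 0 ∨ σ z₀ = 1 := by
  rcases h.ends with h | h <;> rcases hz with rfl | rfl <;> simp [h]

theorem conjZ_productZ_aux (h : IsReparam σ τ) (hH : Good H) {z₀ : ℝ} (hz₀ : z₀ = 0 ∨ z₀ = 1) :
    ∃ ε > 0, ∀ s ∈ II, ∀ x y t : ℝ, ∀ z ∈ II, |z - z₀| ≤ ε →
      conjZ σ τ H (x, y, z, t) s = (x4 (conjZ σ τ H (x, y, z₀, t) s),
        y4 (conjZ σ τ H (x, y, z₀, t) s), z, t4 (conjZ σ τ H (x, y, z₀, t) s)) := by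
  obtain ⟨ε, hε, hP⟩ := hH.productZ
  obtain ⟨δ, hδ, hd⟩ := Metric.continuousAt_iff.1 (h.smooth.continuous.continuousAt (x := z₀)) ε hε
  refine ⟨δ/2, by positivity, fun s hs x y t z hz hzz => ?_⟩
  have h1 := hd (x := z) (by rw [Real.dist_eq]; linarith)
  rw [Real.dist_eq] at h1
  have hσ := h.mapsTo hz
  have key : H (x, y, σ z, t) s = (x4 (H (x, y, σ z₀, t) s), y4 (H (x, y, σ z₀, t) s), σ z,
      t4 (H (x, y, σ z₀, t) s)) := by
    rcases h.end_mem hz₀ with h0 | h0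
    · rw [h0] at h1 ⊢
      exact (hP s hs x y t _ hσ).1 (by linarith [(abs_lt.1 h1).2])
    · rw [h0] at h1 ⊢
      exact (hP s hs x y t _ hσ).2 (by linarith [(abs_lt.1 h1).1])
  change mapZ τ (H (x, y, σ z, t) s) = _
  rw [key]
  exact pt4_ext rfl rfl (h.left z) rfl

theorem Good.conjZ (hH : Good H) (h : IsReparam σ τ) : Good (conjZ σ τ H) where
  smooth := (contDiff_mapZ h.smooth_inv).comp (hH.smooth.comp
    (((contDiff_mapZ h.smooth).comp contDiff_fst).prodMk contDiff_snd))
  mapsTo s hs p hp := mapZ_mem_cube4 h.mapsTo_inv (hH.mapsTo s hs (mapZ_mem_cube4 h.mapsTo hp))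
  diffeo s hs := by
    obtain ⟨G, hG, hinv⟩ := hH.diffeo s hs
    refine ⟨fun p => mapZ τ (G (mapZ σ p)),
      (contDiff_mapZ h.smooth_inv).comp (hG.comp (contDiff_mapZ h.smooth)),
      fun p hp => ?_, fun q hq => ?_⟩
    · simp only [HDA4.conjZ]
      rw [mapZ_mapZ h.right]
      have := hinv.1 (mapZ_mem_cube4 h.mapsTo hp)
      simp only at this
      rw [this, mapZ_mapZ h.left]
    · simp only [HDA4.conjZ]
      rw [mapZ_mapZ h.right]
      have := hinv.2 (mapZ_mem_cube4 h.mapsTo hq)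
      simp only at this
      rw [this, mapZ_mapZ h.left]
  productT := by
    obtain ⟨ε, hε, hP⟩ := hH.productT
    refine ⟨ε, hε, fun s hs x y z t ht => ⟨fun h1 => ?_, fun h1 => ?_⟩⟩
    · exact congrArg (mapZ τ) ((hP s hs x y (σ z) t ht).1 h1)
    · exact congrArg (mapZ τ) ((hP s hs x y (σ z) t ht).2 h1)
  productZ := by
    obtain ⟨ε, hε, hP⟩ := conjZ_productZ_aux h hH (Or.inl rfl)
    obtain ⟨ε', hε', hP'⟩ := conjZ_productZ_aux h hH (Or.inr rfl)
    refine ⟨min ε ε', by positivity, fun s hs x y t z hz => ⟨fun h1 => ?_, fun h1 => ?_⟩⟩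
    · exact hP s hs x y t z hz (by rw [sub_zero, abs_of_nonneg hz.1]; exact h1.trans (min_le_left _ _))
    · refine hP' s hs x y t z hz ?_
      rw [abs_sub_comm, abs_of_nonneg (by linarith [hz.2])]
      linarith [min_le_right ε ε']
  levelEnds t₀ ht s hs y z x x' := hH.levelEnds t₀ ht s hs y (σ z) x x'
  levelEndsZ t₀ ht s hs z x x' y y' := congrArg τ (hH.levelEndsZ t₀ ht s hs (σ z) x x' y y')
  levelSides z₀ hz s hs y t x x' := hH.levelSides (σ z₀) (h.end_mem hz) s hs y t x x'
  levelSidesT z₀ hz s hs t x x' y y' := hH.levelSidesT (σ z₀) (h.end_mem hz) s hs t x x' y y'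

/-- The reflection of the `z` direction. -/
theorem isReparam_refl : IsReparam (fun z => 1 - z) (fun z => 1 - z) where
  smooth := by fun_prop
  smooth_inv := by fun_prop
  mapsTo z hz := ⟨by linarith [hz.2], by linarith [hz.1]⟩
  mapsTo_inv z hz := ⟨by linarith [hz.2], by linarith [hz.1]⟩
  left z := by ring
  right z := by ring
  ends := by norm_num

/-- A smooth step function, `0` below `a` and `1` above `b`. -/
def step (a b v : ℝ) : ℝ := Real.smoothTransition ((v - a) / (b - a))

theorem contDiff_step (a b : ℝ) : ContDiff ℝ (⊤ : ℕ∞) (step a b) :=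
  Real.smoothTransition.contDiff.comp (by fun_prop)

theorem step_of_le {a b v : ℝ} (hab : a < b) (h : v ≤ a) : step a b v = 0 :=
  Real.smoothTransition.zero_of_nonpos (div_nonpos_of_nonpos_of_nonneg (by linarith) (by linarith))

theorem step_of_ge {a b v : ℝ} (hab : a < b) (h : b ≤ v) : step a b v = 1 :=
  Real.smoothTransition.one_of_one_le ((one_le_div (by linarith)).2 (by linarith))

theorem step_nonneg (a b v : ℝ) : 0 ≤ step a b v := Real.smoothTransition.nonneg _
theorem step_le_one (a b v : ℝ) : step a b v ≤ 1 := Real.smoothTransition.le_one _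

theorem step_mono {a b : ℝ} (hab : a < b) : Monotone (step a b) := fun u v huv =>
  Real.smoothTransition.monotone (div_le_div_of_nonneg_right (by linarith) (by linarith))

theorem deriv_step_nonneg {a b : ℝ} (hab : a < b) (v : ℝ) : 0 ≤ deriv (step a b) v :=
  (step_mono hab).deriv_nonneg

/-- A reparametrization fixing `[0,1/4]` which expands a given collar of `1` to `[1/3,1]`. -/
theorem exists_isReparam {ε : ℝ} (hε : 0 < ε) (hε1 : ε ≤ 1/4) : ∃ σ τ, IsReparam σ τ ∧
    StrictMono σ ∧ (∀ z, z ≤ 1/4 → σ z = z) ∧ ∀ z, 1/3 ≤ z → 1 - ε ≤ σ z := by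
  set θ := step (1/4) (1/3) with hθ
  have hab : (1/4 : ℝ) < 1/3 := by norm_num
  set σ : ℝ → ℝ := fun z => z + θ z * (1 - ε) * (1 - z) with hσ
  have hθs : ContDiff ℝ (⊤ : ℕ∞) θ := contDiff_step _ _
  have hs : ContDiff ℝ (⊤ : ℕ∞) σ := by fun_prop
  have hlow : ∀ z, z ≤ 1/4 → σ z = z := fun z hz => by
    simp only [hσ, hθ, step_of_le hab hz]; ring
  have hhigh : ∀ z, 1/3 ≤ z → σ z = 1 - ε * (1 - z) := fun z hz => by
    simp only [hσ, hθ, step_of_ge hab hz]; ring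
  have hθd : ∀ z, HasDerivAt θ (deriv θ z) z := fun z =>
    (hθs.differentiable (by simp) z).hasDerivAt
  have hd : ∀ z, HasDerivAt σ
      (1 + (deriv θ z * (1 - ε) * (1 - z) + θ z * (1 - ε) * (0 - 1))) z := fun z =>
    (hasDerivAt_id z).add (((hθd z).mul_const (1 - ε)).mul ((hasDerivAt_const z 1).sub (hasDerivAt_id z)))
  have hpos : ∀ z, 0 < 1 + (deriv θ z * (1 - ε) * (1 - z) + θ z * (1 - ε) * (0 - 1)) := by
    intro z
    have h1 : 0 ≤ deriv θ z * (1 - ε) * (1 - z) := by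
      rcases le_or_gt z (1/2) with hz | hz
      · exact mul_nonneg (mul_nonneg (deriv_step_nonneg hab z) (by linarith)) (by linarith)
      · have : deriv θ z = 0 := by
          have : θ =ᶠ[nhds z] fun _ => 1 := by
            filter_upwards [Ioi_mem_nhds (show (1/3:ℝ) < z by linarith)] with u hu
            exact step_of_ge hab (le_of_lt hu)
          rw [this.deriv_eq]; simp
        simp [this]
    have h2 : θ z ≤ 1 := step_le_one _ _ _
    nlinarith
  have hmono : StrictMono σ := strictMono_of_hasDerivAt_pos hd hpos
  have hsurj : Function.Surjective σ := by
    have hc : Continuous σ := hs.continuous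
    intro w
    have : w ∈ Icc (σ (min w 0)) (σ (max (1 + w / ε) 1)) := by
      constructor
      · rw [hlow _ ((min_le_right _ _).trans (by norm_num))]; exact min_le_left _ _
      · rw [hhigh _ (le_trans (by norm_num) (le_max_right _ _))]
        have := le_max_left (1 + w / ε) 1
        have h3 : ε * (1 + w / ε) = ε + w := by field_simp
        nlinarith [mul_le_mul_of_nonneg_left this hε.le]
    obtain ⟨z, -, hz⟩ := intermediate_value_Icc
      (le_trans (min_le_right w 0) (le_trans zero_le_one (le_max_right (1 + w / ε) 1))) hc.continuousOn this
    exact ⟨z, hz⟩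
  set e := (StrictMono.orderIsoOfSurjective σ hmono hsurj).toHomeomorph with he
  have hes : ∀ z, e z = σ z := fun z => rfl
  have hinv : ContDiff ℝ (⊤ : ℕ∞) (e.symm : ℝ → ℝ) :=
    e.contDiff_symm_deriv (f' := fun z => 1 + (deriv θ z * (1 - ε) * (1 - z) + θ z * (1 - ε) * (0 - 1)))
      (fun z => (hpos z).ne') hd hs
  have h0 : σ 0 = 0 := hlow 0 (by norm_num)
  have h1 : σ 1 = 1 := by rw [hhigh 1 (by norm_num)]; ring
  refine ⟨σ, e.symm, ⟨hs, hinv, ?_, ?_, fun z => e.symm_apply_apply z, fun z => e.apply_symm_apply z,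
    Or.inl ⟨h0, h1⟩⟩, hmono, hlow, ?_⟩
  · intro z hz
    exact ⟨h0 ▸ hmono.monotone hz.1, h1 ▸ hmono.monotone hz.2⟩
  · intro z hz
    have hz' : σ (e.symm z) = z := e.apply_symm_apply z
    constructor
    · rw [← hmono.le_iff_le, h0, hz']; exact hz.1
    · rw [← hmono.le_iff_le, h1, hz']; exact hz.2
  · intro z hz
    rw [hhigh z hz]
    nlinarith

end

/-- The unit vectors of the coordinate directions. -/
def ex : Pt4 := (1, 0, 0, 0)
def ey : Pt4 := (0, 1, 0, 0)
def et : Pt4 := (0, 0, 0, 1)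

/-- The map `h` is triangular on the slab `a ≤ z ≤ b`: it preserves `z`, and on each level
its `t` component only depends on `t` and its `y` component only on `y` and `t`. -/
structure Tri (h : Pt4 → Pt4) (a b : ℝ) : Prop where
  z_eq : ∀ p, z4 p ∈ Icc a b → z4 (h p) = z4 p
  t_eq : ∀ z ∈ Icc a b, ∀ x x' y y' t, t4 (h (x, y, z, t)) = t4 (h (x', y', z, t))
  y_eq : ∀ z ∈ Icc a b, ∀ x x' y t, y4 (h (x, y, z, t)) = y4 (h (x', y, z, t))

/-- The diagonal entries of the derivative of `h`, read along the coordinates `x`, `y`, `t`. -/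
def dX (h : Pt4 → Pt4) (p : Pt4) : ℝ := x4 (fderiv ℝ h p ex)
def dY (h : Pt4 → Pt4) (p : Pt4) : ℝ := y4 (fderiv ℝ h p ey)
def dT (h : Pt4 → Pt4) (p : Pt4) : ℝ := t4 (fderiv ℝ h p et)

section
variable {h : Pt4 → Pt4} {a b : ℝ}

theorem hasDerivAt_line_x (hd : Differentiable ℝ h) (x y z t : ℝ) :
    HasDerivAt (fun v => h (v, y, z, t)) (fderiv ℝ h (x, y, z, t) ex) x :=
  (hd (x, y, z, t)).hasFDerivAt.comp_hasDerivAt x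
    ((hasDerivAt_id x).prodMk (hasDerivAt_const x (y, z, t)))

theorem hasDerivAt_line_y (hd : Differentiable ℝ h) (x y z t : ℝ) :
    HasDerivAt (fun v => h (x, v, z, t)) (fderiv ℝ h (x, y, z, t) ey) y :=
  (hd (x, y, z, t)).hasFDerivAt.comp_hasDerivAt y
    ((hasDerivAt_const y x).prodMk ((hasDerivAt_id y).prodMk (hasDerivAt_const y (z, t))))

theorem hasDerivAt_line_t (hd : Differentiable ℝ h) (x y z t : ℝ) :
    HasDerivAt (fun v => h (x, y, z, v)) (fderiv ℝ h (x, y, z, t) et) t :=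
  (hd (x, y, z, t)).hasFDerivAt.comp_hasDerivAt t
    ((hasDerivAt_const t x).prodMk ((hasDerivAt_const t y).prodMk
      ((hasDerivAt_const t z).prodMk (hasDerivAt_id t))))

theorem hasDerivAt_x4 {c : ℝ → Pt4} {v : Pt4} {u : ℝ} (hc : HasDerivAt c v u) :
    HasDerivAt (fun u => x4 (c u)) (x4 v) u :=
  (hasFDerivAt_fst (𝕜 := ℝ) (p := c u)).comp_hasDerivAt u hc

theorem hasDerivAt_y4 {c : ℝ → Pt4} {v : Pt4} {u : ℝ} (hc : HasDerivAt c v u) :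
    HasDerivAt (fun u => y4 (c u)) (y4 v) u :=
  ((ContinuousLinearMap.fst ℝ ℝ (ℝ × ℝ)).comp
    (ContinuousLinearMap.snd ℝ ℝ (ℝ × ℝ × ℝ))).hasFDerivAt.comp_hasDerivAt u hc

theorem hasDerivAt_t4 {c : ℝ → Pt4} {v : Pt4} {u : ℝ} (hc : HasDerivAt c v u) :
    HasDerivAt (fun u => t4 (c u)) (t4 v) u :=
  tL.hasFDerivAt.comp_hasDerivAt u hc

theorem hasDerivAt_dX (hd : Differentiable ℝ h) (x y z t : ℝ) :
    HasDerivAt (fun v => x4 (h (v, y, z, t))) (dX h (x, y, z, t)) x :=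
  hasDerivAt_x4 (hasDerivAt_line_x hd x y z t)

theorem hasDerivAt_dY (hd : Differentiable ℝ h) (x y z t : ℝ) :
    HasDerivAt (fun v => y4 (h (x, v, z, t))) (dY h (x, y, z, t)) y :=
  hasDerivAt_y4 (hasDerivAt_line_y hd x y z t)

theorem hasDerivAt_dT (hd : Differentiable ℝ h) (x y z t : ℝ) :
    HasDerivAt (fun v => t4 (h (x, y, z, v))) (dT h (x, y, z, t)) t :=
  hasDerivAt_t4 (hasDerivAt_line_t hd x y z t)

theorem hasDerivAt_eq_zero_of_const {f : ℝ → ℝ} {f' u : ℝ} (h : HasDerivAt f f' u)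
    (hc : ∀ v, f v = f u) : f' = 0 := by
  have : f = fun _ => f u := funext hc
  rw [this] at h
  exact h.unique (hasDerivAt_const u (f u))

theorem Tri.fderiv_z (hT : Tri h a b) (hab : a < b) (hd : Differentiable ℝ h) {p : Pt4}
    (hp : z4 p ∈ Icc a b) (v : Pt4) : z4 (fderiv ℝ h p v) = z4 v := by
  set S := zL ⁻¹' Icc a b with hS
  have hSc : Convex ℝ S := (convex_Icc a b).linear_preimage zL.toLinearMap
  have hSi : (interior S).Nonempty := by
    refine ⟨(0, 0, (a + b)/2, 0), mem_interior.2 ⟨zL ⁻¹' Ioo a b, preimage_mono Ioo_subset_Icc_self,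
      isOpen_Ioo.preimage zL.continuous, ?_⟩⟩
    change (a + b)/2 ∈ Ioo a b
    constructor <;> linarith
  have h1 : HasFDerivWithinAt (zL ∘ h) (zL.comp (fderiv ℝ h p)) S p :=
    (zL.hasFDerivAt.comp p (hd p).hasFDerivAt).hasFDerivWithinAt
  have h2 : HasFDerivWithinAt (zL ∘ h) zL S p :=
    zL.hasFDerivAt.hasFDerivWithinAt.congr (fun x hx => hT.z_eq x hx) (hT.z_eq p hp)
  exact DFunLike.congr_fun ((uniqueDiffOn_convex hSc hSi p hp).eq h1 h2) v

theorem Tri.fderiv_ex_y (hT : Tri h a b) (hd : Differentiable ℝ h) {p : Pt4}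
    (hp : z4 p ∈ Icc a b) : y4 (fderiv ℝ h p ex) = 0 :=
  hasDerivAt_eq_zero_of_const (hasDerivAt_y4 (hasDerivAt_line_x hd (x4 p) (y4 p) (z4 p) (t4 p)))
    fun _ => hT.y_eq _ hp _ _ _ _

theorem Tri.fderiv_ex_t (hT : Tri h a b) (hd : Differentiable ℝ h) {p : Pt4}
    (hp : z4 p ∈ Icc a b) : t4 (fderiv ℝ h p ex) = 0 :=
  hasDerivAt_eq_zero_of_const (hasDerivAt_t4 (hasDerivAt_line_x hd (x4 p) (y4 p) (z4 p) (t4 p)))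
    fun _ => hT.t_eq _ hp _ _ _ _ _

theorem Tri.fderiv_ey_t (hT : Tri h a b) (hd : Differentiable ℝ h) {p : Pt4}
    (hp : z4 p ∈ Icc a b) : t4 (fderiv ℝ h p ey) = 0 :=
  hasDerivAt_eq_zero_of_const (hasDerivAt_t4 (hasDerivAt_line_y hd (x4 p) (y4 p) (z4 p) (t4 p)))
    fun _ => hT.t_eq _ hp _ _ _ _ _

theorem Tri.injective_of_diag (hT : Tri h a b) (hab : a < b) (hd : Differentiable ℝ h) {p : Pt4}
    (hp : z4 p ∈ Icc a b) (h1 : dX h p ≠ 0) (h2 : dY h p ≠ 0) (h3 : dT h p ≠ 0) :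
    Function.Injective (fderiv ℝ h p) := by
  rw [injective_iff_map_eq_zero]
  intro v hv
  have hz : z4 v = 0 := by rw [← hT.fderiv_z hab hd hp v, hv]; rfl
  have hv' : v = x4 v • ex + y4 v • ey + t4 v • et := by
    refine pt4_ext ?_ ?_ ?_ ?_
    · simp [x4, ex, ey, et]
    · simp [y4, ex, ey, et]
    · rw [hz]; simp [z4, ex, ey, et]
    · simp [t4, ex, ey, et]
  have hD : x4 v • fderiv ℝ h p ex + y4 v • fderiv ℝ h p ey + t4 v • fderiv ℝ h p et = 0 := by
    rw [← hv]; conv_rhs => rw [hv']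
    simp only [map_add, map_smul]
  have ht : t4 v = 0 := by
    have := congrArg t4 hD
    change x4 v * t4 (fderiv ℝ h p ex) + y4 v * t4 (fderiv ℝ h p ey) + t4 v * dT h p = 0 at this
    rw [hT.fderiv_ex_t hd hp, hT.fderiv_ey_t hd hp] at this
    simpa [h3] using this
  have hy : y4 v = 0 := by
    have := congrArg y4 hD
    change x4 v * y4 (fderiv ℝ h p ex) + y4 v * dY h p + t4 v * y4 (fderiv ℝ h p et) = 0 at this
    rw [hT.fderiv_ex_y hd hp, ht] at this
    simpa [h2] using this
  have hx : x4 v = 0 := by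
    have := congrArg x4 hD
    change x4 v * dX h p + y4 v * x4 (fderiv ℝ h p ey) + t4 v * x4 (fderiv ℝ h p et) = 0 at this
    rw [hy, ht] at this
    simpa [h1] using this
  exact pt4_ext hx hy hz ht

theorem Tri.diag_ne_zero (hT : Tri h a b) (hab : a < b) (hd : Differentiable ℝ h) {p : Pt4}
    (hp : z4 p ∈ Icc a b) (hinj : Function.Injective (fderiv ℝ h p)) :
    dX h p ≠ 0 ∧ dY h p ≠ 0 ∧ dT h p ≠ 0 := by
  have hx : fderiv ℝ h p ex = (dX h p, 0, 0, 0) :=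
    pt4_ext rfl (hT.fderiv_ex_y hd hp) (hT.fderiv_z hab hd hp ex) (hT.fderiv_ex_t hd hp)
  have hy : fderiv ℝ h p ey = (x4 (fderiv ℝ h p ey), dY h p, 0, 0) :=
    pt4_ext rfl rfl (hT.fderiv_z hab hd hp ey) (hT.fderiv_ey_t hd hp)
  have ht : fderiv ℝ h p et = (x4 (fderiv ℝ h p et), y4 (fderiv ℝ h p et), 0, dT h p) :=
    pt4_ext rfl rfl (hT.fderiv_z hab hd hp et) rfl
  set A := dX h p
  set B := dY h p
  set C := x4 (fderiv ℝ h p ey)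
  set E := x4 (fderiv ℝ h p et)
  set F := y4 (fderiv ℝ h p et)
  have h0 := (injective_iff_map_eq_zero _).1 hinj
  have hA : A ≠ 0 := by
    intro hA
    have := h0 ex (by rw [hx, hA]; rfl)
    have h1 : (1:ℝ) = 0 := congrArg x4 this
    exact one_ne_zero h1
  have hB : B ≠ 0 := by
    intro hB
    have := h0 (A • ey - C • ex) (by
      rw [map_sub, map_smul, map_smul, hx, hy, hB]
      refine pt4_ext ?_ ?_ ?_ ?_ <;> simp [x4, y4, z4, t4]
      ring)
    have h1 := congrArg y4 this
    simp [y4, ex, ey] at h1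
    exact hA h1
  refine ⟨hA, hB, fun hC => ?_⟩
  have := h0 ((B * A) • et - (F * A) • ey - (E * B - F * C) • ex) (by
    rw [map_sub, map_sub, map_smul, map_smul, map_smul, hx, hy, ht, hC]
    refine pt4_ext ?_ ?_ ?_ ?_ <;> simp [x4, y4, z4, t4] <;> ring)
  have h1 := congrArg t4 this
  simp [t4, ex, ey, et] at h1
  tauto

end

theorem pos_of_isPreconnected {X : Type*} [TopologicalSpace X] {S : Set X} (hS : IsPreconnected S)
    {f : X → ℝ} (hf : ContinuousOn f S) (hne : ∀ x ∈ S, f x ≠ 0) {x₀ x : X} (hx₀ : x₀ ∈ S)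
    (h0 : 0 < f x₀) (hx : x ∈ S) : 0 < f x := by
  by_contra! hcon
  obtain ⟨y, hy, hy0⟩ := hS.intermediate_value hx hx₀ hf ⟨hcon, h0.le⟩
  exact hne y hy hy0

section
variable {H : Pt4 → ℝ → Pt4} {a b : ℝ}

theorem Good.contDiff (hH : Good H) (s : ℝ) : ContDiff ℝ (⊤ : ℕ∞) fun p => H p s :=
  hH.smooth.comp (contDiff_id.prodMk contDiff_const)

theorem Good.differentiable (hH : Good H) (s : ℝ) : Differentiable ℝ fun p => H p s :=
  (hH.contDiff s).differentiable (by simp)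

theorem Good.continuous_fderiv (hH : Good H) (v : Pt4) :
    Continuous fun q : Pt4 × ℝ => fderiv ℝ (fun p => H p q.2) q.1 v := by
  have h1 : ∀ q : Pt4 × ℝ, fderiv ℝ (fun p => H p q.2) q.1 v =
      fderiv ℝ (fun q : Pt4 × ℝ => H q.1 q.2) q (v, 0) := by
    intro q
    have h2 := HasFDerivAt.comp (f := fun p : Pt4 => (p, q.2)) q.1
      ((hH.smooth.differentiable (by simp)) q).hasFDerivAt
      ((hasFDerivAt_id (𝕜 := ℝ) q.1).prodMk (hasFDerivAt_const (𝕜 := ℝ) q.2 q.1))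
    have h3 := h2.fderiv
    change fderiv ℝ (fun p => H p q.2) q.1 = _ at h3
    rw [h3]
    simp
  simp only [h1]
  exact (hH.smooth.continuous_fderiv (by simp)).clm_apply continuous_const

theorem continuous_x4 : Continuous x4 := continuous_fst
theorem continuous_y4 : Continuous y4 := continuous_fst.comp continuous_snd
theorem continuous_z4 : Continuous z4 := zL.continuous
theorem continuous_t4 : Continuous t4 := tL.continuous

theorem Good.fderiv_injective (hH : Good H) {s : ℝ} (hs : s ∈ II) {p : Pt4} (hp : p ∈ cube4) :
    Function.Injective (fderiv ℝ (fun p => H p s) p) := by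
  obtain ⟨G, hG, hinv⟩ := hH.diffeo s hs
  have := fderiv_injective_of_rightInvOn convex_cube4 interior_cube4_nonempty
    (hH.differentiable s) (hG.differentiable (by simp)) hinv.2 (hH.mapsTo s hs hp)
  rwa [hinv.1 hp] at this

theorem Good.diag_pos (hH : Good H) (h0 : ∀ p, H p 0 = p) (hab : a < b)
    (hT : ∀ s ∈ II, Tri (fun p => H p s) a b) {s : ℝ} (hs : s ∈ II) {p : Pt4} (hp : p ∈ cube4)
    (hz : z4 p ∈ Icc a b) :
    0 < dX (fun p => H p s) p ∧ 0 < dY (fun p => H p s) p ∧ 0 < dT (fun p => H p s) p := by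
  have hne : ∀ s ∈ II, _ := fun s hs =>
    (hT s hs).diag_ne_zero hab (hH.differentiable s) hz (hH.fderiv_injective hs hp)
  have hI : IsPreconnected II := isPreconnected_Icc
  have hid : (fun p => H p 0) = id := funext h0
  have hc : ∀ v, Continuous fun s => fderiv ℝ (fun p => H p s) p v := fun v =>
    (hH.continuous_fderiv v).comp (continuous_const.prodMk continuous_id)
  refine ⟨pos_of_isPreconnected hI (f := fun s => dX (fun p => H p s) p)
      (continuous_x4.comp (hc ex)).continuousOn (fun s hs => (hne s hs).1) zero_mem_II ?_ hs,
    pos_of_isPreconnected hI (f := fun s => dY (fun p => H p s) p)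
      (continuous_y4.comp (hc ey)).continuousOn (fun s hs => (hne s hs).2.1) zero_mem_II ?_ hs,
    pos_of_isPreconnected hI (f := fun s => dT (fun p => H p s) p)
      (continuous_t4.comp (hc et)).continuousOn (fun s hs => (hne s hs).2.2) zero_mem_II ?_ hs⟩
  · simp [dX, hid, x4, ex]
  · simp [dY, hid, y4, ey]
  · simp [dT, hid, t4, et]

end

theorem exists_mem_II_eq {f : ℝ → ℝ} (hf : ContinuousOn f II) (h0 : f 0 ≤ 0) (h1 : 1 ≤ f 1)
    {v : ℝ} (hv : v ∈ II) : ∃ u ∈ II, f u = v :=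
  intermediate_value_Icc zero_le_one hf ⟨h0.trans hv.1, hv.2.trans h1⟩

/-- On the level `z = c` of the cube, `F` is a monotone triangular map covering the level. -/
structure Box (F : Pt4 → Pt4) (c : ℝ) : Prop where
  z_eq : ∀ x ∈ II, ∀ y ∈ II, ∀ t ∈ II, z4 (F (x, y, c, t)) = c
  t_eq : ∀ x ∈ II, ∀ y ∈ II, ∀ t ∈ II, t4 (F (x, y, c, t)) = t4 (F (0, 0, c, t))
  y_eq : ∀ x ∈ II, ∀ y ∈ II, ∀ t ∈ II, y4 (F (x, y, c, t)) = y4 (F (0, y, c, t))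
  t_mono : StrictMonoOn (fun t => t4 (F (0, 0, c, t))) II
  t_zero : t4 (F (0, 0, c, 0)) ≤ 0
  t_one : 1 ≤ t4 (F (0, 0, c, 1))
  y_mono : ∀ t ∈ II, StrictMonoOn (fun y => y4 (F (0, y, c, t))) II
  y_zero : ∀ t ∈ II, y4 (F (0, 0, c, t)) ≤ 0
  y_one : ∀ t ∈ II, 1 ≤ y4 (F (0, 1, c, t))
  x_mono : ∀ t ∈ II, ∀ y ∈ II, y4 (F (0, y, c, t)) ∈ II →
    StrictMonoOn (fun x => x4 (F (x, y, c, t))) II ∧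
      x4 (F (0, y, c, t)) ≤ 0 ∧ 1 ≤ x4 (F (1, y, c, t))

section
variable {F : Pt4 → Pt4} {c : ℝ}

theorem Box.exists_eq (hB : Box F c) (hF : Continuous F) (hc : c ∈ II) {q : Pt4} (hq : q ∈ cube4)
    (hz : z4 q = c) : ∃ p ∈ cube4, z4 p = c ∧ F p = q := by
  have c1 : Continuous fun t : ℝ => t4 (F (0, 0, c, t)) := continuous_t4.comp (hF.comp (by fun_prop))
  obtain ⟨t, ht, hte⟩ := exists_mem_II_eq c1.continuousOn hB.t_zero hB.t_one hq.2.2.2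
  have c2 : Continuous fun y : ℝ => y4 (F (0, y, c, t)) := continuous_y4.comp (hF.comp (by fun_prop))
  obtain ⟨y, hy, hye⟩ := exists_mem_II_eq c2.continuousOn (hB.y_zero t ht) (hB.y_one t ht) hq.2.1
  obtain ⟨-, hx0, hx1⟩ := hB.x_mono t ht y hy (by rw [hye]; exact hq.2.1)
  have c3 : Continuous fun x : ℝ => x4 (F (x, y, c, t)) := continuous_x4.comp (hF.comp (by fun_prop))
  obtain ⟨x, hx, hxe⟩ := exists_mem_II_eq c3.continuousOn hx0 hx1 hq.1
  refine ⟨(x, y, c, t), ⟨hx, hy, hc, ht⟩, rfl, pt4_ext hxe ?_ ?_ ?_⟩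
  · rw [hB.y_eq x hx y hy t ht, hye]; rfl
  · rw [hB.z_eq x hx y hy t ht, hz]
  · rw [hB.t_eq x hx y hy t ht, hte]; rfl

theorem Box.eq_of_eq (hB : Box F c) {p p' : Pt4} (hp : p ∈ cube4) (hp' : p' ∈ cube4)
    (hz : z4 p = c) (hz' : z4 p' = c) (hFp : F p ∈ cube4) (he : F p = F p') : p = p' := by
  obtain ⟨x, y, z, t⟩ := p
  obtain ⟨x', y', z', t'⟩ := p'
  obtain ⟨hx, hy, -, ht⟩ := mem_cube4.1 hp
  obtain ⟨hx', hy', -, ht'⟩ := mem_cube4.1 hp'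
  simp only [x4, y4, t4, z4] at hx hy ht hx' hy' ht' hz hz'
  subst hz hz'
  have htt : t = t' := by
    refine hB.t_mono.injOn ht ht' ?_
    rw [← hB.t_eq x hx y hy t ht, he, hB.t_eq x' hx' y' hy' t' ht']
  subst htt
  have hyy : y = y' := by
    refine (hB.y_mono t ht).injOn hy hy' ?_
    rw [← hB.y_eq x hx y hy t ht, he, hB.y_eq x' hx' y' hy' t ht]
  subst hyy
  have hxx : x = x' := by
    refine (hB.x_mono t ht y hy ?_).1.injOn hx hx' (congrArg x4 he)
    rw [← hB.y_eq x hx y hy t ht]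
    exact hFp.2.1
  rw [hxx]

end

/-- The collar correction: it is applied to a coordinate `u` of the image, where `v` is the
corresponding coordinate of the source and `g₀`, `g₁` are the images of the end points. -/
def clampTo (η r g₀ g₁ v u : ℝ) : ℝ :=
  u - r * (1 - step 0 η v) * g₀ + r * step (1 - η) 1 v * (1 - g₁)

section
variable {η r g₀ g₁ : ℝ}

theorem clampTo_zero_left (u v : ℝ) : clampTo η 0 g₀ g₁ v u = u := by simp [clampTo]

theorem clampTo_middle (hη : 0 < η) {v : ℝ} (h1 : η ≤ v) (h2 : v ≤ 1 - η) (u : ℝ) :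
    clampTo η r g₀ g₁ v u = u := by
  simp [clampTo, step_of_ge hη h1, step_of_le (show 1 - η < 1 by linarith) h2]

theorem clampTo_of_ends (u v : ℝ) : clampTo η r 0 1 v u = u := by simp [clampTo]

theorem clampTo_zero (hη : 0 < η) (hη1 : η ≤ 1/2) (u : ℝ) {v : ℝ} (hv : v ≤ 0) :
    clampTo η r g₀ g₁ v u = u - r * g₀ := by
  simp [clampTo, step_of_le hη hv, step_of_le (show 1 - η < 1 by linarith) (show v ≤ 1 - η by linarith)]

theorem clampTo_one (hη : 0 < η) (hη1 : η ≤ 1/2) (u : ℝ) {v : ℝ} (hv : 1 ≤ v) :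
    clampTo η r g₀ g₁ v u = u + r * (1 - g₁) := by
  simp [clampTo, step_of_ge hη (show η ≤ v by linarith), step_of_ge (show 1 - η < 1 by linarith) hv]

theorem clampTo_mem_II (hr0 : 0 ≤ r) (hr1 : r ≤ 1) (hg₀ : g₀ ∈ II) (hg₁ : g₁ ∈ II) {u : ℝ}
    (hu : u ∈ Icc g₀ g₁) (v : ℝ) : clampTo η r g₀ g₁ v u ∈ II := by
  have a1 := step_nonneg 0 η v
  have a2 := step_le_one 0 η v
  have b1 := step_nonneg (1 - η) 1 v
  have b2 := step_le_one (1 - η) 1 v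
  have k1 : r * (1 - step 0 η v) ≤ 1 := mul_le_one₀ hr1 (by linarith) (by linarith)
  have k2 : 0 ≤ r * (1 - step 0 η v) := mul_nonneg hr0 (by linarith)
  have k3 : r * step (1 - η) 1 v ≤ 1 := mul_le_one₀ hr1 b1 b2
  have k4 : 0 ≤ r * step (1 - η) 1 v := mul_nonneg hr0 b1
  constructor <;> simp only [clampTo]
  · nlinarith [hu.1, hu.2, hg₀.1, hg₁.2, mul_nonneg k4 (sub_nonneg.2 hg₁.2),
      mul_le_mul_of_nonneg_right k1 hg₀.1]
  · nlinarith [hu.1, hu.2, hg₀.1, hg₁.2, mul_nonneg k2 hg₀.1,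
      mul_le_mul_of_nonneg_right k3 (sub_nonneg.2 hg₁.2)]

theorem strictMonoOn_of_two {n : ℝ → ℝ} (hn : ContinuousOn n II) (hinj : InjOn n II) (hg₀ : g₀ ∈ II)
    (hg₁ : g₁ ∈ II) (hlt : g₀ < g₁) (h0 : n g₀ = 0) (h1 : n g₁ = 1) : StrictMonoOn n II := by
  rcases ContinuousOn.strictMonoOn_of_injOn_Icc' (zero_le_one (α := ℝ)) hn hinj with h | h
  · exact h
  · have := h hg₀ hg₁ hlt
    linarith

theorem clampTo_comp (hη : 0 < η) (hη1 : η ≤ 1/2) (hr0 : 0 ≤ r) {n : ℝ → ℝ}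
    (hn : StrictMonoOn n II) (hg₀ : g₀ ∈ II) (hg₁ : g₁ ∈ II) (h0 : n g₀ = 0) (h1 : n g₁ = 1) :
    StrictMonoOn (fun u => clampTo η r g₀ g₁ (n u) u) II ∧
      clampTo η r g₀ g₁ (n 0) 0 ≤ 0 ∧ 1 ≤ clampTo η r g₀ g₁ (n 1) 1 ∧
      (r = 1 → ∀ u ∈ II, clampTo η r g₀ g₁ (n u) u ∈ II → n u ∈ II) := by
  have hmono : StrictMonoOn (fun u => clampTo η r g₀ g₁ (n u) u) II := by
    intro u hu v hv huv
    have hnn := (hn hu hv huv).le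
    have s1 := step_mono hη hnn
    have s2 := step_mono (show 1 - η < 1 by linarith) hnn
    simp only [clampTo]
    nlinarith [mul_nonneg (mul_nonneg hr0 (sub_nonneg.2 s1)) hg₀.1,
      mul_nonneg (mul_nonneg hr0 (sub_nonneg.2 s2)) (sub_nonneg.2 hg₁.2)]
  refine ⟨hmono, ?_, ?_, ?_⟩
  · rw [clampTo_zero hη hη1 _ ((hn.monotoneOn zero_mem_II hg₀ hg₀.1).trans h0.le)]
    nlinarith [mul_nonneg hr0 hg₀.1]
  · rw [clampTo_one hη hη1 _ (h1.ge.trans (hn.monotoneOn hg₁ one_mem_II hg₁.2))]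
    nlinarith [mul_nonneg hr0 (sub_nonneg.2 hg₁.2)]
  · rintro rfl u hu hc
    constructor
    · by_contra! hcon
      have h2 : u < g₀ := by
        by_contra! h3
        linarith [hn.monotoneOn hg₀ hu h3]
      have := hmono hu hg₀ h2
      simp only at this
      rw [h0, clampTo_zero hη hη1 _ le_rfl] at this
      linarith [hc.1]
    · by_contra! hcon
      have h2 : g₁ < u := by
        by_contra! h3
        linarith [hn.monotoneOn hu hg₁ h3]
      have := hmono hg₁ hu h2
      simp only at this
      rw [h1, clampTo_one hη hη1 _ le_rfl] at this
      linarith [hc.2]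

/-- The derivative of the collar correction is bounded below by that of the coordinate. -/
theorem exists_hasDerivAt_clampTo (hη : 0 < η) (hr0 : 0 ≤ r) {f : ℝ → ℝ}
    {f' v : ℝ} (hf : HasDerivAt f f' v) (hg : r ≠ 0 → 0 ≤ g₀ ∧ g₁ ≤ 1) :
    ∃ d ≥ f', HasDerivAt (fun v => clampTo η r g₀ g₁ v (f v)) d v := by
  have e1 : HasDerivAt (step 0 η) (deriv (step 0 η) v) v :=
    ((contDiff_step 0 η).differentiable (by simp) v).hasDerivAt
  have e2 : HasDerivAt (step (1 - η) 1) (deriv (step (1 - η) 1) v) v :=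
    ((contDiff_step (1 - η) 1).differentiable (by simp) v).hasDerivAt
  have d1 := deriv_step_nonneg hη v
  have d2 := deriv_step_nonneg (show 1 - η < 1 by linarith) v
  refine ⟨_, ?_, (hf.sub (((e1.const_sub 1).const_mul r).mul_const g₀)).add
    ((e2.const_mul r).mul_const (1 - g₁))⟩
  by_cases hr : r = 0
  · simp [hr]
  · obtain ⟨h1, h2⟩ := hg hr
    nlinarith [mul_nonneg (mul_nonneg hr0 d1) h1, mul_nonneg (mul_nonneg hr0 d2) (sub_nonneg.2 h2)]

end

/-- A continuous curve on which a function is constant is constant if that function has nonzero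
derivative along the curve. -/
theorem eq_of_comp_const {S : Set ℝ} (hS : IsPreconnected S) {c g : ℝ → ℝ} {k : ℝ}
    (hc : ContinuousOn c S) (hg : ∀ u ∈ S, g (c u) = k)
    (hd : ∀ u ∈ S, ∃ d ≠ 0, HasDerivAt g d (c u)) {u v : ℝ} (hu : u ∈ S) (hv : v ∈ S) :
    c u = c v := by
  by_contra hne
  wlog hlt : c u < c v generalizing u v
  · exact this hv hu (Ne.symm hne) (lt_of_le_of_ne (not_lt.1 hlt) (Ne.symm hne))
  have hmem : ∀ y ∈ Icc (c u) (c v), ∃ w ∈ S, c w = y := fun y hy => hS.intermediate_value hu hv hc hy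
  obtain ⟨w, hw, hwe⟩ := hmem ((c u + c v)/2) ⟨by linarith, by linarith⟩
  obtain ⟨d, hd0, hd⟩ := hd w hw
  have : g =ᶠ[nhds (c w)] fun _ => k := by
    rw [hwe]
    filter_upwards [Ioo_mem_nhds (show c u < (c u + c v)/2 by linarith)
      (show (c u + c v)/2 < c v by linarith)] with y hy
    obtain ⟨w', hw', rfl⟩ := hmem y (Ioo_subset_Icc_self hy)
    exact hg w' hw'
  exact hd0 (hd.unique ((hasDerivAt_const (c w) k).congr_of_eventuallyEq this))

/-- Correct the map `h` near the side faces of the cube, in the collar of the top level, so that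
it preserves these faces there. -/
def tame (η ε : ℝ) (h : Pt4 → Pt4) (p : Pt4) : Pt4 :=
  (clampTo η (step (1 - ε/2) (1 - ε/4) (z4 p)) (x4 (h (0, y4 p, z4 p, t4 p)))
      (x4 (h (1, y4 p, z4 p, t4 p))) (x4 p) (x4 (h p)),
    clampTo η (step (1 - 3*ε/4) (1 - ε/2) (z4 p)) (y4 (h (0, 0, z4 p, t4 p)))
      (y4 (h (0, 1, z4 p, t4 p))) (y4 p) (y4 (h p)),
    z4 (h p), t4 (h p))

/-- A weak diffeomorphism of the cube that is triangular and positive in the collar of the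
top level. -/
structure Frame (h G : Pt4 → Pt4) (ε : ℝ) : Prop where
  smooth : ContDiff ℝ (⊤ : ℕ∞) h
  smooth_inv : ContDiff ℝ (⊤ : ℕ∞) G
  mapsTo : MapsTo h cube4 cube4
  inv : InvOn G h cube4 cube4
  ε_pos : 0 < ε
  ε_le : ε ≤ 1/4
  tri : Tri h (1 - ε) 1
  t_inv : ∀ q ∈ cube4, t4 (G q) ∈ II
  pos : ∀ p ∈ cube4, z4 p ∈ Icc (1 - ε) 1 → 0 < dX h p ∧ 0 < dY h p ∧ 0 < dT h p

theorem strictMonoOn_of_hasDerivAt_pos {f f' : ℝ → ℝ} (hf : ∀ u, HasDerivAt f (f' u) u)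
    (hpos : ∀ u ∈ II, 0 < f' u) : StrictMonoOn f II := by
  refine strictMonoOn_of_deriv_pos (convex_Icc 0 1)
    (fun u _ => (hf u).continuousAt.continuousWithinAt) fun u hu => ?_
  rw [(hf u).deriv]
  exact hpos u (interior_subset hu)

section
variable {h : Pt4 → Pt4} {η ε : ℝ}

theorem tame_eq_of_le (hε : 0 < ε) {p : Pt4} (hp : z4 p ≤ 1 - 3*ε/4) : tame η ε h p = h p := by
  simp only [tame]
  rw [step_of_le (by linarith) hp, step_of_le (by linarith) (by linarith), clampTo_zero_left,
    clampTo_zero_left]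
  rfl

theorem tame_eq_of_mid (hη : 0 < η) {p : Pt4} (hx : x4 p ∈ Icc η (1 - η))
    (hy : y4 p ∈ Icc η (1 - η)) : tame η ε h p = h p := by
  simp only [tame]
  rw [clampTo_middle hη hx.1 hx.2, clampTo_middle hη hy.1 hy.2]
  rfl

theorem tame_id (p : Pt4) : tame η ε (fun p => p) p = p := by
  simp only [tame, x4, y4]
  rw [clampTo_of_ends, clampTo_of_ends]
  rfl

theorem Tri.tame (hT : Tri h (1 - ε) 1) : Tri (tame η ε h) (1 - ε) 1 where
  z_eq := hT.z_eq
  t_eq := hT.t_eq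
  y_eq z hz x x' y t := by
    simp only [HDA4.tame, y4, z4, t4]
    congr 1
    exact hT.y_eq z hz x x' y t

theorem tame_faces (hη : 0 < η) (hη1 : η ≤ 1/2) (hε : 0 < ε) (hT : Tri h (1 - ε) 1) {p : Pt4}
    (hz : z4 p ∈ Icc (1 - ε/4) 1) :
    (x4 p = 0 → x4 (HDA4.tame η ε h p) = 0) ∧ (x4 p = 1 → x4 (HDA4.tame η ε h p) = 1) ∧
    (y4 p = 0 → y4 (HDA4.tame η ε h p) = 0) ∧ (y4 p = 1 → y4 (HDA4.tame η ε h p) = 1) := by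
  obtain ⟨x, y, z, t⟩ := p
  simp only [HDA4.tame, x4, y4, z4, t4] at hz ⊢
  have hz' : z ∈ Icc (1 - ε) 1 := ⟨by linarith [hz.1], hz.2⟩
  have e := hT.y_eq z hz' x 0 y t
  simp only [y4] at e
  rw [step_of_ge (show 1 - ε/2 < 1 - ε/4 by linarith) hz.1,
    step_of_ge (show 1 - 3*ε/4 < 1 - ε/2 by linarith) (by linarith [hz.1]), e]
  refine ⟨?_, ?_, ?_, ?_⟩
  · rintro rfl; rw [clampTo_zero hη hη1 _ le_rfl]; ring
  · rintro rfl; rw [clampTo_one hη hη1 _ le_rfl]; ring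
  · rintro rfl; rw [clampTo_zero hη hη1 _ le_rfl]; ring
  · rintro rfl; rw [clampTo_one hη hη1 _ le_rfl]; ring

end

section
variable {h G : Pt4 → Pt4} {η ε c : ℝ}

theorem Frame.differentiable (hF : Frame h G ε) : Differentiable ℝ h :=
  hF.smooth.differentiable (by simp)

theorem Frame.mono_x (hF : Frame h G ε) (hc : c ∈ Icc (1 - ε) 1) {y t : ℝ} (hy : y ∈ II) (ht : t ∈ II) :
    StrictMonoOn (fun x => x4 (h (x, y, c, t))) II :=
  strictMonoOn_of_hasDerivAt_pos (fun x => hasDerivAt_dX hF.differentiable x y c t)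
    fun x' hx => (hF.pos (x', y, c, t) ⟨hx, hy, ⟨by linarith [hc.1, hF.ε_le], hc.2⟩, ht⟩ hc).1

theorem Frame.mono_y (hF : Frame h G ε) (hc : c ∈ Icc (1 - ε) 1) {x t : ℝ} (hx : x ∈ II) (ht : t ∈ II) :
    StrictMonoOn (fun y => y4 (h (x, y, c, t))) II :=
  strictMonoOn_of_hasDerivAt_pos (fun y => hasDerivAt_dY hF.differentiable x y c t)
    fun y' hy => (hF.pos (x, y', c, t) ⟨hx, hy, ⟨by linarith [hc.1, hF.ε_le], hc.2⟩, ht⟩ hc).2.1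

theorem Frame.mono_t (hF : Frame h G ε) (hc : c ∈ Icc (1 - ε) 1) {x y : ℝ} (hx : x ∈ II) (hy : y ∈ II) :
    StrictMonoOn (fun t => t4 (h (x, y, c, t))) II :=
  strictMonoOn_of_hasDerivAt_pos (fun t => hasDerivAt_dT hF.differentiable x y c t)
    fun t' ht => (hF.pos (x, y, c, t') ⟨hx, hy, ⟨by linarith [hc.1, hF.ε_le], hc.2⟩, ht⟩ hc).2.2

theorem Frame.level_mem (hF : Frame h G ε) (hc : c ∈ Icc (1 - ε) 1) : c ∈ II :=
  ⟨by linarith [hc.1, hF.ε_le], hc.2⟩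

theorem Frame.base_mem (hF : Frame h G ε) : ((0, 0, 1 - ε/2, 0) : Pt4) ∈ cube4 :=
  ⟨zero_mem_II, zero_mem_II, hF.level_mem ⟨by linarith [hF.ε_pos], by linarith [hF.ε_pos]⟩, zero_mem_II⟩

theorem Frame.base_level (hF : Frame h G ε) : zL ((0, 0, 1 - ε/2, 0) : Pt4) ∈ Ioo (1 - ε) 1 := by
  have := hF.ε_pos
  rw [zL_apply]; simp only [z4]; constructor <;> linarith

theorem Frame.z_inv (hF : Frame h G ε) {q : Pt4} (hq : q ∈ cube4) (hz : z4 q ∈ Icc (1 - ε) 1) :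
    z4 (G q) = z4 q :=
  level_inverse_eq (l := zL) convex_cube4 hF.smooth_inv.continuous hF.mapsTo hF.inv hF.tri.z_eq
    hF.base_mem hF.base_level hq hz

theorem Frame.z_inv_lt (hF : Frame h G ε) {q : Pt4} (hq : q ∈ cube4) (hz : z4 q < 1 - ε) :
    z4 (G q) < 1 - ε :=
  level_inverse_lt_of_lt (l := zL) convex_cube4 hF.smooth_inv.continuous hF.mapsTo hF.inv hF.tri.z_eq
    hF.base_mem hF.base_level (fun _ hq => hq.2.2.1.2) hq hz

theorem Frame.mapsTo_tame (hF : Frame h G ε) : MapsTo (tame η ε h) cube4 cube4 := by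
  intro p hp
  rcases le_total (z4 p) (1 - 3*ε/4) with hz | hz
  · rw [tame_eq_of_le hF.ε_pos hz]
    exact hF.mapsTo hp
  have hε := hF.ε_pos
  obtain ⟨x, y, z, t⟩ := p
  have hp' := hF.mapsTo hp
  obtain ⟨hx, hy, hz1, ht⟩ := mem_cube4.1 hp
  simp only [x4, y4, z4, t4] at hx hy hz1 ht hz
  have hzz : z ∈ Icc (1 - ε) 1 := ⟨by linarith, hz1.2⟩
  refine mem_cube4.2 ⟨?_, ?_, hp'.2.2.1, hp'.2.2.2⟩
  · have m := (hF.mono_x hzz hy ht).monotoneOn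
    exact clampTo_mem_II (step_nonneg _ _ _) (step_le_one _ _ _)
      (hF.mapsTo (x := (0, y, z, t)) ⟨zero_mem_II, hy, hz1, ht⟩).1
      (hF.mapsTo (x := (1, y, z, t)) ⟨one_mem_II, hy, hz1, ht⟩).1
      ⟨m zero_mem_II hx hx.1, m hx one_mem_II hx.2⟩ _
  · have m := (hF.mono_y hzz zero_mem_II ht).monotoneOn
    refine clampTo_mem_II (step_nonneg _ _ _) (step_le_one _ _ _)
      (hF.mapsTo (x := (0, 0, z, t)) ⟨zero_mem_II, zero_mem_II, hz1, ht⟩).2.1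
      (hF.mapsTo (x := (0, 1, z, t)) ⟨zero_mem_II, one_mem_II, hz1, ht⟩).2.1 ?_ _
    rw [hF.tri.y_eq z hzz x 0 y t]
    exact ⟨m zero_mem_II hy hy.1, m hy one_mem_II hy.2⟩

theorem Frame.t_inv_eq (hF : Frame h G ε) {q q' : Pt4} (hq : q ∈ cube4) (hq' : q' ∈ cube4)
    (hz : z4 q ∈ Icc (1 - ε) 1) (hzz : z4 q = z4 q') (htt : t4 q = t4 q') : t4 (G q) = t4 (G q') := by
  have key : ∀ q ∈ cube4, z4 q ∈ Icc (1 - ε) 1 → t4 (h (0, 0, z4 q, t4 (G q))) = t4 q := by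
    intro q hq hz
    rw [hF.tri.t_eq _ hz 0 (x4 (G q)) 0 (y4 (G q)), ← hF.z_inv hq hz]
    exact congrArg t4 (hF.inv.2 hq)
  refine (hF.mono_t hz zero_mem_II zero_mem_II).injOn (hF.t_inv q hq) (hF.t_inv q' hq') ?_
  have h2 := key q' hq' (hzz ▸ hz)
  rw [← hzz] at h2
  exact (key q hq hz).trans (htt.trans h2.symm)

theorem Frame.fderiv_injective (hF : Frame h G ε) {q : Pt4} (hq : q ∈ cube4) :
    Function.Injective (fderiv ℝ h (G q)) :=
  fderiv_injective_of_rightInvOn convex_cube4 interior_cube4_nonempty hF.differentiable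
    (hF.smooth_inv.differentiable (by simp)) hF.inv.2 hq

theorem Frame.diag_ne_zero (hF : Frame h G ε) {q : Pt4} (hq : q ∈ cube4) (hz : z4 q ∈ Icc (1 - ε) 1) :
    dX h (G q) ≠ 0 ∧ dY h (G q) ≠ 0 ∧ dT h (G q) ≠ 0 :=
  hF.tri.diag_ne_zero (by linarith [hF.ε_pos]) hF.differentiable
    (by rw [hF.z_inv hq hz]; exact hz) (hF.fderiv_injective hq)

theorem Frame.diag_pos (hF : Frame h G ε) {q : Pt4} (hq : q ∈ cube4) (hz : z4 q ∈ Icc (1 - ε) 1) :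
    0 < dX h (G q) ∧ 0 < dY h (G q) := by
  have hS : IsPreconnected (cube4 ∩ zL ⁻¹' Icc (1 - ε) 1) :=
    (convex_cube4.inter ((convex_Icc _ _).linear_preimage zL.toLinearMap)).isPreconnected
  have hc : ∀ v, Continuous fun q => fderiv ℝ h (G q) v := fun v =>
    ((hF.smooth.continuous_fderiv (by simp)).comp hF.smooth_inv.continuous).clm_apply continuous_const
  have hb := hF.base_mem
  have hbz : z4 ((0, 0, 1 - ε/2, 0) : Pt4) ∈ Icc (1 - ε) 1 := Ioo_subset_Icc_self hF.base_level
  have hm : h (0, 0, 1 - ε/2, 0) ∈ cube4 ∩ zL ⁻¹' Icc (1 - ε) 1 :=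
    ⟨hF.mapsTo hb, by rw [mem_preimage, zL_apply, hF.tri.z_eq _ hbz]; exact hbz⟩
  have hp := hF.pos _ hb hbz
  exact ⟨pos_of_isPreconnected hS (f := fun q => dX h (G q)) (continuous_x4.comp (hc ex)).continuousOn
      (fun q hq => (hF.diag_ne_zero hq.1 hq.2).1) hm (by rw [hF.inv.1 hb]; exact hp.1) ⟨hq, hz⟩,
    pos_of_isPreconnected hS (f := fun q => dY h (G q)) (continuous_y4.comp (hc ey)).continuousOn
      (fun q hq => (hF.diag_ne_zero hq.1 hq.2).2.1) hm (by rw [hF.inv.1 hb]; exact hp.2.1) ⟨hq, hz⟩⟩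

/-- The inverse has the form `(x', y', c, t)` on the level `z = c`. -/
theorem Frame.inv_eq (hF : Frame h G ε) (hc : c ∈ Icc (1 - ε) 1) {x y t : ℝ} (hx : x ∈ II) (hy : y ∈ II)
    (ht : t ∈ II) : G (x, y, c, t) =
      (x4 (G (x, y, c, t)), y4 (G (0, y, c, t)), c, t4 (G (0, 0, c, t))) := by
  have hcI := hF.level_mem hc
  have hm : ∀ x ∈ II, ((x, y, c, t) : Pt4) ∈ cube4 := fun x hx => ⟨hx, hy, hcI, ht⟩
  have hT : ∀ x ∈ II, t4 (G (x, y, c, t)) = t4 (G (0, 0, c, t)) := fun x hx =>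
    hF.t_inv_eq (hm x hx) ⟨zero_mem_II, zero_mem_II, hcI, ht⟩ hc rfl rfl
  refine pt4_ext rfl ?_ (hF.z_inv (hm x hx) hc) (hT x hx)
  refine eq_of_comp_const (S := II) isPreconnected_Icc (c := fun x => y4 (G (x, y, c, t)))
    (g := fun v => y4 (h (0, v, c, t4 (G (0, 0, c, t))))) (k := y)
    (continuous_y4.comp (hF.smooth_inv.continuous.comp (by fun_prop))).continuousOn ?_ ?_ hx zero_mem_II
  · intro u hu
    rw [← hT u hu, hF.tri.y_eq c hc 0 (x4 (G (u, y, c, t)))]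
    have h1 : ((x4 (G (u, y, c, t)), y4 (G (u, y, c, t)), c, t4 (G (u, y, c, t))) : Pt4) =
      G (u, y, c, t) := pt4_ext rfl rfl (hF.z_inv (hm u hu) hc).symm rfl
    rw [h1]
    exact congrArg y4 (hF.inv.2 (hm u hu))
  · intro u hu
    refine ⟨_, (hF.diag_ne_zero (hm u hu) hc).2.1, ?_⟩
    have h1 : (fun v => y4 (h (0, v, c, t4 (G (0, 0, c, t))))) = fun v =>
        y4 (h (x4 (G (u, y, c, t)), v, z4 (G (u, y, c, t)), t4 (G (u, y, c, t)))) := by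
      funext v
      rw [hF.z_inv (hm u hu) hc, hT u hu]
      exact hF.tri.y_eq c hc _ _ _ _
    rw [h1]
    exact hasDerivAt_dY hF.differentiable _ _ _ _

end

section
variable {h G : Pt4 → Pt4} {η ε c : ℝ}

theorem contDiff_tame (hh : ContDiff ℝ (⊤ : ℕ∞) h) : ContDiff ℝ (⊤ : ℕ∞) (tame η ε h) := by
  have := contDiff_step
  unfold tame clampTo x4 y4 z4 t4
  fun_prop

/-- The values of the tamed map at the points of the inverse image of a level. -/
theorem Frame.tame_inv (hF : Frame h G ε) (hc : c ∈ Icc (1 - ε) 1) {x y t : ℝ} (hx : x ∈ II)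
    (hy : y ∈ II) (ht : t ∈ II) : tame η ε h (G (x, y, c, t)) =
      (clampTo η (step (1 - ε/2) (1 - ε/4) c)
        (x4 (h (0, y4 (G (0, y, c, t)), c, t4 (G (0, 0, c, t)))))
        (x4 (h (1, y4 (G (0, y, c, t)), c, t4 (G (0, 0, c, t))))) (x4 (G (x, y, c, t))) x,
      clampTo η (step (1 - 3*ε/4) (1 - ε/2) c) (y4 (h (0, 0, c, t4 (G (0, 0, c, t)))))
        (y4 (h (0, 1, c, t4 (G (0, 0, c, t))))) (y4 (G (0, y, c, t))) y, c, t) := by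
  have hm : ((x, y, c, t) : Pt4) ∈ cube4 := ⟨hx, hy, hF.level_mem hc, ht⟩
  have e := hF.inv_eq hc hx hy ht
  have ey : y4 (G (x, y, c, t)) = y4 (G (0, y, c, t)) := by rw [e]; rfl
  have ez : z4 (G (x, y, c, t)) = c := congrArg z4 e
  have et : t4 (G (x, y, c, t)) = t4 (G (0, 0, c, t)) := by rw [e]; rfl
  simp only [tame]
  rw [ey, ez, et, hF.inv.2 hm]
  rfl

theorem Frame.y_inv (hF : Frame h G ε) (hc : c ∈ Icc (1 - ε) 1) {y t : ℝ} (hy : y ∈ II) (ht : t ∈ II) :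
    y4 (h (0, y4 (G (0, y, c, t)), c, t4 (G (0, 0, c, t)))) = y := by
  have hm : ((0, y, c, t) : Pt4) ∈ cube4 := ⟨zero_mem_II, hy, hF.level_mem hc, ht⟩
  have e := hF.inv_eq hc zero_mem_II hy ht
  rw [hF.tri.y_eq c hc 0 (x4 (G (0, y, c, t))), ← e]
  exact congrArg y4 (hF.inv.2 hm)

/-- A point of the cube whose `t` coordinate is that of the inverse of the level `t`. -/
theorem Frame.map_eq (hF : Frame h G ε) (hc : c ∈ Icc (1 - ε) 1) {x y t : ℝ} (hx : x ∈ II)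
    (hy : y ∈ II) (ht : t ∈ II) :
    h (x, y, c, t4 (G (0, 0, c, t))) = (x4 (h (x, y, c, t4 (G (0, 0, c, t)))),
      y4 (h (0, y, c, t4 (G (0, 0, c, t)))), c, t) ∧ h (x, y, c, t4 (G (0, 0, c, t))) ∈ cube4 := by
  have hm0 : ((0, 0, c, t) : Pt4) ∈ cube4 := ⟨zero_mem_II, zero_mem_II, hF.level_mem hc, ht⟩
  refine ⟨pt4_ext rfl (hF.tri.y_eq c hc _ _ _ _) (hF.tri.z_eq _ hc) ?_,
    hF.mapsTo ⟨hx, hy, hF.level_mem hc, hF.t_inv _ hm0⟩⟩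
  have e := hF.inv_eq hc zero_mem_II zero_mem_II ht
  rw [hF.tri.t_eq c hc x (x4 (G (0, 0, c, t))) y (y4 (G (0, 0, c, t))), ← e]
  rw [hF.inv.2 hm0]; rfl

theorem Frame.clamp_y (hF : Frame h G ε) (hη : 0 < η) (hη1 : η ≤ 1/2) (hc : c ∈ Icc (1 - ε) 1)
    {r t : ℝ} (hr : 0 ≤ r) (ht : t ∈ II) :
    StrictMonoOn (fun y => clampTo η r (y4 (h (0, 0, c, t4 (G (0, 0, c, t)))))
        (y4 (h (0, 1, c, t4 (G (0, 0, c, t))))) (y4 (G (0, y, c, t))) y) II ∧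
      clampTo η r (y4 (h (0, 0, c, t4 (G (0, 0, c, t))))) (y4 (h (0, 1, c, t4 (G (0, 0, c, t)))))
        (y4 (G (0, 0, c, t))) 0 ≤ 0 ∧
      1 ≤ clampTo η r (y4 (h (0, 0, c, t4 (G (0, 0, c, t))))) (y4 (h (0, 1, c, t4 (G (0, 0, c, t)))))
        (y4 (G (0, 1, c, t))) 1 ∧
      (r = 1 → ∀ y ∈ II, clampTo η r (y4 (h (0, 0, c, t4 (G (0, 0, c, t)))))
        (y4 (h (0, 1, c, t4 (G (0, 0, c, t))))) (y4 (G (0, y, c, t))) y ∈ II →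
        y4 (G (0, y, c, t)) ∈ II) := by
  have hT := hF.t_inv _ (show ((0, 0, c, t) : Pt4) ∈ cube4 from
    ⟨zero_mem_II, zero_mem_II, hF.level_mem hc, ht⟩)
  have key : ∀ y ∈ II, y4 (G (0, y4 (h (0, y, c, t4 (G (0, 0, c, t)))), c, t)) = y ∧
      y4 (h (0, y, c, t4 (G (0, 0, c, t)))) ∈ II := by
    intro y hy
    obtain ⟨e1, e2⟩ := hF.map_eq hc zero_mem_II hy ht
    refine ⟨?_, e2.2.1⟩
    have e3 := hF.inv_eq hc e2.1 e2.2.1 ht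
    have e4 := hF.inv.1 (show ((0, y, c, t4 (G (0, 0, c, t))) : Pt4) ∈ cube4 from
      ⟨zero_mem_II, hy, hF.level_mem hc, hT⟩)
    rw [e1] at e4
    exact (congrArg y4 e3).symm.trans (congrArg y4 e4)
  obtain ⟨k0, m0⟩ := key 0 zero_mem_II
  obtain ⟨k1, m1⟩ := key 1 one_mem_II
  refine clampTo_comp hη hη1 hr (n := fun y => y4 (G (0, y, c, t)))
    (strictMonoOn_of_two ?_ ?_ m0 m1 ?_ k0 k1) m0 m1 k0 k1
  · exact (continuous_y4.comp (hF.smooth_inv.continuous.comp (by fun_prop))).continuousOn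
  · intro y hy y' hy' he
    simp only at he
    rw [← hF.y_inv hc hy ht, he, hF.y_inv hc hy' ht]
  · exact hF.mono_y hc zero_mem_II hT zero_mem_II one_mem_II one_pos

theorem Frame.clamp_x (hF : Frame h G ε) (hη : 0 < η) (hη1 : η ≤ 1/2) (hc : c ∈ Icc (1 - ε) 1)
    {r y t : ℝ} (hr : 0 ≤ r) (hy : y ∈ II) (ht : t ∈ II) (hY : y4 (G (0, y, c, t)) ∈ II) :
    StrictMonoOn (fun x => clampTo η r (x4 (h (0, y4 (G (0, y, c, t)), c, t4 (G (0, 0, c, t)))))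
        (x4 (h (1, y4 (G (0, y, c, t)), c, t4 (G (0, 0, c, t))))) (x4 (G (x, y, c, t))) x) II ∧
      clampTo η r (x4 (h (0, y4 (G (0, y, c, t)), c, t4 (G (0, 0, c, t)))))
        (x4 (h (1, y4 (G (0, y, c, t)), c, t4 (G (0, 0, c, t))))) (x4 (G (0, y, c, t))) 0 ≤ 0 ∧
      1 ≤ clampTo η r (x4 (h (0, y4 (G (0, y, c, t)), c, t4 (G (0, 0, c, t)))))
        (x4 (h (1, y4 (G (0, y, c, t)), c, t4 (G (0, 0, c, t))))) (x4 (G (1, y, c, t))) 1 := by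
  have hT := hF.t_inv _ (show ((0, 0, c, t) : Pt4) ∈ cube4 from
    ⟨zero_mem_II, zero_mem_II, hF.level_mem hc, ht⟩)
  have key : ∀ x ∈ II, x4 (G (x4 (h (x, y4 (G (0, y, c, t)), c, t4 (G (0, 0, c, t)))), y, c, t)) = x ∧
      x4 (h (x, y4 (G (0, y, c, t)), c, t4 (G (0, 0, c, t)))) ∈ II := by
    intro x hx
    obtain ⟨e1, e2⟩ := hF.map_eq hc hx hY ht
    refine ⟨?_, e2.1⟩
    rw [hF.y_inv hc hy ht] at e1
    have e4 := hF.inv.1 (show ((x, y4 (G (0, y, c, t)), c, t4 (G (0, 0, c, t))) : Pt4) ∈ cube4 from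
      ⟨hx, hY, hF.level_mem hc, hT⟩)
    rw [e1] at e4
    exact congrArg x4 e4
  obtain ⟨k0, m0⟩ := key 0 zero_mem_II
  obtain ⟨k1, m1⟩ := key 1 one_mem_II
  have := clampTo_comp hη hη1 hr (n := fun x => x4 (G (x, y, c, t)))
    (strictMonoOn_of_two ?_ ?_ m0 m1 ?_ k0 k1) m0 m1 k0 k1
  · exact ⟨this.1, this.2.1, this.2.2.1⟩
  · exact (continuous_x4.comp (hF.smooth_inv.continuous.comp (by fun_prop))).continuousOn
  · intro x hx x' hx' he
    simp only at he
    have e1 := hF.inv_eq hc hx hy ht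
    rw [he, ← hF.inv_eq hc hx' hy ht] at e1
    have h1 := hF.inv.2 (show ((x, y, c, t) : Pt4) ∈ cube4 from ⟨hx, hy, hF.level_mem hc, ht⟩)
    have h2 := hF.inv.2 (show ((x', y, c, t) : Pt4) ∈ cube4 from ⟨hx', hy, hF.level_mem hc, ht⟩)
    rw [e1, h2] at h1
    exact (congrArg x4 h1).symm
  · exact hF.mono_x hc hY hT zero_mem_II one_mem_II one_pos

theorem Frame.y_inv_mem (hF : Frame h G ε) (hη : 0 < η) (hη1 : η ≤ 1/2) (hc : c ∈ Icc (1 - ε) 1)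
    (hc2 : 1 - ε/2 ≤ c) {y t : ℝ} (hy : y ∈ II) (ht : t ∈ II)
    (hm : y4 (tame η ε h (G (0, y, c, t))) ∈ II) : y4 (G (0, y, c, t)) ∈ II := by
  rw [hF.tame_inv hc zero_mem_II hy ht] at hm
  have hε := hF.ε_pos
  have r1 : step (1 - 3*ε/4) (1 - ε/2) c = 1 := step_of_ge (by linarith) hc2
  exact (hF.clamp_y hη hη1 hc (step_nonneg _ _ _) ht).2.2.2 r1 y hy hm

theorem Frame.box (hF : Frame h G ε) (hη : 0 < η) (hη1 : η ≤ 1/2) (hc : c ∈ Icc (1 - ε) 1) :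
    Box (fun q => tame η ε h (G q)) c where
  z_eq x hx y hy t ht := by rw [hF.tame_inv hc hx hy ht]; rfl
  t_eq x hx y hy t ht := by
    rw [hF.tame_inv hc hx hy ht, hF.tame_inv hc zero_mem_II zero_mem_II ht]; rfl
  y_eq x hx y hy t ht := by
    rw [hF.tame_inv hc hx hy ht, hF.tame_inv hc zero_mem_II hy ht]; rfl
  t_mono := by
    refine strictMonoOn_id.congr fun t ht => ?_
    rw [hF.tame_inv hc zero_mem_II zero_mem_II ht]; rfl
  t_zero := by rw [hF.tame_inv hc zero_mem_II zero_mem_II zero_mem_II]; exact le_rfl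
  t_one := by rw [hF.tame_inv hc zero_mem_II zero_mem_II one_mem_II]; exact le_rfl
  y_mono t ht := by
    refine (hF.clamp_y hη hη1 hc (step_nonneg (1 - 3*ε/4) (1 - ε/2) c) ht).1.congr fun y hy => ?_
    rw [hF.tame_inv hc zero_mem_II hy ht]; rfl
  y_zero t ht := by
    rw [hF.tame_inv hc zero_mem_II zero_mem_II ht]
    exact (hF.clamp_y hη hη1 hc (step_nonneg _ _ _) ht).2.1
  y_one t ht := by
    rw [hF.tame_inv hc zero_mem_II one_mem_II ht]
    exact (hF.clamp_y hη hη1 hc (step_nonneg _ _ _) ht).2.2.1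
  x_mono t ht y hy hm := by
    have hε := hF.ε_pos
    rw [hF.tame_inv hc zero_mem_II hy ht, hF.tame_inv hc one_mem_II hy ht]
    rcases le_total c (1 - ε/2) with hc2 | hc2
    · have r2 : step (1 - ε/2) (1 - ε/4) c = 0 := step_of_le (by linarith) hc2
      refine ⟨strictMonoOn_id.congr fun x hx => ?_, ?_, ?_⟩
      · rw [hF.tame_inv hc hx hy ht, r2, clampTo_zero_left]; rfl
      · rw [r2, clampTo_zero_left]; exact le_rfl
      · rw [r2, clampTo_zero_left]; exact le_rfl
    · have hY := hF.y_inv_mem hη hη1 hc hc2 hy ht hm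
      obtain ⟨a1, a2, a3⟩ := hF.clamp_x hη hη1 hc (step_nonneg (1 - ε/2) (1 - ε/4) c) hy ht hY
      refine ⟨a1.congr fun x hx => ?_, a2, a3⟩
      rw [hF.tame_inv hc hx hy ht]; rfl

theorem Frame.fderiv_tame_injective (hF : Frame h G ε) (hη : 0 < η) (hη1 : η ≤ 1/2) {q : Pt4}
    (hq : q ∈ cube4) (hFq : tame η ε h (G q) ∈ cube4) :
    Function.Injective (fderiv ℝ (tame η ε h) (G q)) := by
  have hε := hF.ε_pos
  rcases lt_or_ge (z4 q) (1 - ε) with hz | hz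
  · have hz' := hF.z_inv_lt hq hz
    have : tame η ε h =ᶠ[nhds (G q)] h := by
      filter_upwards [(isOpen_Iio.preimage continuous_z4).mem_nhds
        (show G q ∈ z4 ⁻¹' Iio (1 - ε) from hz')] with p hp
      have hp : z4 p < 1 - ε := hp
      exact tame_eq_of_le hε (by linarith)
    rw [this.fderiv_eq]
    exact hF.fderiv_injective hq
  have hc : z4 q ∈ Icc (1 - ε) 1 := ⟨hz, hq.2.2.1.2⟩
  have hcI := hF.level_mem hc
  obtain ⟨x, y, c, t⟩ := q
  obtain ⟨hx, hy, -, ht⟩ := mem_cube4.1 hq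
  simp only [x4, y4, z4, t4] at hx hy hc hcI ht
  have hd : Differentiable ℝ (tame η ε h) := (contDiff_tame hF.smooth).differentiable (by simp)
  have hzG := hF.z_inv hq hc
  have htG := hF.t_inv _ hq
  obtain ⟨px, py⟩ := hF.diag_pos hq hc
  have pt := (hF.diag_ne_zero hq hc).2.2
  have hYI : 1 - ε/2 ≤ c → y4 (G (x, y, c, t)) ∈ II := fun hc2 => by
    rw [hF.inv_eq hc hx hy ht]
    refine hF.y_inv_mem hη hη1 hc hc2 hy ht ?_
    have := hFq.2.1
    rw [hF.tame_inv hc hx hy ht] at this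
    rw [hF.tame_inv hc zero_mem_II hy ht]
    exact this
  set p := G (x, y, c, t) with hp
  have hzp : z4 p = c := hzG
  refine hF.tri.tame.injective_of_diag (by linarith) hd (hzp ▸ hc) (ne_of_gt ?_) (ne_of_gt ?_) ?_
  · obtain ⟨d, hd1, hd2⟩ := exists_hasDerivAt_clampTo (η := η)
      (r := step (1 - ε/2) (1 - ε/4) (z4 p)) hη (step_nonneg _ _ _)
      (hasDerivAt_dX hF.differentiable (x4 p) (y4 p) (z4 p) (t4 p))
      (g₀ := x4 (h (0, y4 p, z4 p, t4 p))) (g₁ := x4 (h (1, y4 p, z4 p, t4 p))) (fun hr => by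
        have hc2 : 1 - ε/2 ≤ c := by
          by_contra! hcon
          exact hr (step_of_le (by linarith) (by linarith))
        have hY := hYI hc2
        have m : ∀ x ∈ II, ((x, y4 p, z4 p, t4 p) : Pt4) ∈ cube4 := fun x hx =>
          ⟨hx, hY, hzp ▸ hcI, htG⟩
        exact ⟨(hF.mapsTo (m 0 zero_mem_II)).1.1, (hF.mapsTo (m 1 one_mem_II)).1.2⟩)
    have := hd2.unique (hasDerivAt_dX hd (x4 p) (y4 p) (z4 p) (t4 p))
    have e : dX (tame η ε h) p = d := this.symm
    rw [e]
    exact px.trans_le hd1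
  · have m : ∀ y ∈ II, ((0, y, z4 p, t4 p) : Pt4) ∈ cube4 := fun y hy =>
      ⟨zero_mem_II, hy, hzp ▸ hcI, htG⟩
    obtain ⟨d, hd1, hd2⟩ := exists_hasDerivAt_clampTo (η := η)
      (r := step (1 - 3*ε/4) (1 - ε/2) (z4 p)) hη (step_nonneg _ _ _)
      (hasDerivAt_dY hF.differentiable (x4 p) (y4 p) (z4 p) (t4 p))
      (g₀ := y4 (h (0, 0, z4 p, t4 p))) (g₁ := y4 (h (0, 1, z4 p, t4 p))) (fun _ =>
        ⟨(hF.mapsTo (m 0 zero_mem_II)).2.1.1, (hF.mapsTo (m 1 one_mem_II)).2.1.2⟩)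
    have := hd2.unique (hasDerivAt_dY hd (x4 p) (y4 p) (z4 p) (t4 p))
    have e : dY (tame η ε h) p = d := this.symm
    rw [e]
    exact py.trans_le hd1
  · have e : dT (tame η ε h) p = dT h p :=
      (hasDerivAt_dT hd (x4 p) (y4 p) (z4 p) (t4 p)).unique
        (hasDerivAt_dT hF.differentiable (x4 p) (y4 p) (z4 p) (t4 p))
    rw [e]
    exact pt

theorem Frame.exists_inv_tame (hF : Frame h G ε) (hη : 0 < η) (hη1 : η ≤ 1/2) :
    ∃ G' : Pt4 → Pt4, ContDiff ℝ (⊤ : ℕ∞) G' ∧ InvOn G' (tame η ε h) cube4 cube4 := by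
  have hε := hF.ε_pos
  have hcG := hF.smooth_inv.continuous
  have hct : Continuous (tame η ε h) := (contDiff_tame hF.smooth).continuous
  have hz : ∀ q ∈ cube4, z4 (tame η ε h (G q)) = z4 q := fun q hq => by
    change z4 (h (G q)) = z4 q
    rw [hF.inv.2 hq]
  have hlow : ∀ q ∈ cube4, z4 q < 1 - ε → tame η ε h (G q) = q := fun q hq hlt => by
    rw [tame_eq_of_le hε (by linarith [hF.z_inv_lt hq hlt])]
    exact hF.inv.2 hq
  refine exists_contDiff_invOn (Q := G '' (cube4 ∩ (fun q => tame η ε h (G q)) ⁻¹' cube4))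
    (contDiff_tame hF.smooth)
    ((isCompact_cube4.inter_right (isCompact_cube4.isClosed.preimage (hct.comp hcG))).image hcG)
    ?_ ?_ ?_ ?_
  · rintro _ ⟨q, ⟨hq, hFq⟩, rfl⟩ _ ⟨q', ⟨hq', -⟩, rfl⟩ he
    have hzz : z4 q = z4 q' := by rw [← hz q hq, ← hz q' hq', he]
    rcases lt_or_ge (z4 q) (1 - ε) with hlt | hge
    · have := he
      rw [hlow q hq hlt, hlow q' hq' (hzz ▸ hlt)] at this
      rw [this]
    · rw [(hF.box hη hη1 (c := z4 q) ⟨hge, hq.2.2.1.2⟩).eq_of_eq hq hq' rfl hzz.symm hFq he]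
  · rintro _ ⟨q, ⟨hq, hFq⟩, rfl⟩
    exact hF.fderiv_tame_injective hη hη1 hq hFq
  · intro p hp
    refine ⟨h p, ⟨hF.mapsTo hp, ?_⟩, hF.inv.1 hp⟩
    rw [mem_preimage, hF.inv.1 hp]
    exact hF.mapsTo_tame hp
  · intro q hq
    rcases lt_or_ge (z4 q) (1 - ε) with hlt | hge
    · exact ⟨G q, ⟨q, ⟨hq, by rw [mem_preimage, hlow q hq hlt]; exact hq⟩, rfl⟩, hlow q hq hlt⟩
    · obtain ⟨q', hq', -, he⟩ := (hF.box hη hη1 (c := z4 q) ⟨hge, hq.2.2.1.2⟩).exists_eq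
        (hct.comp hcG) hq.2.2.1 hq rfl
      exact ⟨G q', ⟨q', ⟨hq', by rw [mem_preimage, he]; exact hq⟩, rfl⟩, he⟩

end

theorem contDiff_clampTo {E : Type*} [NormedAddCommGroup E] [NormedSpace ℝ E] (η : ℝ)
    {r g₀ g₁ v u : E → ℝ} (hr : ContDiff ℝ (⊤ : ℕ∞) r) (hg₀ : ContDiff ℝ (⊤ : ℕ∞) g₀)
    (hg₁ : ContDiff ℝ (⊤ : ℕ∞) g₁) (hv : ContDiff ℝ (⊤ : ℕ∞) v) (hu : ContDiff ℝ (⊤ : ℕ∞) u) :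
    ContDiff ℝ (⊤ : ℕ∞) fun e => clampTo η (r e) (g₀ e) (g₁ e) (v e) (u e) := by
  have := contDiff_step
  unfold clampTo
  fun_prop

theorem contDiff_x4 : ContDiff ℝ (⊤ : ℕ∞) x4 := by unfold x4; fun_prop
theorem contDiff_y4 : ContDiff ℝ (⊤ : ℕ∞) y4 := by unfold y4; fun_prop
theorem contDiff_z4 : ContDiff ℝ (⊤ : ℕ∞) z4 := by unfold z4; fun_prop
theorem contDiff_t4 : ContDiff ℝ (⊤ : ℕ∞) t4 := by unfold t4; fun_prop

/-- An equivalence isotopy starting at the identity that is triangular and preserves the side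
faces on the slab `a ≤ z ≤ b`. -/
structure Tame (A : Pt4 → ℝ → Pt4) (a b : ℝ) : Prop where
  good : Good A
  zero : ∀ p, A p 0 = p
  tri : ∀ s ∈ II, Tri (fun p => A p s) a b
  faces : ∀ s ∈ II, ∀ p, z4 p ∈ Icc a b →
    (x4 p = 0 → x4 (A p s) = 0) ∧ (x4 p = 1 → x4 (A p s) = 1) ∧
    (y4 p = 0 → y4 (A p s) = 0) ∧ (y4 p = 1 → y4 (A p s) = 1)

section
variable {H : Pt4 → ℝ → Pt4} {η ε : ℝ}

theorem Good.exists_frame (hH : Good H) (h0 : ∀ p, H p 0 = p) (hε : 0 < ε) (hε4 : ε ≤ 1/4)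
    (hT : ∀ s ∈ II, Tri (fun p => H p s) (1 - ε) 1) {s : ℝ} (hs : s ∈ II) :
    ∃ G, Frame (fun p => H p s) G ε := by
  obtain ⟨G, hG, hinv⟩ := hH.diffeo s hs
  exact ⟨G, hH.contDiff s, hG, hH.mapsTo s hs, hinv, hε, hε4, hT s hs,
    fun q hq => (hH.t4_inverse hs hG.continuous hinv hq).1,
    fun p hp hz => hH.diag_pos h0 (by linarith) hT hs hp hz⟩

theorem Good.tri_of_product (hH : Good H) (hε4 : ε ≤ 1/4)
    (hP : ∀ s ∈ II, ∀ x y t : ℝ, ∀ z ∈ II, 1 - ε ≤ z → H (x, y, z, t) s =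
      (x4 (H (x, y, 1, t) s), y4 (H (x, y, 1, t) s), z, t4 (H (x, y, 1, t) s))) {s : ℝ} (hs : s ∈ II) :
    Tri (fun p => H p s) (1 - ε) 1 where
  z_eq p hz := by
    have := hP s hs (x4 p) (y4 p) (t4 p) (z4 p) ⟨by linarith [hz.1], hz.2⟩ hz.1
    exact (congrArg z4 this :)
  t_eq z hz x x' y y' t := by
    rw [hP s hs x y t z ⟨by linarith [hz.1], hz.2⟩ hz.1, hP s hs x' y' t z ⟨by linarith [hz.1], hz.2⟩ hz.1]
    exact hH.levelSidesT 1 (Or.inr rfl) s hs t x x' y y'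
  y_eq z hz x x' y t := by
    rw [hP s hs x y t z ⟨by linarith [hz.1], hz.2⟩ hz.1, hP s hs x' y t z ⟨by linarith [hz.1], hz.2⟩ hz.1]
    exact hH.levelSides 1 (Or.inr rfl) s hs y t x x'

theorem Good.tame (hH : Good H) (h0 : ∀ p, H p 0 = p) (hη : 0 < η) (hη1 : η ≤ 1/2) (hε : 0 < ε)
    (hε4 : ε ≤ 1/4)
    (hP : ∀ s ∈ II, ∀ x y t : ℝ, ∀ z ∈ II,
      (z ≤ ε → H (x, y, z, t) s =
        (x4 (H (x, y, 0, t) s), y4 (H (x, y, 0, t) s), z, t4 (H (x, y, 0, t) s))) ∧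
      (1 - ε ≤ z → H (x, y, z, t) s =
        (x4 (H (x, y, 1, t) s), y4 (H (x, y, 1, t) s), z, t4 (H (x, y, 1, t) s)))) :
    Good fun p s => tame η ε (fun p => H p s) p := by
  have hT := fun s hs => hH.tri_of_product hε4 (fun s hs x y t z hz => (hP s hs x y t z hz).2) (s := s) hs
  constructor
  · have hc : ∀ f : Pt4 × ℝ → Pt4, ContDiff ℝ (⊤ : ℕ∞) f →
        ContDiff ℝ (⊤ : ℕ∞) fun q : Pt4 × ℝ => H (f q) q.2 := fun f hf =>
      hH.smooth.comp (hf.prodMk contDiff_snd)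
    have hx := contDiff_x4
    have hy := contDiff_y4
    have hz := contDiff_z4
    have ht := contDiff_t4
    have hs := contDiff_step
    refine (contDiff_clampTo η ?_ (hx.comp (hc _ ?_)) (hx.comp (hc _ ?_)) (hx.comp contDiff_fst)
      (hx.comp (hc _ contDiff_fst))).prodMk
      ((contDiff_clampTo η ?_ (hy.comp (hc _ ?_)) (hy.comp (hc _ ?_)) (hy.comp contDiff_fst)
      (hy.comp (hc _ contDiff_fst))).prodMk ((hz.comp (hc _ contDiff_fst)).prodMk
        (ht.comp (hc _ contDiff_fst))))
    · exact (hs _ _).comp (hz.comp contDiff_fst)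
    · fun_prop
    · fun_prop
    · exact (hs _ _).comp (hz.comp contDiff_fst)
    · fun_prop
    · fun_prop
  · intro s hs
    obtain ⟨G, hF⟩ := hH.exists_frame h0 hε hε4 hT hs
    exact hF.mapsTo_tame
  · intro s hs
    obtain ⟨G, hF⟩ := hH.exists_frame h0 hε hε4 hT hs
    exact hF.exists_inv_tame hη hη1
  · obtain ⟨δ, hδ, hQ⟩ := hH.productT
    refine ⟨δ, hδ, fun s hs x y z t ht => ⟨fun h1 => ?_, fun h1 => ?_⟩⟩
    · have e := fun x y => (hQ s hs x y z t ht).1 h1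
      simp only [HDA4.tame, x4, y4, z4, t4] at e ⊢
      simp only [e]
    · have e := fun x y => (hQ s hs x y z t ht).2 h1
      simp only [HDA4.tame, x4, y4, z4, t4] at e ⊢
      simp only [e]
  · refine ⟨ε/4, by positivity, fun s hs x y t z hz => ⟨fun h1 => ?_, fun h1 => ?_⟩⟩
    · rw [tame_eq_of_le hε (by simp only [z4]; linarith), tame_eq_of_le hε (by simp only [z4]; linarith)]
      exact (hP s hs x y t z hz).1 (by linarith)
    · have e := fun x y => (hP s hs x y t z hz).2 (by linarith)
      simp only [HDA4.tame, x4, y4, z4, t4] at e ⊢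
      rw [step_of_ge (by linarith) h1, step_of_ge (by linarith) (show 1 - ε/4 ≤ 1 by linarith),
        step_of_ge (by linarith) (show 1 - ε/2 ≤ z by linarith),
        step_of_ge (by linarith) (show 1 - ε/2 ≤ 1 by linarith)]
      simp only [e]
  · intro t₀ ht s hs y z x x'
    have e := hH.levelEnds t₀ ht s hs y z x x'
    simp only [HDA4.tame, x4, y4, z4, t4] at e ⊢
    rw [e]
  · intro t₀ ht s hs z x x' y y'
    exact hH.levelEndsZ t₀ ht s hs z x x' y y'
  · intro z₀ hz s hs y t x x'
    have e := hH.levelSides z₀ hz s hs y t x x'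
    simp only [HDA4.tame, x4, y4, z4, t4] at e ⊢
    rw [e]
  · intro z₀ hz s hs t x x' y y'
    exact hH.levelSidesT z₀ hz s hs t x x' y y'

end

section
variable {H : Pt4 → ℝ → Pt4} {α α' : Set Pt4}

theorem mapZ_mem_of_product (hsub : α ⊆ cube4) (hp : ProductZOn4 α (1/4) 1) {f : ℝ → ℝ}
    (h1 : ∀ z ≤ 1/4, f z = z) (h2 : MapsTo f (Icc (1/4) 1) (Icc (1/4) 1)) {p : Pt4} (hpα : p ∈ α) :
    mapZ f p ∈ α := by
  rcases le_total (z4 p) (1/4) with h | h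
  · rwa [show mapZ f p = p from pt4_ext rfl rfl (h1 _ h) rfl]
  · have hz : z4 p ∈ Icc (1/4) 1 := ⟨h, (hsub hpα).2.2.1.2⟩
    exact (hp (x4 p) (y4 p) (t4 p) (z4 p) hz _ (h2 hz)).1 hpα

/-- An equivalence between 2-tangles that are products near the top can be made triangular and
face preserving on the upper two thirds of the cube. -/
theorem exists_tame_top (hH : Good H) (h0 : ∀ p, H p 0 = p) (him : (fun p => H p 1) '' α = α')
    (hα : α ⊆ cube4) (hα' : α' ⊆ cube4) (hp : ProductZOn4 α (1/4) 1) (hp' : ProductZOn4 α' (1/4) 1)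
    {η : ℝ} (hη : 0 < η) (hη1 : η ≤ 1/2)
    (hm : ∀ x y t : ℝ, (x, y, 1, t) ∈ α → x ∈ Icc η (1 - η) ∧ y ∈ Icc η (1 - η)) :
    ∃ A, Tame A (1/3) 1 ∧ (fun p => A p 1) '' α = α' := by
  obtain ⟨ε, hε, hε4, hP⟩ := hH.exists_z_zone
  have hT := fun s hs => hH.tri_of_product hε4 (fun s hs x y t z hz => (hP s hs x y t z hz).2) (s := s) hs
  obtain ⟨σ, τ, hR, hmono, hσ, hσ'⟩ := exists_isReparam (ε := ε/4) (by positivity) (by linarith)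
  set T : Pt4 → ℝ → Pt4 := fun p s => tame η ε (fun p => H p s) p with hTdef
  have hid : (fun p => H p 0) = fun p => p := funext h0
  have hT0 : ∀ p, T p 0 = p := fun p => by
    simp only [hTdef, hid]
    exact tame_id p
  have hT1 : ∀ p ∈ α, T p 1 = H p 1 := by
    intro p hpα
    rcases le_total (z4 p) (1 - 3*ε/4) with hz | hz
    · exact tame_eq_of_le hε hz
    · have hz1 := (hα hpα).2.2.1.2
      have := hm (x4 p) (y4 p) (t4 p)
        ((hp (x4 p) (y4 p) (t4 p) (z4 p) ⟨by linarith, hz1⟩ 1 ⟨by norm_num, le_rfl⟩).1 hpα)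
      exact tame_eq_of_mid hη this.1 this.2
  have hσ4 : MapsTo σ (Icc (1/4) 1) (Icc (1/4) 1) := fun z hz =>
    ⟨by rw [← hσ (1/4) le_rfl]; exact hmono.monotone hz.1, (hR.mapsTo ⟨by linarith [hz.1], hz.2⟩).2⟩
  have hτ : ∀ z ≤ 1/4, τ z = z := fun z hz => by
    have := hR.left z
    rwa [hσ z hz] at this
  have hτ4 : MapsTo τ (Icc (1/4) 1) (Icc (1/4) 1) := fun z hz => by
    refine ⟨?_, (hR.mapsTo_inv ⟨by linarith [hz.1], hz.2⟩).2⟩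
    by_contra! hcon
    have := hσ _ hcon.le
    rw [hR.right] at this
    linarith [hz.1]
  have hzone : ∀ z ∈ Icc (1/3 : ℝ) 1, σ z ∈ Icc (1 - ε/4) 1 := fun z hz =>
    ⟨hσ' z hz.1, (hR.mapsTo ⟨by linarith [hz.1], hz.2⟩).2⟩
  have hzone' : ∀ z ∈ Icc (1/3 : ℝ) 1, σ z ∈ Icc (1 - ε) 1 := fun z hz =>
    ⟨by linarith [(hzone z hz).1], (hzone z hz).2⟩
  refine ⟨conjZ σ τ T, ⟨(hH.tame h0 hη hη1 hε hε4 hP).conjZ hR, fun p => ?_, fun s hs => ?_,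
    fun s hs p hz => ?_⟩, ?_⟩
  · simp only [conjZ]
    rw [hT0, mapZ_mapZ hR.left]
  · have hTt := (hT s hs).tame (η := η)
    exact ⟨fun p hz => by
        change τ (z4 (T (mapZ σ p) s)) = z4 p
        have : z4 (T (mapZ σ p) s) = σ (z4 p) := hTt.z_eq (mapZ σ p) (hzone' _ hz)
        rw [this, hR.left],
      fun z hz x x' y y' t => hTt.t_eq (σ z) (hzone' z hz) x x' y y' t,
      fun z hz x x' y t => hTt.y_eq (σ z) (hzone' z hz) x x' y t⟩
  · exact tame_faces hη hη1 hε (hT s hs) (p := mapZ σ p) (hzone _ hz)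
  · ext q
    constructor
    · rintro ⟨p, hpα, rfl⟩
      have h1 := mapZ_mem_of_product hα hp hσ hσ4 hpα
      simp only [conjZ]
      refine mapZ_mem_of_product hα' hp' hτ hτ4 ?_
      rw [hT1 _ h1, ← him]
      exact ⟨_, h1, rfl⟩
    · intro hq
      have h1 := mapZ_mem_of_product hα' hp' hσ hσ4 hq
      rw [← him] at h1
      obtain ⟨p, hpα, he⟩ := h1
      refine ⟨mapZ τ p, mapZ_mem_of_product hα hp hτ hτ4 hpα, ?_⟩
      simp only [conjZ] at he ⊢
      rw [mapZ_mapZ hR.right, hT1 p hpα, he, mapZ_mapZ hR.left]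

/-- Reflection of the cube in the `z` direction. -/
def flip (p : Pt4) : Pt4 := mapZ (fun z => 1 - z) p

theorem flip_flip (p : Pt4) : flip (flip p) = p := mapZ_mapZ (fun z => by ring) p

theorem Tame.flip {A : Pt4 → ℝ → Pt4} {a b : ℝ} (h : Tame A a b) :
    Tame (fun p s => HDA4.flip (A (HDA4.flip p) s)) (1 - b) (1 - a) where
  good := h.good.conjZ isReparam_refl
  zero p := by rw [h.zero, flip_flip]
  tri s hs := ⟨fun p hz => by
      have := (h.tri s hs).z_eq (HDA4.flip p) ⟨by change a ≤ 1 - z4 p; linarith [hz.2],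
        by change 1 - z4 p ≤ b; linarith [hz.1]⟩
      change 1 - z4 (A (HDA4.flip p) s) = z4 p
      rw [this]
      change 1 - (1 - z4 p) = z4 p
      ring,
    fun z hz x x' y y' t => (h.tri s hs).t_eq (1 - z) ⟨by linarith [hz.2], by linarith [hz.1]⟩ x x' y y' t,
    fun z hz x x' y t => (h.tri s hs).y_eq (1 - z) ⟨by linarith [hz.2], by linarith [hz.1]⟩ x x' y t⟩
  faces s hs p hz := h.faces s hs (HDA4.flip p) ⟨by change a ≤ 1 - z4 p; linarith [hz.2],
        by change 1 - z4 p ≤ b; linarith [hz.1]⟩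

theorem exists_tame_bot (hH : Good H) (h0 : ∀ p, H p 0 = p) (him : (fun p => H p 1) '' α = α')
    (hα : α ⊆ cube4) (hα' : α' ⊆ cube4) (hp : ProductZOn4 α 0 (3/4)) (hp' : ProductZOn4 α' 0 (3/4))
    {η : ℝ} (hη : 0 < η) (hη1 : η ≤ 1/2)
    (hm : ∀ x y t : ℝ, (x, y, 0, t) ∈ α → x ∈ Icc η (1 - η) ∧ y ∈ Icc η (1 - η)) :
    ∃ A, Tame A 0 (2/3) ∧ (fun p => A p 1) '' α = α' := by
  have hsub : ∀ {γ : Set Pt4}, γ ⊆ cube4 → flip ⁻¹' γ ⊆ cube4 := fun hγ p hpγ => by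
    rw [← flip_flip p]
    exact mapZ_mem_cube4 isReparam_refl.mapsTo (hγ hpγ)
  have hprod : ∀ {γ : Set Pt4}, ProductZOn4 γ 0 (3/4) → ProductZOn4 (flip ⁻¹' γ) (1/4) 1 :=
    fun hγ x y t z hz z' hz' => hγ x y t (1 - z) ⟨by linarith [hz.2], by linarith [hz.1]⟩ (1 - z')
      ⟨by linarith [hz'.2], by linarith [hz'.1]⟩
  obtain ⟨A, hA, hAi⟩ := exists_tame_top (H := fun p s => flip (H (flip p) s)) (α := flip ⁻¹' α)
    (α' := flip ⁻¹' α') (hH.conjZ isReparam_refl) (fun p => by rw [h0, flip_flip]) (by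
      rw [← him]
      ext q
      constructor
      · rintro ⟨p, hpα, rfl⟩
        exact ⟨flip p, hpα, by simp only [flip_flip]⟩
      · rintro ⟨p, hpα, he⟩
        refine ⟨flip p, ?_, ?_⟩
        · rwa [mem_preimage, flip_flip]
        · simp only at he ⊢
          rw [flip_flip, he, flip_flip]) (hsub hα) (hsub hα') (hprod hp) (hprod hp') hη hη1
    (fun x y t h => hm x y t (by
      have : flip (x, y, 1, t) = (x, y, 0, t) := pt4_ext rfl rfl (sub_self (1:ℝ)) rfl
      rw [mem_preimage, this] at h
      exact h))
  refine ⟨_, by have := hA.flip; norm_num at this; exact this, ?_⟩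
  ext q
  constructor
  · rintro ⟨p, hpα, rfl⟩
    have : A (flip p) 1 ∈ flip ⁻¹' α' := by
      rw [← hAi]
      exact ⟨flip p, by rwa [mem_preimage, flip_flip], rfl⟩
    exact this
  · intro hq
    have : flip q ∈ flip ⁻¹' α' := by rwa [mem_preimage, flip_flip]
    rw [← hAi] at this
    obtain ⟨p, hpα, he⟩ := this
    refine ⟨flip p, hpα, ?_⟩
    simp only at he ⊢
    rw [flip_flip, he, flip_flip]

theorem IsTwoTangle.exists_margin (hα : IsTwoTangle α) : ∃ η > 0, η ≤ 1/2 ∧ ∀ x y z t : ℝ,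
    z = 0 ∨ z = 1 → (x, y, z, t) ∈ α → x ∈ Icc η (1 - η) ∧ y ∈ Icc η (1 - η) := by
  obtain ⟨L, hL, hS⟩ := hα.sides
  have hpos : ∀ q ∈ L, 0 < min (min q.1 (1 - q.1)) (min q.2.1 (1 - q.2.1)) := by
    intro q hq
    have h1 : ((q.1, q.2.1, q.2.2, 0) : Pt4) ∈ {p : Pt4 | (x4 p, y4 p, z4 p) ∈ (L : Set Pt3) ∧ t4 p ∈ II} :=
      ⟨hq, zero_mem_II⟩
    rw [← hS] at h1
    have h2 := hα.endTangles.1.subset (show q ∈ tSlice α 0 from h1.1)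
    simp only [lt_min_iff]
    exact ⟨⟨h2.1.1, sub_pos.2 h2.1.2⟩, h2.2.1.1, sub_pos.2 h2.2.1.2⟩
  obtain ⟨η, hη, hη1, hle⟩ : ∃ η > 0, η ≤ 1/2 ∧ ∀ q ∈ L,
      η ≤ min (min q.1 (1 - q.1)) (min q.2.1 (1 - q.2.1)) := by
    set S := insert (1/2 : ℝ) (L.image fun q => min (min q.1 (1 - q.1)) (min q.2.1 (1 - q.2.1)))
    have hne : S.Nonempty := Finset.insert_nonempty _ _
    refine ⟨S.min' hne, ?_, S.min'_le _ (Finset.mem_insert_self _ _), fun q hq =>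
      S.min'_le _ (Finset.mem_insert_of_mem (Finset.mem_image_of_mem _ hq))⟩
    rw [gt_iff_lt, Finset.lt_min'_iff]
    intro v hv
    rcases Finset.mem_insert.1 hv with rfl | hv
    · norm_num
    · obtain ⟨q, hq, rfl⟩ := Finset.mem_image.1 hv
      exact hpos q hq
  refine ⟨η, hη, hη1, fun x y z t hz hmem => ?_⟩
  have h1 : ((x, y, z, t) : Pt4) ∈ {p ∈ α | z4 p = 0 ∨ z4 p = 1} := ⟨hmem, hz⟩
  rw [hS] at h1
  have h2 := hle _ h1.1
  simp only [le_min_iff, x4, y4] at h2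
  exact ⟨⟨h2.1.1, by linarith [h2.1.2]⟩, h2.2.1, by linarith [h2.2.2]⟩

end

theorem box_of_tri {h : Pt4 → Pt4} {a b c : ℝ} (hd : Differentiable ℝ h) (hT : Tri h a b)
    (hc : c ∈ Icc a b) (hcI : c ∈ II)
    (hpos : ∀ p ∈ cube4, z4 p = c → 0 < dX h p ∧ 0 < dY h p ∧ 0 < dT h p)
    (hfaces : ∀ p, z4 p = c → (x4 p = 0 → x4 (h p) = 0) ∧ (x4 p = 1 → x4 (h p) = 1) ∧
      (y4 p = 0 → y4 (h p) = 0) ∧ (y4 p = 1 → y4 (h p) = 1))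
    (ht0 : ∀ p, t4 p = 0 → t4 (h p) = 0) (ht1 : ∀ p, t4 p = 1 → t4 (h p) = 1) : Box h c where
  z_eq x _ y _ t _ := hT.z_eq (x, y, c, t) hc
  t_eq x _ y _ t _ := hT.t_eq c hc x 0 y 0 t
  y_eq x _ y _ t _ := hT.y_eq c hc x 0 y t
  t_mono := strictMonoOn_of_hasDerivAt_pos (fun t => hasDerivAt_dT hd 0 0 c t)
    fun t ht => (hpos (0, 0, c, t) ⟨zero_mem_II, zero_mem_II, hcI, ht⟩ rfl).2.2
  t_zero := (ht0 (0, 0, c, 0) rfl).le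
  t_one := (ht1 (0, 0, c, 1) rfl).ge
  y_mono t ht := strictMonoOn_of_hasDerivAt_pos (fun y => hasDerivAt_dY hd 0 y c t)
    fun y hy => (hpos (0, y, c, t) ⟨zero_mem_II, hy, hcI, ht⟩ rfl).2.1
  y_zero t _ := ((hfaces (0, 0, c, t) rfl).2.2.1 rfl).le
  y_one t _ := ((hfaces (0, 1, c, t) rfl).2.2.2 rfl).ge
  x_mono t ht y hy _ := ⟨strictMonoOn_of_hasDerivAt_pos (fun x => hasDerivAt_dX hd x y c t)
    fun x hx => (hpos (x, y, c, t) ⟨hx, hy, hcI, ht⟩ rfl).1,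
    ((hfaces (0, y, c, t) rfl).1 rfl).le, ((hfaces (1, y, c, t) rfl).2.1 rfl).ge⟩

section
variable {A B : Pt4 → ℝ → Pt4} {G : Pt4 → Pt4} {a b c s : ℝ}

theorem Tame.diag_pos (h : Tame A a b) (hab : a < b) (hs : s ∈ II) {p : Pt4} (hp : p ∈ cube4)
    (hz : z4 p ∈ Icc a b) :
    0 < dX (fun p => A p s) p ∧ 0 < dY (fun p => A p s) p ∧ 0 < dT (fun p => A p s) p :=
  h.good.diag_pos h.zero hab h.tri hs hp hz

theorem Tame.box (h : Tame A a b) (hab : a < b) (hs : s ∈ II) (hc : c ∈ Icc a b) (hcI : c ∈ II) :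
    Box (fun p => A p s) c :=
  box_of_tri (h.good.differentiable s) (h.tri s hs) hc hcI
    (fun _ hp hz => h.diag_pos hab hs hp (hz ▸ hc)) (fun p hz => h.faces s hs p (hz ▸ hc))
    (fun _ hp => h.good.t4_bot hs hp) (fun _ hp => h.good.t4_top hs hp)

theorem Tame.inv_mem (h : Tame A a b) (hab : a < b) (hs : s ∈ II)
    (hinv : InvOn G (fun p => A p s) cube4 cube4) {q : Pt4} (hq : q ∈ cube4) (hz : z4 q ∈ Icc a b) :
    G q ∈ cube4 ∧ z4 (G q) = z4 q := by
  obtain ⟨p, hp, hzp, he⟩ := (h.box hab hs hz hq.2.2.1).exists_eq (h.good.contDiff s).continuous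
    hq.2.2.1 hq rfl
  rw [← he, hinv.1 hp]
  exact ⟨hp, by simp only [he, hzp]⟩

theorem Tame.lt_of_lt (h : Tame A a 1) (ha0 : 0 ≤ a) (ha : a < 1) (hs : s ∈ II)
    {p : Pt4} (hp : p ∈ cube4) (hz : z4 p < a) : z4 (A p s) < a := by
  obtain ⟨G, hG, hinv⟩ := h.good.diffeo s hs
  have h0 : ((0, 0, (a + 1)/2, 0) : Pt4) ∈ cube4 :=
    ⟨zero_mem_II, zero_mem_II, ⟨by linarith, by linarith⟩, zero_mem_II⟩
  have h1 : zL (0, 0, (a + 1)/2, 0) ∈ Ioo a 1 := by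
    rw [zL_apply]; simp only [z4]; constructor <;> linarith
  exact level_lt_of_lt (l := zL) convex_cube4 hG.continuous (h.good.mapsTo s hs) hinv
    (h.tri s hs).z_eq h0 h1 (fun _ hq => hq.2.2.1.2) hp hz

theorem Tame.inv_lt_of_lt (h : Tame A a 1) (ha0 : 0 ≤ a) (ha : a < 1) (hs : s ∈ II)
    (hG : Continuous G) (hinv : InvOn G (fun p => A p s) cube4 cube4)
    {q : Pt4} (hq : q ∈ cube4) (hz : z4 q < a) : z4 (G q) < a := by
  have h0 : ((0, 0, (a + 1)/2, 0) : Pt4) ∈ cube4 :=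
    ⟨zero_mem_II, zero_mem_II, ⟨by linarith, by linarith⟩, zero_mem_II⟩
  have h1 : zL (0, 0, (a + 1)/2, 0) ∈ Ioo a 1 := by
    rw [zL_apply]; simp only [z4]; constructor <;> linarith
  exact level_inverse_lt_of_lt (l := zL) convex_cube4 hG (h.good.mapsTo s hs) hinv
    (h.tri s hs).z_eq h0 h1 (fun _ hq => hq.2.2.1.2) hq hz

theorem flip_mem_cube4 {p : Pt4} (hp : p ∈ cube4) : flip p ∈ cube4 :=
  mapZ_mem_cube4 isReparam_refl.mapsTo hp

theorem Tame.gt_of_gt (h : Tame A 0 b) (hb0 : 0 < b) (hb : b ≤ 1) (hs : s ∈ II)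
    {p : Pt4} (hp : p ∈ cube4) (hz : b < z4 p) : b < z4 (A p s) := by
  have hf := h.flip
  rw [sub_zero] at hf
  have := hf.lt_of_lt (by linarith) (by linarith) hs (flip_mem_cube4 hp)
    (by change 1 - z4 p < 1 - b; linarith)
  simp only [flip_flip] at this
  change 1 - z4 (A p s) < 1 - b at this
  linarith

theorem Tame.inv_gt_of_gt (h : Tame A 0 b) (hb0 : 0 < b) (hb : b ≤ 1) (hs : s ∈ II)
    (hG : Continuous G) (hinv : InvOn G (fun p => A p s) cube4 cube4)
    {q : Pt4} (hq : q ∈ cube4) (hz : b < z4 q) : b < z4 (G q) := by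
  have hf := h.flip
  rw [sub_zero] at hf
  have hc : Continuous HDA4.flip := (contDiff_mapZ isReparam_refl.smooth).continuous
  have := hf.inv_lt_of_lt (G := fun q => HDA4.flip (G (HDA4.flip q))) (by linarith) (by linarith) hs
    (hc.comp (hG.comp hc)) ⟨fun p hp => ?_, fun q hq => ?_⟩ (flip_mem_cube4 hq)
    (by change 1 - z4 q < 1 - b; linarith)
  · simp only [flip_flip] at this
    change 1 - z4 (G q) < 1 - b at this
    linarith
  · have := hinv.1 (flip_mem_cube4 hp)
    simp only [flip_flip] at this ⊢
    rw [this, flip_flip]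
  · have := hinv.2 (flip_mem_cube4 hq)
    simp only [flip_flip] at this ⊢
    rw [this, flip_flip]

/-- The isotopy that agrees with `A` in the lower part of the cube and with `B` in the upper part,
and interpolates linearly in between. -/
def blend (A B : Pt4 → ℝ → Pt4) (p : Pt4) (s : ℝ) : Pt4 :=
  (1 - step (2/5) (3/5) (z4 p)) • A p s + step (2/5) (3/5) (z4 p) • B p s

theorem blend_of_le {p : Pt4} (hp : z4 p ≤ 2/5) : blend A B p s = A p s := by
  simp [blend, step_of_le (show (2/5 : ℝ) < 3/5 by norm_num) hp]

theorem blend_of_ge {p : Pt4} (hp : 3/5 ≤ z4 p) : blend A B p s = B p s := by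
  simp [blend, step_of_ge (show (2/5 : ℝ) < 3/5 by norm_num) hp]

theorem blend_x (A B : Pt4 → ℝ → Pt4) (p : Pt4) (s : ℝ) : x4 (blend A B p s) =
    (1 - step (2/5) (3/5) (z4 p)) * x4 (A p s) + step (2/5) (3/5) (z4 p) * x4 (B p s) := rfl
theorem blend_y (A B : Pt4 → ℝ → Pt4) (p : Pt4) (s : ℝ) : y4 (blend A B p s) =
    (1 - step (2/5) (3/5) (z4 p)) * y4 (A p s) + step (2/5) (3/5) (z4 p) * y4 (B p s) := rfl
theorem blend_z (A B : Pt4 → ℝ → Pt4) (p : Pt4) (s : ℝ) : z4 (blend A B p s) =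
    (1 - step (2/5) (3/5) (z4 p)) * z4 (A p s) + step (2/5) (3/5) (z4 p) * z4 (B p s) := rfl
theorem blend_t (A B : Pt4 → ℝ → Pt4) (p : Pt4) (s : ℝ) : t4 (blend A B p s) =
    (1 - step (2/5) (3/5) (z4 p)) * t4 (A p s) + step (2/5) (3/5) (z4 p) * t4 (B p s) := rfl

theorem contDiff_blend (hA : Good A) (hB : Good B) :
    ContDiff ℝ (⊤ : ℕ∞) fun q : Pt4 × ℝ => blend A B q.1 q.2 := by
  have h1 := hA.smooth
  have h2 := hB.smooth
  have h3 : ContDiff ℝ (⊤ : ℕ∞) fun q : Pt4 × ℝ => step (2/5) (3/5) (z4 q.1) :=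
    (contDiff_step _ _).comp (contDiff_z4.comp contDiff_fst)
  unfold blend
  exact ((contDiff_const.sub h3).smul h1).add (h3.smul h2)

theorem contDiff_blend_apply (hA : Good A) (hB : Good B) (s : ℝ) :
    ContDiff ℝ (⊤ : ℕ∞) fun p => blend A B p s := by
  have h3 : ContDiff ℝ (⊤ : ℕ∞) fun p : Pt4 => step (2/5) (3/5) (z4 p) :=
    (contDiff_step _ _).comp contDiff_z4
  unfold blend
  exact ((contDiff_const.sub h3).smul (hA.contDiff s)).add (h3.smul (hB.contDiff s))

theorem blend_pos {u v : ℝ} (hu : 0 < u) (hv : 0 < v) (z : ℝ) :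
    0 < (1 - step (2/5) (3/5) z) * u + step (2/5) (3/5) z * v := by
  have h1 := step_nonneg (2/5) (3/5) z
  have h2 := step_le_one (2/5) (3/5) z
  rcases eq_or_lt_of_le h1 with h | h
  · rw [← h]; linarith
  · have := mul_pos h hv
    have := mul_nonneg (sub_nonneg.2 h2) hu.le
    linarith

theorem differentiable_blend (hA : Tame A (1/3) 1) (hB : Tame B 0 (2/3))
    (s : ℝ) : Differentiable ℝ fun p => blend A B p s :=
  (contDiff_blend_apply hA.good hB.good s).differentiable (by simp)

theorem mapsTo_blend (hA : Tame A (1/3) 1) (hB : Tame B 0 (2/3))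
    (hs : s ∈ II) : MapsTo (fun p => blend A B p s) cube4 cube4 := fun p hp =>
  convex_cube4 (hA.good.mapsTo s hs hp) (hB.good.mapsTo s hs hp)
    (sub_nonneg.2 (step_le_one _ _ _)) (step_nonneg _ _ _) (by ring)

theorem tri_blend (hA : Tame A (1/3) 1) (hB : Tame B 0 (2/3))
    (hs : s ∈ II) : Tri (fun p => blend A B p s) (1/3) (2/3) where
  z_eq p hz := by
    have e1 := (hA.tri s hs).z_eq p ⟨hz.1, by linarith [hz.2]⟩
    have e2 := (hB.tri s hs).z_eq p ⟨by linarith [hz.1], hz.2⟩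
    rw [blend_z, e1, e2]; ring
  t_eq z hz x x' y y' t := by
    have e1 := (hA.tri s hs).t_eq z ⟨hz.1, by linarith [hz.2]⟩ x x' y y' t
    have e2 := (hB.tri s hs).t_eq z ⟨by linarith [hz.1], hz.2⟩ x x' y y' t
    rw [blend_t, blend_t, e1, e2]; rfl
  y_eq z hz x x' y t := by
    have e1 := (hA.tri s hs).y_eq z ⟨hz.1, by linarith [hz.2]⟩ x x' y t
    have e2 := (hB.tri s hs).y_eq z ⟨by linarith [hz.1], hz.2⟩ x x' y t
    rw [blend_y, blend_y, e1, e2]; rfl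

theorem diag_pos_blend (hA : Tame A (1/3) 1) (hB : Tame B 0 (2/3))
    (hs : s ∈ II) {p : Pt4} (hp : p ∈ cube4) (hz : z4 p ∈ Icc (1/3) (2/3)) :
    0 < dX (fun p => blend A B p s) p ∧ 0 < dY (fun p => blend A B p s) p ∧
      0 < dT (fun p => blend A B p s) p := by
  obtain ⟨a1, a2, a3⟩ := hA.diag_pos (by norm_num) hs hp ⟨hz.1, hp.2.2.1.2⟩
  obtain ⟨b1, b2, b3⟩ := hB.diag_pos (by norm_num) hs hp ⟨hp.2.2.1.1, hz.2⟩
  obtain ⟨x, y, z, t⟩ := p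
  have dA := hA.good.differentiable s
  have dB := hB.good.differentiable s
  have dC := differentiable_blend hA hB s
  refine ⟨?_, ?_, ?_⟩
  · rw [(hasDerivAt_dX dC x y z t).unique (((hasDerivAt_dX dA x y z t).const_mul
      (1 - step (2/5) (3/5) z)).add ((hasDerivAt_dX dB x y z t).const_mul (step (2/5) (3/5) z)))]
    exact blend_pos a1 b1 z
  · rw [(hasDerivAt_dY dC x y z t).unique (((hasDerivAt_dY dA x y z t).const_mul
      (1 - step (2/5) (3/5) z)).add ((hasDerivAt_dY dB x y z t).const_mul (step (2/5) (3/5) z)))]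
    exact blend_pos a2 b2 z
  · rw [(hasDerivAt_dT dC x y z t).unique (((hasDerivAt_dT dA x y z t).const_mul
      (1 - step (2/5) (3/5) z)).add ((hasDerivAt_dT dB x y z t).const_mul (step (2/5) (3/5) z)))]
    exact blend_pos a3 b3 z

theorem box_blend (hA : Tame A (1/3) 1) (hB : Tame B 0 (2/3))
    (hs : s ∈ II) (hc : c ∈ Icc (1/3) (2/3)) : Box (fun p => blend A B p s) c := by
  refine box_of_tri (differentiable_blend hA hB s) (tri_blend hA hB hs) hc
    ⟨by linarith [hc.1], by linarith [hc.2]⟩ (fun _ hp hz => diag_pos_blend hA hB hs hp (hz ▸ hc))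
    (fun p hz => ?_) (fun p hp => ?_) (fun p hp => ?_)
  · obtain ⟨a1, a2, a3, a4⟩ := hA.faces s hs p ⟨by linarith [hc.1], by linarith [hc.2]⟩
    obtain ⟨b1, b2, b3, b4⟩ := hB.faces s hs p ⟨by linarith [hc.1], by linarith [hc.2]⟩
    rw [blend_x, blend_y]
    exact ⟨fun h => by rw [a1 h, b1 h]; ring, fun h => by rw [a2 h, b2 h]; ring,
      fun h => by rw [a3 h, b3 h]; ring, fun h => by rw [a4 h, b4 h]; ring⟩
  · rw [blend_t, hA.good.t4_bot hs hp, hB.good.t4_bot hs hp]; ring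
  · rw [blend_t, hA.good.t4_top hs hp, hB.good.t4_top hs hp]; ring

/-- The region that `blend A B` maps onto the cube, where `GA` and `GB` are inverse to `A` and
`B`. -/
def blendDomain (GA GB : Pt4 → Pt4) : Set Pt4 :=
  GA '' (cube4 ∩ {q | z4 q ≤ 1/3}) ∪ GB '' (cube4 ∩ {q | 2/3 ≤ z4 q}) ∪
    (cube4 ∩ {q | z4 q ∈ Icc (1/3) (2/3)})

theorem isCompact_blendDomain {GA GB : Pt4 → Pt4} (hGA : Continuous GA) (hGB : Continuous GB) :
    IsCompact (blendDomain GA GB) :=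
  (((isCompact_cube4.inter_right (isClosed_Iic.preimage continuous_z4)).image hGA).union
    ((isCompact_cube4.inter_right (isClosed_Ici.preimage continuous_z4)).image hGB)).union
    (isCompact_cube4.inter_right (isClosed_Icc.preimage continuous_z4))

theorem Tame.inv_le_of_le (h : Tame A (1/3) 1) (hs : s ∈ II) (hG : Continuous G)
    (hinv : InvOn G (fun p => A p s) cube4 cube4) {q : Pt4} (hq : q ∈ cube4) (hz : z4 q ≤ 1/3) :
    z4 (G q) ≤ 1/3 := by
  rcases eq_or_lt_of_le hz with h' | h'
  · rw [(h.inv_mem (by norm_num) hs hinv hq ⟨h'.ge, hq.2.2.1.2⟩).2, h']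
  · exact (h.inv_lt_of_lt (by norm_num) (by norm_num) hs hG hinv hq h').le

theorem Tame.inv_ge_of_ge (h : Tame B 0 (2/3)) (hs : s ∈ II) (hG : Continuous G)
    (hinv : InvOn G (fun p => B p s) cube4 cube4) {q : Pt4} (hq : q ∈ cube4) (hz : 2/3 ≤ z4 q) :
    2/3 ≤ z4 (G q) := by
  rcases eq_or_lt_of_le hz with h' | h'
  · rw [(h.inv_mem (by norm_num) hs hinv hq ⟨hq.2.2.1.1, h'.ge⟩).2, ← h']
  · exact (h.inv_gt_of_gt (by norm_num) (by norm_num) hs hG hinv hq h').le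

theorem blend_inv_of_le (hA : Tame A (1/3) 1) (hs : s ∈ II) (hG : Continuous G)
    (hinv : InvOn G (fun p => A p s) cube4 cube4) {q : Pt4} (hq : q ∈ cube4) (hz : z4 q ≤ 1/3) :
    blend A B (G q) s = q := by
  rw [blend_of_le (by linarith [hA.inv_le_of_le hs hG hinv hq hz])]
  exact hinv.2 hq

theorem blend_inv_of_ge (hB : Tame B 0 (2/3)) (hs : s ∈ II) (hG : Continuous G)
    (hinv : InvOn G (fun p => B p s) cube4 cube4) {q : Pt4} (hq : q ∈ cube4) (hz : 2/3 ≤ z4 q) :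
    blend A B (G q) s = q := by
  rw [blend_of_ge (by linarith [hB.inv_ge_of_ge hs hG hinv hq hz])]
  exact hinv.2 hq

section
variable {GA GB : Pt4 → Pt4}

theorem blend_cases (hA : Tame A (1/3) 1) (hB : Tame B 0 (2/3)) (hs : s ∈ II)
    (hGA : Continuous GA) (hGB : Continuous GB) (iA : InvOn GA (fun p => A p s) cube4 cube4)
    (iB : InvOn GB (fun p => B p s) cube4 cube4) {p : Pt4} (hp : p ∈ blendDomain GA GB) :
    blend A B p s ∈ cube4 ∧
      (z4 (blend A B p s) < 1/3 → p = GA (blend A B p s)) ∧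
      (2/3 < z4 (blend A B p s) → p = GB (blend A B p s)) ∧
      (z4 (blend A B p s) ∈ Icc (1/3) (2/3) → p ∈ cube4 ∧ z4 p = z4 (blend A B p s)) := by
  obtain ((⟨q, ⟨hq, hz⟩, rfl⟩ | ⟨q, ⟨hq, hz⟩, rfl⟩) | ⟨hp, hz⟩) := hp
  · have hz : z4 q ≤ 1/3 := hz
    rw [blend_inv_of_le hA hs hGA iA hq hz]
    exact ⟨hq, fun _ => rfl, fun h => by linarith, fun h =>
      hA.inv_mem (by norm_num) hs iA hq ⟨h.1, hq.2.2.1.2⟩⟩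
  · have hz : 2/3 ≤ z4 q := hz
    rw [blend_inv_of_ge hB hs hGB iB hq hz]
    exact ⟨hq, fun h => by linarith, fun _ => rfl, fun h =>
      hB.inv_mem (by norm_num) hs iB hq ⟨hq.2.2.1.1, h.2⟩⟩
  · have e : z4 (blend A B p s) = z4 p := (tri_blend hA hB hs).z_eq p hz
    have h1 : 1/3 ≤ z4 p := hz.1
    have h2 : z4 p ≤ 2/3 := hz.2
    rw [e]
    exact ⟨mapsTo_blend hA hB hs hp, fun h => by linarith, fun h => by linarith, fun _ => ⟨hp, rfl⟩⟩

theorem injOn_blend (hA : Tame A (1/3) 1) (hB : Tame B 0 (2/3)) (hs : s ∈ II)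
    (hGA : Continuous GA) (hGB : Continuous GB) (iA : InvOn GA (fun p => A p s) cube4 cube4)
    (iB : InvOn GB (fun p => B p s) cube4 cube4) :
    InjOn (fun p => blend A B p s) (blendDomain GA GB) := by
  intro p hp p' hp' he
  have he : blend A B p s = blend A B p' s := he
  obtain ⟨hm, c1, c2, c3⟩ := blend_cases hA hB hs hGA hGB iA iB hp
  obtain ⟨-, d1, d2, d3⟩ := blend_cases hA hB hs hGA hGB iA iB hp'
  rw [← he] at d1 d2 d3
  rcases lt_or_ge (z4 (blend A B p s)) (1/3) with h1 | h1
  · exact (c1 h1).trans (d1 h1).symm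
  rcases lt_or_ge (2/3) (z4 (blend A B p s)) with h2 | h2
  · exact (c2 h2).trans (d2 h2).symm
  obtain ⟨m1, z1⟩ := c3 ⟨h1, h2⟩
  obtain ⟨m2, z2⟩ := d3 ⟨h1, h2⟩
  generalize z4 (blend A B p s) = c at *
  exact (box_blend hA hB hs ⟨h1, h2⟩).eq_of_eq m1 m2 z1 z2 hm he

theorem fderiv_blend_injective (hA : Tame A (1/3) 1) (hB : Tame B 0 (2/3)) (hs : s ∈ II)
    (hGA : ContDiff ℝ (⊤ : ℕ∞) GA) (hGB : ContDiff ℝ (⊤ : ℕ∞) GB)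
    (iA : InvOn GA (fun p => A p s) cube4 cube4) (iB : InvOn GB (fun p => B p s) cube4 cube4)
    {p : Pt4} (hp : p ∈ blendDomain GA GB) :
    Function.Injective (fderiv ℝ (fun p => blend A B p s) p) := by
  obtain ((⟨q, ⟨hq, hz⟩, rfl⟩ | ⟨q, ⟨hq, hz⟩, rfl⟩) | ⟨hp, hz⟩) := hp
  · have hlt := hA.inv_le_of_le hs hGA.continuous iA hq hz
    have : (fun p => blend A B p s) =ᶠ[nhds (GA q)] fun p => A p s := by
      filter_upwards [(isOpen_Iio.preimage continuous_z4).mem_nhds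
        (show GA q ∈ z4 ⁻¹' Iio (2/5) from hlt.trans_lt (by norm_num))] with p hp
      exact blend_of_le (le_of_lt hp)
    rw [this.fderiv_eq]
    exact fderiv_injective_of_rightInvOn convex_cube4 interior_cube4_nonempty
      (hA.good.differentiable s) (hGA.differentiable (by simp)) iA.2 hq
  · have hlt := hB.inv_ge_of_ge hs hGB.continuous iB hq hz
    have : (fun p => blend A B p s) =ᶠ[nhds (GB q)] fun p => B p s := by
      filter_upwards [(isOpen_Ioi.preimage continuous_z4).mem_nhds
        (show GB q ∈ z4 ⁻¹' Ioi (3/5) from lt_of_lt_of_le (by norm_num) hlt)] with p hp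
      exact blend_of_ge (le_of_lt hp)
    rw [this.fderiv_eq]
    exact fderiv_injective_of_rightInvOn convex_cube4 interior_cube4_nonempty
      (hB.good.differentiable s) (hGB.differentiable (by simp)) iB.2 hq
  · obtain ⟨h1, h2, h3⟩ := diag_pos_blend hA hB hs hp hz
    exact (tri_blend hA hB hs).injective_of_diag (by norm_num) (differentiable_blend hA hB s) hz
      h1.ne' h2.ne' h3.ne'

theorem cube4_subset_blendDomain (hA : Tame A (1/3) 1) (hB : Tame B 0 (2/3)) (hs : s ∈ II)
    (iA : InvOn GA (fun p => A p s) cube4 cube4) (iB : InvOn GB (fun p => B p s) cube4 cube4) :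
    cube4 ⊆ blendDomain GA GB := by
  intro p hp
  rcases lt_or_ge (z4 p) (1/3) with h1 | h1
  · exact Or.inl (Or.inl ⟨A p s, ⟨hA.good.mapsTo s hs hp,
      (hA.lt_of_lt (by norm_num) (by norm_num) hs hp h1).le⟩, iA.1 hp⟩)
  rcases lt_or_ge (2/3) (z4 p) with h2 | h2
  · exact Or.inl (Or.inr ⟨B p s, ⟨hB.good.mapsTo s hs hp,
      (hB.gt_of_gt (by norm_num) (by norm_num) hs hp h2).le⟩, iB.1 hp⟩)
  exact Or.inr ⟨hp, h1, h2⟩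

theorem surjOn_blend (hA : Tame A (1/3) 1) (hB : Tame B 0 (2/3)) (hs : s ∈ II)
    (hGA : Continuous GA) (hGB : Continuous GB) (iA : InvOn GA (fun p => A p s) cube4 cube4)
    (iB : InvOn GB (fun p => B p s) cube4 cube4) :
    SurjOn (fun p => blend A B p s) (blendDomain GA GB) cube4 := by
  intro q hq
  rcases lt_or_ge (z4 q) (1/3) with h1 | h1
  · exact ⟨GA q, Or.inl (Or.inl ⟨q, ⟨hq, h1.le⟩, rfl⟩), blend_inv_of_le hA hs hGA iA hq h1.le⟩
  rcases lt_or_ge (2/3) (z4 q) with h2 | h2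
  · exact ⟨GB q, Or.inl (Or.inr ⟨q, ⟨hq, h2.le⟩, rfl⟩), blend_inv_of_ge hB hs hGB iB hq h2.le⟩
  obtain ⟨p, hp, hzp, he⟩ := (box_blend hA hB hs ⟨h1, h2⟩).exists_eq
    (differentiable_blend hA hB s).continuous hq.2.2.1 hq rfl
  exact ⟨p, Or.inr ⟨hp, hzp.symm ▸ h1, hzp.symm ▸ h2⟩, he⟩

end

theorem exists_inv_blend (hA : Tame A (1/3) 1) (hB : Tame B 0 (2/3)) (hs : s ∈ II) :
    ∃ G : Pt4 → Pt4, ContDiff ℝ (⊤ : ℕ∞) G ∧ InvOn G (fun p => blend A B p s) cube4 cube4 := by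
  obtain ⟨GA, hGA, iA⟩ := hA.good.diffeo s hs
  obtain ⟨GB, hGB, iB⟩ := hB.good.diffeo s hs
  have cA := hGA.continuous
  have cB := hGB.continuous
  exact exists_contDiff_invOn (contDiff_blend_apply hA.good hB.good s) (isCompact_blendDomain cA cB)
    (injOn_blend hA hB hs cA cB iA iB)
    (fun _ hp => fderiv_blend_injective hA hB hs hGA hGB iA iB hp)
    (cube4_subset_blendDomain hA hB hs iA iB) (surjOn_blend hA hB hs cA cB iA iB)

theorem good_blend (hA : Tame A (1/3) 1) (hB : Tame B 0 (2/3))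
    : Good (blend A B) where
  smooth := contDiff_blend hA.good hB.good
  mapsTo _ hs := mapsTo_blend hA hB hs
  diffeo _ hs := exists_inv_blend hA hB hs
  productT := by
    obtain ⟨δ, hδ, -, hP⟩ := hA.good.exists_t_zone
    obtain ⟨δ', hδ', -, hP'⟩ := hB.good.exists_t_zone
    refine ⟨min δ δ', lt_min hδ hδ', fun s hs x y z t ht => ⟨fun h1 => ?_, fun h1 => ?_⟩⟩
    · have e := (hP s hs x y z t ht).1 (h1.trans (min_le_left _ _))
      have e' := (hP' s hs x y z t ht).1 (h1.trans (min_le_right _ _))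
      refine pt4_ext ?_ ?_ ?_ ?_
      · rw [blend_x, e, e']; rfl
      · rw [blend_y, e, e']; rfl
      · rw [blend_z, e, e']; rfl
      · rw [blend_t, e, e']; simp only [t4]; ring
    · have e := (hP s hs x y z t ht).2 (by linarith [min_le_left δ δ'])
      have e' := (hP' s hs x y z t ht).2 (by linarith [min_le_right δ δ'])
      refine pt4_ext ?_ ?_ ?_ ?_
      · rw [blend_x, e, e']; rfl
      · rw [blend_y, e, e']; rfl
      · rw [blend_z, e, e']; rfl
      · rw [blend_t, e, e']; simp only [t4]; ring
  productZ := by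
    obtain ⟨δ, hδ, hδ4, hP⟩ := hA.good.exists_z_zone
    obtain ⟨δ', hδ', hδ4', hP'⟩ := hB.good.exists_z_zone
    refine ⟨min δ δ', lt_min hδ hδ', fun s hs x y t z hz => ⟨fun h1 => ?_, fun h1 => ?_⟩⟩
    · have := min_le_left δ δ'
      rw [blend_of_le (by simp only [z4]; linarith), blend_of_le (by simp only [z4]; norm_num)]
      exact (hP s hs x y t z hz).1 (by linarith)
    · have := min_le_right δ δ'
      rw [blend_of_ge (by simp only [z4]; linarith), blend_of_ge (by simp only [z4]; norm_num)]
      exact (hP' s hs x y t z hz).2 (by linarith)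
  levelEnds t₀ ht s hs y z x x' := by
    rw [blend_y, blend_y, hA.good.levelEnds t₀ ht s hs y z x x', hB.good.levelEnds t₀ ht s hs y z x x']
    rfl
  levelEndsZ t₀ ht s hs z x x' y y' := by
    rw [blend_z, blend_z, hA.good.levelEndsZ t₀ ht s hs z x x' y y',
      hB.good.levelEndsZ t₀ ht s hs z x x' y y']
    rfl
  levelSides z₀ hz s hs y t x x' := by
    rw [blend_y, blend_y, hA.good.levelSides z₀ hz s hs y t x x',
      hB.good.levelSides z₀ hz s hs y t x x']
    rfl
  levelSidesT z₀ hz s hs t x x' y y' := by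
    rw [blend_t, blend_t, hA.good.levelSidesT z₀ hz s hs t x x' y y',
      hB.good.levelSidesT z₀ hz s hs t x x' y y']
    rfl

end

theorem eqOn_of_image_eq {u v : ℝ → ℝ} {Y : Set ℝ} (hY : Y.Finite) (hu : StrictMonoOn u Y)
    (hv : StrictMonoOn v Y) (h : u '' Y = v '' Y) : EqOn u v Y := by
  have := hY.to_subtype
  rw [image_eq_range, image_eq_range] at h
  have e := (StrictMono.range_inj (f := fun y : Y => u y) (g := fun y : Y => v y)
    (fun a b hab => hu a.2 b.2 hab) (fun a b hab => hv a.2 b.2 hab)).1 h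
  exact fun y hy => congrFun e ⟨y, hy⟩

/-- Two maps of the plane that are monotone in `y` and have the same image of a finite set agree on
it, provided the points of the image have distinct `y` coordinates. -/
theorem eqOn_of_image_eq_of_injOn_snd {f g : Pt2 → Pt2} {u v : ℝ → ℝ} {W W' : Set Pt2} {Y : Set ℝ}
    (hW : W.Finite) (hWY : ∀ w ∈ W, w.2 ∈ Y) (hW' : InjOn Prod.snd W') (hu : StrictMonoOn u Y)
    (hv : StrictMonoOn v Y) (hfu : ∀ w ∈ W, (f w).2 = u w.2) (hgv : ∀ w ∈ W, (g w).2 = v w.2)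
    (hf : f '' W = W') (hg : g '' W = W') : EqOn f g W := by
  have hsub : Prod.snd '' W ⊆ Y := by
    rintro _ ⟨w, hw, rfl⟩
    exact hWY w hw
  have himage : ∀ {k : Pt2 → Pt2} {r : ℝ → ℝ}, (∀ w ∈ W, (k w).2 = r w.2) → k '' W = W' →
      r '' (Prod.snd '' W) = Prod.snd '' W' := by
    intro k r hk he
    rw [← he, image_image, image_image]
    exact image_congr fun w hw => (hk w hw).symm
  have huv := eqOn_of_image_eq (hW.image Prod.snd) (hu.mono hsub) (hv.mono hsub)
    ((himage hfu hf).trans (himage hgv hg).symm)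
  intro w hw
  refine hW' (hf ▸ mem_image_of_mem f hw) (hg ▸ mem_image_of_mem g hw) ?_
  rw [hfu w hw, hgv w hw, huv (mem_image_of_mem _ hw)]

/-- The set `S` consists of the vertical strands `W × I₄` at the level `z = c`. -/
def StrandsAt (S : Set Pt4) (W : Set Pt2) (c : ℝ) : Prop :=
  ∀ x y t : ℝ, (x, y, c, t) ∈ S ↔ (x, y) ∈ W ∧ t ∈ II

theorem IsGenericTwoTangle.exists_strands {α : Set Pt4} (hα : IsGenericTwoTangle α)
    (hp : ProductZOn4 α (1/4) 1) :
    ∃ W : Set Pt2, W.Finite ∧ InjOn Prod.snd W ∧ (∀ w ∈ W, w ∈ sq) ∧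
      ∀ c ∈ Icc (1/4 : ℝ) 1, StrandsAt α W c := by
  obtain ⟨hT, F, -, hF⟩ := hα
  obtain ⟨L, hL, hS⟩ := hT.sides
  have hst : ∀ c ∈ Icc (1/4 : ℝ) 1, StrandsAt α {w | (w.1, w.2, (1 : ℝ)) ∈ L} c := by
    intro c hc x y t
    rw [hp x y t c hc 1 ⟨by norm_num, le_rfl⟩]
    have h := Set.ext_iff.1 hS (x, y, 1, t)
    constructor
    · intro h1
      exact h.1 ⟨h1, Or.inr rfl⟩
    · intro h1
      exact (h.2 h1).1
  refine ⟨{w | (w.1, w.2, (1 : ℝ)) ∈ L}, ?_, ?_, ?_, hst⟩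
  · refine Set.Finite.preimage (f := fun w : Pt2 => ((w.1, w.2, (1 : ℝ)) : Pt3)) ?_ L.finite_toSet
    intro w _ w' _ h
    simp only [Prod.mk.injEq] at h
    exact Prod.ext h.1 h.2.1
  · rintro ⟨x, y⟩ hw ⟨x', y'⟩ hw' (rfl : y = y')
    obtain ⟨t, ht⟩ := ((Icc_infinite (zero_lt_one' ℝ)).sdiff F.finite_toSet).nonempty
    obtain ⟨-, Cr, Ex, -, hinj, -⟩ := hF t ht
    have hfin : {z : ℝ | (y, z) ∈ (Cr : Set Pt2)}.Finite :=
      Cr.finite_toSet.preimage fun z _ z' _ h => (Prod.ext_iff.1 h).2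
    obtain ⟨z, hz, hzC⟩ := ((Icc_infinite (show (1/4 : ℝ) < 1 by norm_num)).sdiff hfin).nonempty
    have e := hinj (x₁ := (x, y, z)) ⟨(hst z hz x y t).2 ⟨hw, ht.1⟩, hzC⟩ (x₂ := (x', y, z))
      ⟨(hst z hz x' y t).2 ⟨hw', ht.1⟩, hzC⟩ rfl
    simp only [Prod.mk.injEq] at e
    rw [e.1]
  · intro w hw
    have := hT.subset ((hst 1 ⟨by norm_num, le_rfl⟩ w.1 w.2 0).2 ⟨hw, zero_mem_II⟩)
    exact ⟨this.1, this.2.1⟩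

/-- The map induced by `h` on the square `z = c`, `t` constant. -/
def sliceMap (h : Pt4 → Pt4) (c t : ℝ) (w : Pt2) : Pt2 :=
  (x4 (h (w.1, w.2, c, t)), y4 (h (w.1, w.2, c, t)))

theorem Box.sliceMap_image {h : Pt4 → Pt4} {c t : ℝ} {S S' : Set Pt4} {W W' : Set Pt2}
    (hB : Box h c) (hc : c ∈ II) (hm : MapsTo h cube4 cube4) (hW : ∀ w ∈ W, w ∈ sq)
    (hS : StrandsAt S W c) (hS' : StrandsAt S' W' c) (him : h '' S = S')
    (hback : ∀ p ∈ S, z4 (h p) = c → z4 p = c) (ht : t ∈ II) :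
    sliceMap h c t '' W = W' := by
  apply Subset.antisymm
  · rintro _ ⟨w, hw, rfl⟩
    have h1 : h (w.1, w.2, c, t) ∈ S' := him ▸ mem_image_of_mem h ((hS _ _ _).2 ⟨hw, ht⟩)
    have hz := hB.z_eq w.1 (hW w hw).1 w.2 (hW w hw).2 t ht
    have e : h (w.1, w.2, c, t) =
        ((sliceMap h c t w).1, (sliceMap h c t w).2, c, t4 (h (w.1, w.2, c, t))) :=
      pt4_ext rfl rfl hz rfl
    rw [e] at h1
    exact ((hS' _ _ _).1 h1).1
  · intro w' hw'
    have hτ : t4 (h (0, 0, c, t)) ∈ II := (hm (x := (0, 0, c, t))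
      ⟨zero_mem_II, zero_mem_II, hc, ht⟩).2.2.2
    have h1 : (w'.1, w'.2, c, t4 (h (0, 0, c, t))) ∈ S' := (hS' _ _ _).2 ⟨hw', hτ⟩
    rw [← him] at h1
    obtain ⟨p, hp, he⟩ := h1
    have hz := hback p hp (by rw [he]; rfl)
    obtain ⟨x, y, z, t₁⟩ := p
    obtain rfl : z = c := hz
    obtain ⟨hw, ht₁⟩ := (hS x y t₁).1 hp
    have e : t4 (h (0, 0, z, t₁)) = t4 (h (0, 0, z, t)) := by
      rw [← hB.t_eq x (hW _ hw).1 y (hW _ hw).2 t₁ ht₁, he]; rfl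
    obtain rfl : t₁ = t := hB.t_mono.injOn ht₁ ht e
    refine ⟨(x, y), hw, Prod.ext ?_ ?_⟩
    · change x4 (h (x, y, z, t₁)) = _
      rw [he]; rfl
    · change y4 (h (x, y, z, t₁)) = _
      rw [he]; rfl

theorem Box.sliceMap_snd {h : Pt4 → Pt4} {c t : ℝ} (hB : Box h c) (ht : t ∈ II) {w : Pt2}
    (hw : w ∈ sq) : (sliceMap h c t w).2 = y4 (h (0, w.2, c, t)) :=
  hB.y_eq w.1 hw.1 w.2 hw.2 t ht

theorem mem_glueZ4_iff_left {α β : Set Pt4} (h : ∀ p, z4 p ∈ Icc (1/4 : ℝ) (3/4) → (p ∈ α ↔ p ∈ β))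
    {p : Pt4} (hp : z4 p ≤ 3/4) : p ∈ glueZ4 α β ↔ p ∈ α := by
  constructor
  · rintro (⟨h1, -⟩ | ⟨h1, h2⟩)
    · exact h1
    · exact (h p ⟨by linarith, hp⟩).2 h1
  · intro h1
    rcases le_total (z4 p) (1/2) with h2 | h2
    · exact Or.inl ⟨h1, h2⟩
    · exact Or.inr ⟨(h p ⟨by linarith, hp⟩).1 h1, h2⟩

theorem mem_glueZ4_iff_right {α β : Set Pt4} (h : ∀ p, z4 p ∈ Icc (1/4 : ℝ) (3/4) → (p ∈ α ↔ p ∈ β))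
    {p : Pt4} (hp : 1/4 ≤ z4 p) : p ∈ glueZ4 α β ↔ p ∈ β := by
  constructor
  · rintro (⟨h1, h2⟩ | ⟨h1, -⟩)
    · exact (h p ⟨hp, by linarith⟩).1 h1
    · exact h1
  · intro h1
    rcases le_total (z4 p) (1/2) with h2 | h2
    · exact Or.inl ⟨(h p ⟨hp, by linarith⟩).2 h1, h2⟩
    · exact Or.inr ⟨h1, h2⟩

theorem StrandsAt.of_match {α β : Set Pt4} {W : Set Pt2} (hα : StrandsAt α W 1)
    (hmatch : ∀ x y t : ℝ, (x, y, 1, t) ∈ α ↔ (x, y, 0, t) ∈ β) (hβ : ProductZOn4 β 0 (3/4)) {c : ℝ}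
    (hc : c ∈ Icc (0 : ℝ) (3/4)) : StrandsAt β W c := fun x y t => by
  rw [hβ x y t c hc 0 ⟨le_rfl, by norm_num⟩, ← hmatch]
  exact hα x y t

section
variable {A B : Pt4 → ℝ → Pt4} {α α' β β' : Set Pt4} {W W' : Set Pt2}

theorem sliceMap_blend (hA : Tame A (1/3) 1) (hB : Tame B 0 (2/3))
    (hαc : α ⊆ cube4) (hβc : β ⊆ cube4)
    (hAα : (fun p => A p 1) '' α = α') (hBβ : (fun p => B p 1) '' β = β')
    (hWf : W.Finite) (hW : ∀ w ∈ W, w ∈ sq) (hW' : InjOn Prod.snd W')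
    {c t : ℝ} (hc : c ∈ Icc (1/3 : ℝ) (2/3)) (ht : t ∈ II)
    (hα : StrandsAt α W c) (hβ : StrandsAt β W c) (hα' : StrandsAt α' W' c)
    (hβ' : StrandsAt β' W' c) :
    sliceMap (fun p => blend A B p 1) c t '' W = W' := by
  have hcI : c ∈ II := ⟨by linarith [hc.1], by linarith [hc.2]⟩
  have bA := hA.box (by norm_num) one_mem_II (c := c) ⟨hc.1, hcI.2⟩ hcI
  have bB := hB.box (by norm_num) one_mem_II (c := c) ⟨hcI.1, hc.2⟩ hcI
  have iA : sliceMap (fun p => A p 1) c t '' W = W' := by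
    refine bA.sliceMap_image hcI (hA.good.mapsTo 1 one_mem_II) hW hα hα' hAα (fun p hp hz => ?_) ht
    have hz : z4 (A p 1) = c := hz
    rcases lt_or_ge (z4 p) (1/3) with h | h
    · linarith [hA.lt_of_lt (by norm_num) (by norm_num) one_mem_II (hαc hp) h, hc.1]
    · exact ((hA.tri 1 one_mem_II).z_eq p ⟨h, (hαc hp).2.2.1.2⟩).symm.trans hz
  have iB : sliceMap (fun p => B p 1) c t '' W = W' := by
    refine bB.sliceMap_image hcI (hB.good.mapsTo 1 one_mem_II) hW hβ hβ' hBβ (fun p hp hz => ?_) ht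
    have hz : z4 (B p 1) = c := hz
    rcases lt_or_ge (2/3) (z4 p) with h | h
    · linarith [hB.gt_of_gt (by norm_num) (by norm_num) one_mem_II (hβc hp) h, hc.2]
    · exact ((hB.tri 1 one_mem_II).z_eq p ⟨(hβc hp).2.2.1.1, h⟩).symm.trans hz
  have e := eqOn_of_image_eq_of_injOn_snd hWf (fun w hw => (hW w hw).2) hW' (bA.y_mono t ht)
    (bB.y_mono t ht) (fun w hw => bA.sliceMap_snd ht (hW w hw))
    (fun w hw => bB.sliceMap_snd ht (hW w hw)) iA iB
  rw [← iA]
  refine image_congr fun w hw => ?_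
  have e1 : x4 (A (w.1, w.2, c, t) 1) = x4 (B (w.1, w.2, c, t) 1) := (congrArg Prod.fst (e hw) :)
  have e2 : y4 (A (w.1, w.2, c, t) 1) = y4 (B (w.1, w.2, c, t) 1) := (congrArg Prod.snd (e hw) :)
  refine Prod.ext ?_ ?_
  · change x4 (blend A B _ 1) = x4 (A _ 1)
    rw [blend_x, ← e1]; ring
  · change y4 (blend A B _ 1) = y4 (A _ 1)
    rw [blend_y, ← e2]; ring

theorem blend_image_glueZ4 (hA : Tame A (1/3) 1) (hB : Tame B 0 (2/3))
    (hαc : α ⊆ cube4) (hβc : β ⊆ cube4)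
    (hAα : (fun p => A p 1) '' α = α') (hBβ : (fun p => B p 1) '' β = β')
    (hWf : W.Finite) (hW : ∀ w ∈ W, w ∈ sq) (hW' : InjOn Prod.snd W')
    (hα : ∀ c ∈ Icc (1/4 : ℝ) (3/4), StrandsAt α W c)
    (hβ : ∀ c ∈ Icc (1/4 : ℝ) (3/4), StrandsAt β W c)
    (hα' : ∀ c ∈ Icc (1/4 : ℝ) (3/4), StrandsAt α' W' c)
    (hβ' : ∀ c ∈ Icc (1/4 : ℝ) (3/4), StrandsAt β' W' c) :
    (fun p => blend A B p 1) '' glueZ4 α β = glueZ4 α' β' := by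
  have hg : ∀ p, z4 p ∈ Icc (1/4 : ℝ) (3/4) → (p ∈ α ↔ p ∈ β) := fun p hz =>
    (hα _ hz _ _ _).trans (hβ _ hz _ _ _).symm
  have hg' : ∀ p, z4 p ∈ Icc (1/4 : ℝ) (3/4) → (p ∈ α' ↔ p ∈ β') := fun p hz =>
    (hα' _ hz _ _ _).trans (hβ' _ hz _ _ _).symm
  have hI : ∀ {c : ℝ}, c ∈ Icc (1/3 : ℝ) (2/3) → c ∈ Icc (1/4 : ℝ) (3/4) := fun h =>
    ⟨by linarith [h.1], by linarith [h.2]⟩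
  have hsl : ∀ c ∈ Icc (1/3 : ℝ) (2/3), ∀ t ∈ II,
      sliceMap (fun p => blend A B p 1) c t '' W = W' := fun c hc t ht =>
    sliceMap_blend hA hB hαc hβc hAα hBβ hWf hW hW' hc ht (hα c (hI hc)) (hβ c (hI hc))
      (hα' c (hI hc)) (hβ' c (hI hc))
  apply Subset.antisymm
  · rintro _ ⟨p, hp, rfl⟩
    change blend A B p 1 ∈ _
    rcases lt_or_ge (z4 p) (1/3) with h1 | h1
    · have hpα := (mem_glueZ4_iff_left hg (by linarith)).1 hp
      have hlt := hA.lt_of_lt (by norm_num) (by norm_num) one_mem_II (hαc hpα) h1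
      rw [blend_of_le (by linarith), mem_glueZ4_iff_left hg' (by linarith), ← hAα]
      exact ⟨p, hpα, rfl⟩
    rcases lt_or_ge (2/3) (z4 p) with h2 | h2
    · have hpβ := (mem_glueZ4_iff_right hg (by linarith)).1 hp
      have hlt := hB.gt_of_gt (by norm_num) (by norm_num) one_mem_II (hβc hpβ) h2
      rw [blend_of_ge (by linarith), mem_glueZ4_iff_right hg' (by linarith), ← hBβ]
      exact ⟨p, hpβ, rfl⟩
    have hpα := (mem_glueZ4_iff_left hg (by linarith)).1 hp
    obtain ⟨x, y, c, t⟩ := p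
    have hc : c ∈ Icc (1/3 : ℝ) (2/3) := ⟨h1, h2⟩
    obtain ⟨hw, ht⟩ := (hα c (hI hc) x y t).1 hpα
    have hz : z4 (blend A B (x, y, c, t) 1) = c := (tri_blend hA hB one_mem_II).z_eq (x, y, c, t) hc
    have hw' := (hsl c hc t ht) ▸ mem_image_of_mem (sliceMap (fun p => blend A B p 1) c t) hw
    have htI := (mapsTo_blend hA hB one_mem_II (hαc hpα)).2.2.2
    have e : blend A B (x, y, c, t) 1 = (x4 (blend A B (x, y, c, t) 1),
      y4 (blend A B (x, y, c, t) 1), c, t4 (blend A B (x, y, c, t) 1)) := pt4_ext rfl rfl hz rfl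
    rw [mem_glueZ4_iff_left hg' (by rw [hz]; exact (hI hc).2), e]
    exact (hα' c (hI hc) _ _ _).2 ⟨hw', htI⟩
  · intro q hq
    rcases lt_or_ge (z4 q) (1/3) with h1 | h1
    · have hqα := (mem_glueZ4_iff_left hg' (by linarith)).1 hq
      rw [← hAα] at hqα
      obtain ⟨p, hp, rfl⟩ := hqα
      have h1 : z4 (A p 1) < 1/3 := h1
      have hz : z4 p < 1/3 := by
        by_contra! h
        have e : z4 (A p 1) = z4 p := (hA.tri 1 one_mem_II).z_eq p ⟨h, (hαc hp).2.2.1.2⟩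
        linarith
      exact ⟨p, (mem_glueZ4_iff_left hg (by linarith)).2 hp, blend_of_le (by linarith)⟩
    rcases lt_or_ge (2/3) (z4 q) with h2 | h2
    · have hqβ := (mem_glueZ4_iff_right hg' (by linarith)).1 hq
      rw [← hBβ] at hqβ
      obtain ⟨p, hp, rfl⟩ := hqβ
      have h2 : 2/3 < z4 (B p 1) := h2
      have hz : 2/3 < z4 p := by
        by_contra! h
        have e : z4 (B p 1) = z4 p := (hB.tri 1 one_mem_II).z_eq p ⟨(hβc hp).2.2.1.1, h⟩
        linarith
      exact ⟨p, (mem_glueZ4_iff_right hg (by linarith)).2 hp, blend_of_ge (by linarith)⟩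
    have hqα := (mem_glueZ4_iff_left hg' (by linarith)).1 hq
    obtain ⟨x', y', c, t'⟩ := q
    have hc : c ∈ Icc (1/3 : ℝ) (2/3) := ⟨h1, h2⟩
    obtain ⟨hw', ht'⟩ := (hα' c (hI hc) x' y' t').1 hqα
    have hbox := box_blend hA hB one_mem_II hc
    have hcont : Continuous fun t : ℝ => t4 (blend A B (0, 0, c, t) 1) :=
      continuous_t4.comp ((differentiable_blend hA hB 1).continuous.comp
        (show Continuous fun t : ℝ => ((0, 0, c, t) : Pt4) by fun_prop))
    obtain ⟨t, ht, hte⟩ := exists_mem_II_eq hcont.continuousOn hbox.t_zero hbox.t_one ht'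
    rw [← hsl c hc t ht] at hw'
    obtain ⟨w, hw, hwe⟩ := hw'
    refine ⟨(w.1, w.2, c, t), (mem_glueZ4_iff_left (p := (w.1, w.2, c, t)) hg (hI hc).2).2
      ((hα c (hI hc) _ _ _).2 ⟨hw, ht⟩),
      pt4_ext (congrArg Prod.fst hwe :) (congrArg Prod.snd hwe :)
      (hbox.z_eq w.1 (hW w hw).1 w.2 (hW w hw).2 t ht)
      ((hbox.t_eq w.1 (hW w hw).1 w.2 (hW w hw).2 t ht).trans hte)⟩

end

/-- **Horizontal composition of 2-morphisms in the 2-category `𝒯` of 2-tangles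
is well defined** (part of Lemma 1 of HDA IV): if `α : f ⇒ f'` and
`β : g ⇒ g'` are 2-morphisms with `f, f' : A → B` and `g, g' : B → C`,
represented by generic 2-tangles chosen so that
`α ∩ I₁×I₂×{1}×I₄ = β ∩ I₁×I₂×{0}×I₄`, the representative of `α` having a
product structure in the `z` direction for `z ∈ [1/4,1]` and that of `β` for
`z ∈ [0,3/4]`, then the class of the glued 2-tangle
`(α ∩ I₁×I₂×[0,1/2]×I₄) ∪ (β ∩ I₁×I₂×[1/2,1]×I₄)` is independent of all
choices of representatives. -/
theorem horizontal_composition_of_two_morphisms_well_defined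
    (α β α' β' : Set Pt4)
    (hα : IsGenericTwoTangle α) (hβ : IsGenericTwoTangle β)
    (hα' : IsGenericTwoTangle α') (hβ' : IsGenericTwoTangle β')
    (hαα' : TwoTangleEquiv α α') (hββ' : TwoTangleEquiv β β')
    -- the representatives are glued along the strands at their top and bottom
    (hmatch : ∀ x y t : ℝ, (x, y, 1, t) ∈ α ↔ (x, y, 0, t) ∈ β)
    (hmatch' : ∀ x y t : ℝ, (x, y, 1, t) ∈ α' ↔ (x, y, 0, t) ∈ β')
    (hαp : ProductZOn4 α (1/4) 1) (hβp : ProductZOn4 β 0 (3/4))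
    (hαp' : ProductZOn4 α' (1/4) 1) (hβp' : ProductZOn4 β' 0 (3/4)) :
    TwoTangleEquiv (glueZ4 α β) (glueZ4 α' β') := by
  obtain ⟨H, hH, H0, hHα⟩ := hαα'
  obtain ⟨K, hK, K0, hKβ⟩ := hββ'
  obtain ⟨η, hη, hη1, hm⟩ := hα.1.exists_margin
  obtain ⟨η', hη', hη1', hm'⟩ := hβ.1.exists_margin
  obtain ⟨A, hA, hAα⟩ := exists_tame_top hH.good H0 hHα hα.1.subset hα'.1.subset hαp hαp' hη hη1
    fun x y t h => hm x y 1 t (Or.inr rfl) h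
  obtain ⟨B, hB, hBβ⟩ := exists_tame_bot hK.good K0 hKβ hβ.1.subset hβ'.1.subset hβp hβp' hη' hη1'
    fun x y t h => hm' x y 0 t (Or.inl rfl) h
  obtain ⟨W, hWf, -, hW, hWα⟩ := hα.exists_strands hαp
  obtain ⟨W', -, hWi', -, hWα'⟩ := hα'.exists_strands hαp'
  have h1 : (1 : ℝ) ∈ Icc (1/4 : ℝ) 1 := ⟨by norm_num, le_rfl⟩
  refine ⟨blend A B, (good_blend hA hB).twoTangleEquivIsotopy, fun p => ?_,
    blend_image_glueZ4 hA hB hα.1.subset hβ.1.subset hAα hBβ hWf hW hWi'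
      (fun c hc => hWα c ⟨hc.1, by linarith [hc.2]⟩)
      (fun c hc => (hWα 1 h1).of_match hmatch hβp ⟨by linarith [hc.1], hc.2⟩)
      (fun c hc => hWα' c ⟨hc.1, by linarith [hc.2]⟩)
      (fun c hc => (hWα' 1 h1).of_match hmatch' hβp' ⟨by linarith [hc.1], hc.2⟩)⟩
  rw [blend, hA.zero, hB.zero, ← add_smul, sub_add_cancel, one_smul]

end HDA4
end
end

section
/- In any monoidal 2-category with duals, the equational laws involving counits are consequences of those involving units by taking duals: in particular, the equation e_{A⊗B} = (B*⊗e_A⊗B)e_B for all objects A, B follows from the equation i_{A⊗B} = i_A(A⊗i_B⊗A*) (holding for all objects) together with the other duality axioms ((fg)* = g*f*, (A⊗B)* = B*⊗A*, (A⊗f)* = A⊗f*, i_{X*} = e_X*, X** = X); similarly, either of the equations i_{X*} = e_X* and e_{X*} = i_X* implies the other. -/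
/-! ## Strict 2-categories, presented globularly with totalized operations.
Equations are imposed only when the relevant composability conditions hold. -/

/-- A (strict) 2-category: objects, 1-morphisms, 2-morphisms with vertical and
horizontal composition, identities, unit and associativity laws, and the
exchange identity.  Composition is written diagrammatically: `comp f g = fg`. -/
structure TwoCat where
  Obj : Type
  Mor : Type
  Cell : Type
  src₁ : Mor → Obj
  tgt₁ : Mor → Obj
  src₂ : Cell → Mor
  tgt₂ : Cell → Mor
  id₁ : Obj → Mor
  id₂ : Mor → Cell
  comp : Mor → Mor → Mor
  vcomp : Cell → Cell → Cell
  hcomp : Cell → Cell → Cell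
  id₁_src : ∀ A, src₁ (id₁ A) = A
  id₁_tgt : ∀ A, tgt₁ (id₁ A) = A
  id₂_src : ∀ f, src₂ (id₂ f) = f
  id₂_tgt : ∀ f, tgt₂ (id₂ f) = f
  cell_src_src : ∀ α, src₁ (src₂ α) = src₁ (tgt₂ α)
  cell_tgt_tgt : ∀ α, tgt₁ (src₂ α) = tgt₁ (tgt₂ α)
  comp_src : ∀ f g, tgt₁ f = src₁ g → src₁ (comp f g) = src₁ f
  comp_tgt : ∀ f g, tgt₁ f = src₁ g → tgt₁ (comp f g) = tgt₁ g
  vcomp_src : ∀ α β, tgt₂ α = src₂ β → src₂ (vcomp α β) = src₂ α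
  vcomp_tgt : ∀ α β, tgt₂ α = src₂ β → tgt₂ (vcomp α β) = tgt₂ β
  hcomp_src : ∀ α β, tgt₁ (src₂ α) = src₁ (src₂ β) →
    src₂ (hcomp α β) = comp (src₂ α) (src₂ β)
  hcomp_tgt : ∀ α β, tgt₁ (src₂ α) = src₁ (src₂ β) →
    tgt₂ (hcomp α β) = comp (tgt₂ α) (tgt₂ β)
  comp_id_left : ∀ f, comp (id₁ (src₁ f)) f = f
  comp_id_right : ∀ f, comp f (id₁ (tgt₁ f)) = f
  comp_assoc : ∀ f g h, tgt₁ f = src₁ g → tgt₁ g = src₁ h →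
    comp (comp f g) h = comp f (comp g h)
  vcomp_id_left : ∀ α, vcomp (id₂ (src₂ α)) α = α
  vcomp_id_right : ∀ α, vcomp α (id₂ (tgt₂ α)) = α
  vcomp_assoc : ∀ α β γ, tgt₂ α = src₂ β → tgt₂ β = src₂ γ →
    vcomp (vcomp α β) γ = vcomp α (vcomp β γ)
  hcomp_id₂ : ∀ f g, tgt₁ f = src₁ g → hcomp (id₂ f) (id₂ g) = id₂ (comp f g)
  hcomp_id_left : ∀ α, hcomp (id₂ (id₁ (src₁ (src₂ α)))) α = α
  hcomp_id_right : ∀ α, hcomp α (id₂ (id₁ (tgt₁ (src₂ α)))) = α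
  hcomp_assoc : ∀ α β γ, tgt₁ (src₂ α) = src₁ (src₂ β) → tgt₁ (src₂ β) = src₁ (src₂ γ) →
    hcomp (hcomp α β) γ = hcomp α (hcomp β γ)
  exchange : ∀ α β γ δ, tgt₂ α = src₂ β → tgt₂ γ = src₂ δ →
    tgt₁ (src₂ α) = src₁ (src₂ γ) →
    hcomp (vcomp α β) (vcomp γ δ) = vcomp (hcomp α γ) (hcomp β δ)

namespace TwoCat

/-- `β` is a (vertical) inverse of the 2-morphism `α`. -/
def InvPair (C : TwoCat) (α β : C.Cell) : Prop :=
  C.src₂ β = C.tgt₂ α ∧ C.tgt₂ β = C.src₂ α ∧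
  C.vcomp α β = C.id₂ (C.src₂ α) ∧ C.vcomp β α = C.id₂ (C.tgt₂ α)

/-- The 2-morphism `α` is invertible (a 2-isomorphism). -/
def Invertible2 (C : TwoCat) (α : C.Cell) : Prop := ∃ β, C.InvPair α β

/-- The 1-morphisms `f` and `g` are 2-isomorphic. -/
def Iso2 (C : TwoCat) (f g : C.Mor) : Prop :=
  ∃ α, C.src₂ α = f ∧ C.tgt₂ α = g ∧ C.Invertible2 α

/-- The 1-morphism `f` is an equivalence. -/
def IsEquiv₁ (C : TwoCat) (f : C.Mor) : Prop :=
  ∃ g, C.src₁ g = C.tgt₁ f ∧ C.tgt₁ g = C.src₁ f ∧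
    C.Iso2 (C.comp f g) (C.id₁ (C.src₁ f)) ∧ C.Iso2 (C.comp g f) (C.id₁ (C.tgt₁ f))

end TwoCat
/-! ## Semistrict monoidal 2-categories (Kapranov–Voevodsky), as in HDA1
Lemma 4: conditions (i)–(viii). -/

structure MonTwoCat extends TwoCat where
  unit : Obj
  tOO : Obj → Obj → Obj
  tOM : Obj → Mor → Mor
  tMO : Mor → Obj → Mor
  tOC : Obj → Cell → Cell
  tCO : Cell → Obj → Cell
  tensorator : Mor → Mor → Cell
  tensoratorInv : Mor → Mor → Cell
  -- source/target specifications
  tOM_src : ∀ A f, src₁ (tOM A f) = tOO A (src₁ f)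
  tOM_tgt : ∀ A f, tgt₁ (tOM A f) = tOO A (tgt₁ f)
  tMO_src : ∀ f A, src₁ (tMO f A) = tOO (src₁ f) A
  tMO_tgt : ∀ f A, tgt₁ (tMO f A) = tOO (tgt₁ f) A
  tOC_src : ∀ A α, src₂ (tOC A α) = tOM A (src₂ α)
  tOC_tgt : ∀ A α, tgt₂ (tOC A α) = tOM A (tgt₂ α)
  tCO_src : ∀ α A, src₂ (tCO α A) = tMO (src₂ α) A
  tCO_tgt : ∀ α A, tgt₂ (tCO α A) = tMO (tgt₂ α) A
  tensorator_src : ∀ f g, src₂ (tensorator f g) = comp (tOM (src₁ f) g) (tMO f (tgt₁ g))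
  tensorator_tgt : ∀ f g, tgt₂ (tensorator f g) = comp (tMO f (src₁ g)) (tOM (tgt₁ f) g)
  tensorator_inv : ∀ f g,
    src₂ (tensoratorInv f g) = tgt₂ (tensorator f g) ∧
    tgt₂ (tensoratorInv f g) = src₂ (tensorator f g) ∧
    vcomp (tensorator f g) (tensoratorInv f g) = id₂ (src₂ (tensorator f g)) ∧
    vcomp (tensoratorInv f g) (tensorator f g) = id₂ (tgt₂ (tensorator f g))
  -- (i) for any object A, `A ⊗ -` and `- ⊗ A` are 2-functors
  tOM_id : ∀ A B, tOM A (id₁ B) = id₁ (tOO A B)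
  tMO_id : ∀ A B, tMO (id₁ A) B = id₁ (tOO A B)
  tOC_id : ∀ A f, tOC A (id₂ f) = id₂ (tOM A f)
  tCO_id : ∀ f A, tCO (id₂ f) A = id₂ (tMO f A)
  tOM_comp : ∀ A f g, tgt₁ f = src₁ g → tOM A (comp f g) = comp (tOM A f) (tOM A g)
  tMO_comp : ∀ f g A, tgt₁ f = src₁ g → tMO (comp f g) A = comp (tMO f A) (tMO g A)
  tOC_vcomp : ∀ A α β, tgt₂ α = src₂ β → tOC A (vcomp α β) = vcomp (tOC A α) (tOC A β)
  tCO_vcomp : ∀ α β A, tgt₂ α = src₂ β → tCO (vcomp α β) A = vcomp (tCO α A) (tCO β A)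
  tOC_hcomp : ∀ A α β, tgt₁ (src₂ α) = src₁ (src₂ β) →
    tOC A (hcomp α β) = hcomp (tOC A α) (tOC A β)
  tCO_hcomp : ∀ α β A, tgt₁ (src₂ α) = src₁ (src₂ β) →
    tCO (hcomp α β) A = hcomp (tCO α A) (tCO β A)
  -- (ii) the unit object
  tOO_unit_left : ∀ A, tOO unit A = A
  tOO_unit_right : ∀ A, tOO A unit = A
  tOM_unit : ∀ f, tOM unit f = f
  tMO_unit : ∀ f, tMO f unit = f
  tOC_unit : ∀ α, tOC unit α = α
  tCO_unit : ∀ α, tCO α unit = α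
  -- (iii) strict associativity of tensoring by objects
  tOO_assoc : ∀ A B D, tOO A (tOO B D) = tOO (tOO A B) D
  tOM_assoc : ∀ A B f, tOM A (tOM B f) = tOM (tOO A B) f
  tOMO_assoc : ∀ A f B, tOM A (tMO f B) = tMO (tOM A f) B
  tMO_assoc : ∀ f A B, tMO f (tOO A B) = tMO (tMO f A) B
  tOC_assoc : ∀ A B α, tOC A (tOC B α) = tOC (tOO A B) α
  tOCO_assoc : ∀ A α B, tOC A (tCO α B) = tCO (tOC A α) B
  tCO_assoc : ∀ α A B, tCO α (tOO A B) = tCO (tCO α A) B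
  -- (iv) the tensorator and tensoring by objects
  tens_OM : ∀ A g h, tensorator (tOM A g) h = tOC A (tensorator g h)
  tens_MO_OM : ∀ f B h, tensorator (tMO f B) h = tensorator f (tOM B h)
  tens_MO : ∀ f g D, tensorator f (tMO g D) = tCO (tensorator f g) D
  -- (v) the tensorator on identities
  tens_id_left : ∀ A g, tensorator (id₁ A) g = id₂ (tOM A g)
  tens_id_right : ∀ f B, tensorator f (id₁ B) = id₂ (tMO f B)
  -- (vi) naturality of the tensorator in its second argument
  tens_nat_right : ∀ f β,
    vcomp (hcomp (tOC (src₁ f) β) (id₂ (tMO f (tgt₁ (src₂ β))))) (tensorator f (tgt₂ β))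
    = vcomp (tensorator f (src₂ β)) (hcomp (id₂ (tMO f (src₁ (src₂ β)))) (tOC (tgt₁ f) β))
  -- (vii) naturality of the tensorator in its first argument
  tens_nat_left : ∀ α h,
    vcomp (hcomp (id₂ (tOM (src₁ (src₂ α)) h)) (tCO α (tgt₁ h))) (tensorator (tgt₂ α) h)
    = vcomp (tensorator (src₂ α) h) (hcomp (tCO α (src₁ h)) (id₂ (tOM (tgt₁ (src₂ α)) h)))
  -- (viii) the tensorator and composition
  tens_comp_right : ∀ f g g', tgt₁ g = src₁ g' →
    tensorator f (comp g g')
    = vcomp (hcomp (id₂ (tOM (src₁ f) g)) (tensorator f g'))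
        (hcomp (tensorator f g) (id₂ (tOM (tgt₁ f) g')))
  tens_comp_left : ∀ f f' g, tgt₁ f = src₁ f' →
    tensorator (comp f f') g
    = vcomp (hcomp (tensorator f g) (id₂ (tMO f' (tgt₁ g))))
        (hcomp (id₂ (tMO f (src₁ g))) (tensorator f' g))
/-! ## Monoidal 2-categories with duals (HDA IV, Definition 6). -/

/-- The duality *data* on a semistrict monoidal 2-category: duals of objects,
1-morphisms and 2-morphisms, units, counits and triangulators, with their
source/target specifications. -/
structure DualsData extends MonTwoCat where
  dObj : Obj → Obj
  dMor : Mor → Mor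
  dCell : Cell → Cell
  iObj : Obj → Mor
  eObj : Obj → Mor
  iCell : Mor → Cell
  eCell : Mor → Cell
  tri : Obj → Cell
  dMor_src : ∀ f, src₁ (dMor f) = tgt₁ f
  dMor_tgt : ∀ f, tgt₁ (dMor f) = src₁ f
  dCell_src : ∀ α, src₂ (dCell α) = tgt₂ α
  dCell_tgt : ∀ α, tgt₂ (dCell α) = src₂ α
  iObj_src : ∀ A, src₁ (iObj A) = unit
  iObj_tgt : ∀ A, tgt₁ (iObj A) = tOO A (dObj A)
  eObj_src : ∀ A, src₁ (eObj A) = tOO (dObj A) A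
  eObj_tgt : ∀ A, tgt₁ (eObj A) = unit
  iCell_src : ∀ f, src₂ (iCell f) = id₁ (src₁ f)
  iCell_tgt : ∀ f, tgt₂ (iCell f) = comp f (dMor f)
  eCell_src : ∀ f, src₂ (eCell f) = comp (dMor f) f
  eCell_tgt : ∀ f, tgt₂ (eCell f) = id₁ (tgt₁ f)
  tri_src : ∀ A, src₂ (tri A) = comp (tMO (iObj A) A) (tOM A (eObj A))
  tri_tgt : ∀ A, tgt₂ (tri A) = id₁ A

namespace DualsData

/-- A 2-morphism is unitary if it is invertible with inverse its dual. -/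
def Unitary (C : DualsData) (α : C.Cell) : Prop :=
  C.vcomp α (C.dCell α) = C.id₂ (C.src₂ α) ∧ C.vcomp (C.dCell α) α = C.id₂ (C.tgt₂ α)

/-- The adjoint `α† = (g* i_f) ⋅ (g* α f*) ⋅ (e_g f*)` of a 2-morphism `α : f ⇒ g`. -/
def adj (C : DualsData) (α : C.Cell) : C.Cell :=
  C.vcomp (C.vcomp
    (C.hcomp (C.id₂ (C.dMor (C.tgt₂ α))) (C.iCell (C.src₂ α)))
    (C.hcomp (C.hcomp (C.id₂ (C.dMor (C.tgt₂ α))) α) (C.id₂ (C.dMor (C.src₂ α)))))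
    (C.hcomp (C.eCell (C.tgt₂ α)) (C.id₂ (C.dMor (C.src₂ α))))

end DualsData

/-- The thirteen conditions in the definition of a monoidal 2-category with
duals (HDA IV, Definition 6). -/
structure DualsLaws (C : DualsData) : Prop where
  -- 1. `X** = X`
  dObj_invol : ∀ A, C.dObj (C.dObj A) = A
  dMor_invol : ∀ f, C.dMor (C.dMor f) = f
  dCell_invol : ∀ α, C.dCell (C.dCell α) = α
  -- 2. `1_X* = 1_X`
  dMor_id : ∀ A, C.dMor (C.id₁ A) = C.id₁ A
  dCell_id : ∀ f, C.dCell (C.id₂ f) = C.id₂ f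
  -- 3. behaviour of duals under composition and tensoring
  dCell_vcomp : ∀ α β, C.tgt₂ α = C.src₂ β →
    C.dCell (C.vcomp α β) = C.vcomp (C.dCell β) (C.dCell α)
  dCell_hcomp : ∀ α β, C.tgt₁ (C.src₂ α) = C.src₁ (C.src₂ β) →
    C.dCell (C.hcomp α β) = C.hcomp (C.dCell α) (C.dCell β)
  dMor_comp : ∀ f g, C.tgt₁ f = C.src₁ g →
    C.dMor (C.comp f g) = C.comp (C.dMor g) (C.dMor f)
  dCell_tOC : ∀ A α, C.dCell (C.tOC A α) = C.tOC A (C.dCell α)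
  dCell_tCO : ∀ α A, C.dCell (C.tCO α A) = C.tCO (C.dCell α) A
  dMor_tOM : ∀ A f, C.dMor (C.tOM A f) = C.tOM A (C.dMor f)
  dMor_tMO : ∀ f A, C.dMor (C.tMO f A) = C.tMO (C.dMor f) A
  dObj_tOO : ∀ A B, C.dObj (C.tOO A B) = C.tOO (C.dObj B) (C.dObj A)
  -- 4. the tensorator is unitary
  tensorator_unitary : ∀ f g, C.Unitary (C.tensorator f g)
  -- 5. `i_{X*} = e_X*` and `e_{X*} = i_X*`
  iObj_dual : ∀ A, C.iObj (C.dObj A) = C.dMor (C.eObj A)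
  eObj_dual : ∀ A, C.eObj (C.dObj A) = C.dMor (C.iObj A)
  iCell_dual : ∀ f, C.iCell (C.dMor f) = C.dCell (C.eCell f)
  eCell_dual : ∀ f, C.eCell (C.dMor f) = C.dCell (C.iCell f)
  -- 6. the triangulator is unitary
  tri_unitary : ∀ A, C.Unitary (C.tri A)
  -- 7. `T_I = 1_{1_I}`
  tri_unit : C.tri C.unit = C.id₂ (C.id₁ C.unit)
  -- 8. units, counits and triangulators of tensor products
  iObj_tensor : ∀ A B, C.iObj (C.tOO A B)
    = C.comp (C.iObj A) (C.tOM A (C.tMO (C.iObj B) (C.dObj A)))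
  eObj_tensor : ∀ A B, C.eObj (C.tOO A B)
    = C.comp (C.tOM (C.dObj B) (C.tMO (C.eObj A) B)) (C.eObj B)
  tri_tensor : ∀ A B, C.tri (C.tOO A B) =
    C.vcomp (C.hcomp (C.id₂ (C.tMO (C.iObj A) (C.tOO A B)))
        (C.hcomp (C.tOC A (C.tCO (C.tensoratorInv (C.iObj B) (C.eObj A)) B))
          (C.id₂ (C.tOM (C.tOO A B) (C.eObj B)))))
      (C.hcomp (C.tCO (C.tri A) B) (C.tOC A (C.tri B)))
  -- 9. units and counits of tensor products with objects
  iCell_tOM : ∀ A f, C.iCell (C.tOM A f) = C.tOC A (C.iCell f)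
  iCell_tMO : ∀ f A, C.iCell (C.tMO f A) = C.tCO (C.iCell f) A
  eCell_tOM : ∀ A f, C.eCell (C.tOM A f) = C.tOC A (C.eCell f)
  eCell_tMO : ∀ f A, C.eCell (C.tMO f A) = C.tCO (C.eCell f) A
  -- 10. units and counits of composites
  iCell_comp : ∀ f g, C.tgt₁ f = C.src₁ g → C.iCell (C.comp f g)
    = C.vcomp (C.iCell f) (C.hcomp (C.hcomp (C.id₂ f) (C.iCell g)) (C.id₂ (C.dMor f)))
  eCell_comp : ∀ f g, C.tgt₁ f = C.src₁ g → C.eCell (C.comp f g)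
    = C.vcomp (C.hcomp (C.hcomp (C.id₂ (C.dMor g)) (C.eCell f)) (C.id₂ g)) (C.eCell g)
  -- 11. the triangle identities
  triangle₁ : ∀ f,
    C.vcomp (C.hcomp (C.iCell f) (C.id₂ f)) (C.hcomp (C.id₂ f) (C.eCell f)) = C.id₂ f
  triangle₂ : ∀ f,
    C.vcomp (C.hcomp (C.id₂ (C.dMor f)) (C.iCell f))
      (C.hcomp (C.eCell f) (C.id₂ (C.dMor f))) = C.id₂ (C.dMor f)
  -- 12. `α†* = α*†`
  adj_star : ∀ α, C.dCell (C.adj α) = C.adj (C.dCell α)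
  -- 13. the swallowtail coherence law
  swallowtail : ∀ A,
    C.vcomp (C.vcomp
      (C.hcomp (C.id₂ (C.iObj A)) (C.tOC A (C.adj (C.tri (C.dObj A)))))
      (C.hcomp (C.tensoratorInv (C.iObj A) (C.iObj A))
        (C.id₂ (C.tOM A (C.tMO (C.eObj A) (C.dObj A))))))
      (C.hcomp (C.id₂ (C.iObj A)) (C.tCO (C.tri A) (C.dObj A)))
    = C.id₂ (C.iObj A)
/-- **In any monoidal 2-category with duals, the equational laws involving
counits are consequences of those involving units by taking duals**:
the equation `e_{A⊗B} = (B*⊗e_A⊗B) e_B` for all objects `A, B` follows from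
`i_{A⊗B} = i_A (A⊗i_B⊗A*)` (holding for all objects) together with the other
duality axioms — `(fg)* = g*f*`, `(A⊗B)* = B*⊗A*`, `(A⊗f)* = A⊗f*`,
`(f⊗A)* = f*⊗A`, `i_{X*} = e_X*`, and `X** = X`; and either of the equations
`i_{X*} = e_X*` and `e_{X*} = i_X*` implies the other. -/
theorem counit_laws_from_unit_laws (C : DualsData)
    -- the relevant duality axioms
    (h_dMor_comp : ∀ f g, C.tgt₁ f = C.src₁ g →
      C.dMor (C.comp f g) = C.comp (C.dMor g) (C.dMor f))
    (h_dObj_tOO : ∀ A B, C.dObj (C.tOO A B) = C.tOO (C.dObj B) (C.dObj A))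
    (h_dMor_tOM : ∀ A f, C.dMor (C.tOM A f) = C.tOM A (C.dMor f))
    (h_dMor_tMO : ∀ f A, C.dMor (C.tMO f A) = C.tMO (C.dMor f) A)
    (h_dObj_invol : ∀ A, C.dObj (C.dObj A) = A)
    (h_dMor_invol : ∀ f, C.dMor (C.dMor f) = f) :
    -- first claim: the unit law for tensor products implies the counit law
    ((∀ A, C.iObj (C.dObj A) = C.dMor (C.eObj A)) →
      (∀ A B, C.iObj (C.tOO A B)
          = C.comp (C.iObj A) (C.tOM A (C.tMO (C.iObj B) (C.dObj A)))) →
      ∀ A B, C.eObj (C.tOO A B)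
        = C.comp (C.tOM (C.dObj B) (C.tMO (C.eObj A) B)) (C.eObj B)) ∧
    -- second claim: each of `i_{X*} = e_X*` and `e_{X*} = i_X*` implies the
    -- other (for objects, and likewise for 1-morphisms)
    (((∀ A, C.iObj (C.dObj A) = C.dMor (C.eObj A)) ↔
        (∀ A, C.eObj (C.dObj A) = C.dMor (C.iObj A))) ∧
      ((∀ f, C.dCell (C.dCell f) = f) → (∀ f, C.dMor (C.dMor f) = f) →
        ((∀ f, C.iCell (C.dMor f) = C.dCell (C.eCell f)) ↔
          (∀ f, C.eCell (C.dMor f) = C.dCell (C.iCell f))))) := by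
  refine ⟨fun hi ht A B => ?_, ⟨fun hi A => ?_, fun he A => ?_⟩,
    fun hC hM => ⟨fun hi f => ?_, fun he f => ?_⟩⟩
  · have hcomp : C.tgt₁ (C.iObj (C.dObj B)) =
        C.src₁ (C.tOM (C.dObj B) (C.tMO (C.iObj (C.dObj A)) (C.dObj (C.dObj B)))) := by
      rw [C.iObj_tgt, C.tOM_src, C.tMO_src, C.iObj_src, C.tOO_unit_left]
    rw [← h_dMor_invol (C.eObj (C.tOO A B)), ← hi, h_dObj_tOO, ht, h_dMor_comp _ _ hcomp,
      h_dMor_tOM, h_dMor_tMO, hi, hi, h_dMor_invol, h_dMor_invol, h_dObj_invol]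
  · rw [← h_dMor_invol (C.eObj (C.dObj A)), ← hi, h_dObj_invol]
  · rw [← h_dMor_invol (C.iObj (C.dObj A)), ← he, h_dObj_invol]
  · rw [← hC (C.eCell (C.dMor f)), ← hi, hM]
  · rw [← hC (C.iCell (C.dMor f)), ← he, hM]
end
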